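/- arXiv:2412.18336 — 3 statements merged into one kernel-verified Lean document; each statement's English description precedes it below -/
import Mathlib

section
/- For every integer k ≥ 2 there exists n₀ ∈ ℕ such that for every n ≥ n₀ the following holds: if G is an n-vertex oriented graph with minimum semi-degree δ⁰(G) ≥ (1/2 − 1/10^{6000k})n, then G contains the kth power of a Hamilton cycle. -/
namespace Paper

/-- `G` is a digraph: a loopless directed graph (edges in both directions allowed). -/
def IsDigraph {n : ℕ} (G : Fin n → Fin n → Prop) : Prop := ∀ v, ¬ G v v

/-- `G` is an oriented graph: no loops and at most one directed edge per pair. -/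
def IsOriented {n : ℕ} (G : Fin n → Fin n → Prop) : Prop := ∀ u v, G u v → ¬ G v u

/-- Out-degree of `v` in `G`. -/
noncomputable def outDeg {n : ℕ} (G : Fin n → Fin n → Prop) (v : Fin n) : ℕ :=
  {w | G v w}.ncard

/-- In-degree of `v` in `G`. -/
noncomputable def inDeg {n : ℕ} (G : Fin n → Fin n → Prop) (v : Fin n) : ℕ :=
  {w | G w v}.ncard

/-- `G` contains the `k`-th power of a Hamilton cycle: a cyclic ordering `f` of all the
vertices such that each vertex sends an edge to the next `k` vertices (indices mod `n`). -/
def HasPowHamCycle {n : ℕ} (k : ℕ) (G : Fin n → Fin n → Prop) : Prop :=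
  ∃ f : Fin n ≃ Fin n, ∀ (i : Fin n) (j : ℕ), 1 ≤ j → j ≤ k →
    G (f i) (f ⟨((i : ℕ) + j) % n, Nat.mod_lt _ (Nat.lt_of_le_of_lt (Nat.zero_le _) i.isLt)⟩)

/-- `P` is a `k`-path in `G` (the `k`-th power of a directed path): a list of distinct
vertices in which every vertex sends an edge to each of the next `k` vertices. -/
def IsKPath {n : ℕ} (k : ℕ) (G : Fin n → Fin n → Prop) (P : List (Fin n)) : Prop :=
  P.Nodup ∧ ∀ i j : Fin P.length, (i : ℕ) < (j : ℕ) → (j : ℕ) ≤ (i : ℕ) + k →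
    G (P.get i) (P.get j)

open Finset
open scoped Classical

section Digraph

variable {V : Type*} {G : V → V → Prop}

/-- The out-neighbours of `v` inside `R`. -/
noncomputable def outIn (G : V → V → Prop) (v : V) (R : Finset V) : Finset V :=
  R.filter fun w => G v w

/-- The in-neighbours of `v` inside `R`. -/
noncomputable def innIn (G : V → V → Prop) (v : V) (R : Finset V) : Finset V :=
  R.filter fun w => G w v

/-- The vertices of `R` not adjacent to `v`. -/
noncomputable def nonIn (G : V → V → Prop) (v : V) (R : Finset V) : Finset V :=
  R.filter fun w => ¬ G v w ∧ ¬ G w v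

/-- The common out-neighbours inside `R` of the vertices of a list. -/
noncomputable def commonOut (G : V → V → Prop) (l : List V) (R : Finset V) : Finset V :=
  R.filter fun w => ∀ x ∈ l, G x w

/-- The common in-neighbours inside `R` of the vertices of a list. -/
noncomputable def commonIn (G : V → V → Prop) (l : List V) (R : Finset V) : Finset V :=
  R.filter fun w => ∀ x ∈ l, G w x

/-- The transitive `k`-tuples with entries in `A`. -/
noncomputable def transTuples (G : V → V → Prop) (k : ℕ) (A : Finset V) : Finset (Fin k → V) :=
  (Fintype.piFinset fun _ => A).filter fun f => ∀ i j, i < j → G (f i) (f j)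

lemma mem_transTuples {k : ℕ} {A : Finset V} {f : Fin k → V} :
    f ∈ transTuples G k A ↔ (∀ i, f i ∈ A) ∧ ∀ i j, i < j → G (f i) (f j) := by
  simp [transTuples]

lemma sum_card_outIn_eq (A B : Finset V) :
    ∑ a ∈ A, (#(outIn G a B) : ℝ) = ∑ b ∈ B, (#(innIn G b A) : ℝ) := by
  have := Finset.sum_card_bipartiteAbove_eq_sum_card_bipartiteBelow (s := A) (t := B) G
  exact_mod_cast this

lemma card_out_add_inn_add_non (hG : ∀ u v, G u v → ¬ G v u) (v : V) (R : Finset V) :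
    (#(outIn G v R) : ℝ) + #(innIn G v R) + #(nonIn G v R) = #R := by
  have h1 := Finset.card_filter_add_card_filter_not (s := R) (fun w => G v w)
  have h2 := Finset.card_filter_add_card_filter_not
    (s := R.filter fun w => ¬ G v w) (fun w => G w v)
  have h3 : (R.filter fun w => ¬ G v w).filter (fun w => G w v) = innIn G v R := by
    ext w; simp only [innIn, mem_filter]; have := hG w v; tauto
  have h4 : (R.filter fun w => ¬ G v w).filter (fun w => ¬ G w v) = nonIn G v R := by
    ext w; simp only [nonIn, mem_filter]; tauto
  rw [h3, h4] at h2
  have : #(outIn G v R) + #(innIn G v R) + #(nonIn G v R) = #R := by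
    rw [← h1, ← h2, outIn]; ring
  exact_mod_cast this

lemma two_mul_sum_outIn_le (hG : ∀ u v, G u v → ¬ G v u) (U : Finset V) :
    2 * ∑ u ∈ U, (#(outIn G u U) : ℝ) ≤ (#U : ℝ) ^ 2 := by
  have h := sum_card_outIn_eq (G := G) U U
  have h2 : ∑ u ∈ U, ((#(outIn G u U) : ℝ) + #(innIn G u U)) ≤ ∑ u ∈ U, (#U : ℝ) := by
    refine Finset.sum_le_sum fun u _ => ?_
    have := card_out_add_inn_add_non hG u U
    have : (0 : ℝ) ≤ #(nonIn G u U) := by positivity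
    linarith
  rw [Finset.sum_add_distrib, ← h, Finset.sum_const, nsmul_eq_mul] at h2
  nlinarith

lemma le_two_mul_sum_outIn (hG : ∀ u v, G u v → ¬ G v u) (U : Finset V) {t : ℝ}
    (ht : ∀ v, (#(nonIn G v U) : ℝ) ≤ t) :
    (#U : ℝ) * (#U - t) ≤ 2 * ∑ u ∈ U, (#(outIn G u U) : ℝ) := by
  have h := sum_card_outIn_eq (G := G) U U
  have h2 : ∑ u ∈ U, ((#U : ℝ) - t) ≤ ∑ u ∈ U, ((#(outIn G u U) : ℝ) + #(innIn G u U)) := by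
    refine Finset.sum_le_sum fun u _ => ?_
    have := card_out_add_inn_add_non hG u U
    have := ht u
    linarith
  rw [Finset.sum_add_distrib, ← h, Finset.sum_const, nsmul_eq_mul] at h2
  linarith

/-- Reverse Markov inequality: a sum of terms bounded by `M` with all terms outside a set at most
`m` forces that set to be large. -/
lemma sum_le_card_filter_mul_add {ι : Type*} (s : Finset ι) (f : ι → ℝ) {m M : ℝ}
    (hM : ∀ i ∈ s, f i ≤ M) (hm : 0 ≤ m) :
    ∑ i ∈ s, f i ≤ #(s.filter fun i => m ≤ f i) * M + #s * m := by
  rw [← Finset.sum_filter_add_sum_filter_not s (fun i => m ≤ f i)]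
  gcongr ?_ + ?_
  · rw [← nsmul_eq_mul]
    exact Finset.sum_le_card_nsmul _ _ _ fun i hi => hM i (Finset.mem_filter.1 hi).1
  · refine (Finset.sum_le_card_nsmul _ _ m fun i hi => ?_).trans ?_
    · exact (not_le.1 (Finset.mem_filter.1 hi).2).le
    · rw [nsmul_eq_mul]
      gcongr
      exact Finset.filter_subset _ _

lemma nonIn_mono {A B : Finset V} (h : A ⊆ B) (v : V) : nonIn G v A ⊆ nonIn G v B :=
  Finset.filter_subset_filter _ h

lemma sum_card_transTuples_le (k : ℕ) (U W : Finset V) (hW : W ⊆ U) :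
    ∑ x ∈ W, #(transTuples G k (outIn G x U)) ≤ #(transTuples G (k + 1) U) := by
  rw [← Finset.card_sigma]
  refine Finset.card_le_card_of_injOn (fun p => (Fin.cons p.1 p.2 : Fin (k + 1) → V)) ?_ ?_
  · rintro ⟨x, f⟩ h
    simp only [coe_sigma, Set.mem_sigma_iff, mem_coe, mem_transTuples, outIn, mem_filter] at h ⊢
    refine ⟨fun i => ?_, fun i j hij => ?_⟩
    · refine Fin.cases ?_ (fun i => ?_) i
      · simpa using hW h.1
      · simpa using (h.2.1 i).1
    · induction j using Fin.cases with
      | zero => exact absurd hij (Fin.not_lt_zero _)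
      | succ j =>
        induction i using Fin.cases with
        | zero => simpa using (h.2.1 j).2
        | succ i => simpa using h.2.2 i j (Fin.succ_lt_succ_iff.1 hij)
  · rintro ⟨x, f⟩ _ ⟨y, g⟩ _ h
    obtain ⟨h1, h2⟩ := Fin.cons_injective2 h
    subst h1 h2
    rfl

/-- Supersaturation of transitive tuples in a nearly complete oriented graph. -/
lemma card_transTuples_ge (hG : ∀ u v, G u v → ¬ G v u) {t : ℝ} (ht0 : 0 ≤ t) (k : ℕ) :
    ∀ U : Finset V, (∀ v, (#(nonIn G v U) : ℝ) ≤ t) → 10 * 4 ^ k * t ≤ #U →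
      ((#U : ℝ) / 5 ^ k) ^ k ≤ #(transTuples G k U) := by
  induction k with
  | zero =>
    intro U _ _
    have : transTuples G 0 U = {Fin.elim0} := by
      ext f; simp [mem_transTuples, eq_iff_true_of_subsingleton]
    simp [this]
  | succ k ih =>
    intro U hU hcard
    set W := U.filter fun u => (#U : ℝ) / 4 ≤ #(outIn G u U) with hWdef
    have h10 : 10 * t ≤ #U := by
      refine le_trans ?_ hcard
      have : (1 : ℝ) ≤ 4 ^ (k + 1) := one_le_pow₀ (by norm_num)
      nlinarith
    have hW : (#U : ℝ) / 5 ≤ #W := by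
      rcases (Nat.cast_nonneg (α := ℝ) #U).eq_or_lt with h0 | h0
      · rw [← h0]; simp
      have h1 := le_two_mul_sum_outIn hG U hU
      have h2 := sum_le_card_filter_mul_add U (fun u => (#(outIn G u U) : ℝ)) (m := (#U : ℝ) / 4)
        (M := #U) (fun i _ => by exact_mod_cast Finset.card_le_card (Finset.filter_subset _ _))
        (by positivity)
      rw [← hWdef] at h2
      have h3 : (#U : ℝ) * (#U / 5) ≤ #U * #W := by nlinarith
      exact le_of_mul_le_mul_left h3 h0
    have hstep : ∀ x ∈ W, ((#U : ℝ) / 5 ^ (k + 1)) ^ k ≤ #(transTuples G k (outIn G x U)) := by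
      intro x hx
      have hx' := (Finset.mem_filter.1 hx).2
      refine le_trans ?_ (ih (outIn G x U) (fun v => ?_) ?_)
      · rw [pow_succ 5 k]
        gcongr ?_ ^ k
        rw [mul_comm, ← div_div]
        gcongr
        linarith [(Nat.cast_nonneg (α := ℝ) #U)]
      · refine le_trans ?_ (hU v)
        exact_mod_cast Finset.card_le_card (nonIn_mono (Finset.filter_subset _ _) v)
      · rw [pow_succ] at hcard
        linarith
    have h1 : (#W : ℝ) * ((#U : ℝ) / 5 ^ (k + 1)) ^ k
        ≤ ∑ x ∈ W, (#(transTuples G k (outIn G x U)) : ℝ) := by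
      rw [← nsmul_eq_mul]
      exact Finset.card_nsmul_le_sum _ _ _ hstep
    have h2 : (∑ x ∈ W, (#(transTuples G k (outIn G x U)) : ℝ)) ≤ #(transTuples G (k + 1) U) := by
      exact_mod_cast sum_card_transTuples_le k U W (Finset.filter_subset _ _)
    refine le_trans ?_ (h1.trans h2)
    rw [pow_succ, mul_comm]
    gcongr
    refine le_trans ?_ hW
    gcongr
    exact le_self_pow₀ (by norm_num) (by omega)

/-- The density guaranteed by dependent random choice for `k`-tuples at density `δ`. -/
noncomputable def drcBeta (δ : ℝ) (k : ℕ) : ℝ := δ ^ (k + 1) / (8 * 5 ^ k)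

/-- The proportion of tuples guaranteed by dependent random choice. -/
noncomputable def drcGamma (δ : ℝ) (k : ℕ) : ℝ := δ ^ k / 4 * (δ ^ k / (2 * 5 ^ k)) ^ k

lemma drcBeta_pos {δ : ℝ} (hδ : 0 < δ) (k : ℕ) : 0 < drcBeta δ k := by
  unfold drcBeta; positivity

lemma drcGamma_pos {δ : ℝ} (hδ : 0 < δ) (k : ℕ) : 0 < drcGamma δ k := by
  unfold drcGamma; positivity

lemma drcBeta_pow_le {δ : ℝ} (hδ : 0 < δ) {k : ℕ} (hk : 1 ≤ k) :
    drcBeta δ k ^ k ≤ drcGamma δ k := by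
  unfold drcBeta drcGamma
  have h1 : (δ ^ (k + 1) / (8 * 5 ^ k)) ^ k = δ ^ k * (δ ^ k / (2 * 5 ^ k)) ^ k / 4 ^ k := by
    rw [← mul_pow, ← div_pow]
    congr 1
    rw [pow_succ]
    field_simp
    norm_num
  have h2 : (4 : ℝ) ≤ 4 ^ k := le_self_pow₀ (by norm_num) (by omega)
  rw [h1, div_mul_eq_mul_div]
  gcongr

/-- Dependent random choice: if every vertex of `A` has a neighbourhood of density `δ` in `S`, then
a positive proportion of the `k`-tuples in `A` are transitive and have a common neighbourhood of
density `drcBeta δ k` in `S`. -/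
lemma dependent_random_choice (hG : ∀ u v, G u v → ¬ G v u) {Ω : Type*} (S : Finset Ω)
    (N : V → Ω → Prop) (A : Finset V) {δ t : ℝ} (hδ : 0 < δ) (ht0 : 0 ≤ t) {k : ℕ} (hk : 1 ≤ k)
    (hN : ∀ a ∈ A, δ * #S ≤ #(S.filter (N a))) (hS : S.Nonempty)
    (ht : ∀ v, (#(nonIn G v A) : ℝ) ≤ t) (hA : 20 * 4 ^ k * t ≤ δ ^ k * #A) :
    drcGamma δ k * #A ^ k ≤ #((transTuples G k A).filter fun f =>
      drcBeta δ k * #S ≤ #(S.filter fun ω => ∀ i, N (f i) ω)) := by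
  set P : Finset (Fin k → Ω) := Fintype.piFinset fun _ => S with hP
  have hPcard : (#P : ℝ) = #S ^ k := by simp [hP]
  have hSpos : (0 : ℝ) < #S := by exact_mod_cast hS.card_pos
  set Ab : (Fin k → Ω) → Finset V := fun b => A.filter fun a => ∀ i, N a (b i) with hAb
  have hsum : ∑ b ∈ P, (#(Ab b) : ℝ) = ∑ a ∈ A, (#(S.filter (N a)) : ℝ) ^ k := by
    have := Finset.sum_card_bipartiteAbove_eq_sum_card_bipartiteBelow (s := P) (t := A)
      (fun b a => ∀ i, N a (b i))
    have h2 : ∀ a, Finset.bipartiteBelow (fun (b : Fin k → Ω) a => ∀ i, N a (b i)) P a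
        = Fintype.piFinset fun _ => S.filter (N a) := by
      intro a; ext b
      simp [Finset.bipartiteBelow, hP, forall_and]
    simp only [h2, Fintype.card_piFinset, Finset.prod_const, Finset.card_univ,
      Fintype.card_fin] at this
    exact_mod_cast this
  have hlow : #A * (δ ^ k * #S ^ k) ≤ ∑ b ∈ P, (#(Ab b) : ℝ) := by
    rw [hsum, ← nsmul_eq_mul]
    refine Finset.card_nsmul_le_sum _ _ _ fun a ha => ?_
    rw [← mul_pow]
    gcongr
    exact hN a ha
  set m : ℝ := δ ^ k * #A / 2 with hm
  set Pg := P.filter fun b => m ≤ #(Ab b) with hPg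
  have hup := sum_le_card_filter_mul_add P (fun b => (#(Ab b) : ℝ)) (m := m) (M := #A)
    (fun b _ => by exact_mod_cast Finset.card_le_card (Finset.filter_subset _ _)) (by positivity)
  rw [← hPg, hPcard] at hup
  rcases (Nat.cast_nonneg (α := ℝ) #A).eq_or_lt with h0 | h0
  · rw [← h0, zero_pow (by omega), mul_zero]; positivity
  have hPgcard : δ ^ k / 2 * #S ^ k ≤ #Pg := by
    have : #A * (δ ^ k / 2 * #S ^ k) ≤ #A * #Pg := by
      rw [hm] at hup; nlinarith
    exact le_of_mul_le_mul_left this h0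
  have hZ : ∀ b ∈ Pg, (m / 5 ^ k) ^ k ≤ #(transTuples G k (Ab b)) := by
    intro b hb
    have hb' := (Finset.mem_filter.1 hb).2
    refine le_trans (by gcongr) (card_transTuples_ge hG ht0 k (Ab b) (fun v => ?_) ?_)
    · refine le_trans ?_ (ht v)
      exact_mod_cast Finset.card_le_card (nonIn_mono (Finset.filter_subset _ _) v)
    · rw [hm] at hb'; linarith
  have hT : δ ^ k / 2 * #S ^ k * (m / 5 ^ k) ^ k ≤ ∑ b ∈ P, (#(transTuples G k (Ab b)) : ℝ) := by
    calc _ ≤ #Pg * (m / 5 ^ k) ^ k := by gcongr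
      _ ≤ ∑ b ∈ Pg, (#(transTuples G k (Ab b)) : ℝ) := by
        rw [← nsmul_eq_mul]; exact Finset.card_nsmul_le_sum _ _ _ hZ
      _ ≤ _ := Finset.sum_le_sum_of_subset_of_nonneg (Finset.filter_subset _ _)
        fun _ _ _ => by positivity
  have hswap : ∑ b ∈ P, (#(transTuples G k (Ab b)) : ℝ)
      = ∑ f ∈ transTuples G k A, (#(S.filter fun ω => ∀ i, N (f i) ω) : ℝ) ^ k := by
    have := Finset.sum_card_bipartiteAbove_eq_sum_card_bipartiteBelow (s := P)
      (t := transTuples G k A) (fun b f => ∀ j i, N (f i) (b j))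
    have h2 : ∀ f : Fin k → V,
        Finset.bipartiteBelow (fun (b : Fin k → Ω) (f : Fin k → V) => ∀ j i, N (f i) (b j)) P f
        = Fintype.piFinset fun _ => S.filter fun ω => ∀ i, N (f i) ω := by
      intro f; ext b
      simp [Finset.bipartiteBelow, hP, forall_and]
    have h3 : ∀ b : Fin k → Ω, Finset.bipartiteAbove
        (fun (b : Fin k → Ω) (f : Fin k → V) => ∀ j i, N (f i) (b j)) (transTuples G k A) b
        = transTuples G k (Ab b) := by
      intro b; ext f
      simp only [Finset.bipartiteAbove, mem_filter, mem_transTuples, hAb]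
      constructor
      · rintro ⟨⟨h1, h2⟩, h3⟩; exact ⟨fun i => ⟨h1 i, fun j => h3 j i⟩, h2⟩
      · rintro ⟨h1, h2⟩; exact ⟨⟨fun i => (h1 i).1, h2⟩, fun j i => (h1 i).2 j⟩
    simp only [h2, h3, Fintype.card_piFinset, Finset.prod_const, Finset.card_univ,
      Fintype.card_fin] at this
    exact_mod_cast this
  rw [hswap] at hT
  set Tg := (transTuples G k A).filter fun f =>
      drcBeta δ k * #S ≤ #(S.filter fun ω => ∀ i, N (f i) ω) with hTg
  have hbound : ∑ f ∈ transTuples G k A, (#(S.filter fun ω => ∀ i, N (f i) ω) : ℝ) ^ k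
      ≤ #Tg * #S ^ k + #A ^ k * (drcBeta δ k * #S) ^ k := by
    rw [← Finset.sum_filter_add_sum_filter_not _ (fun f : Fin k → V =>
      drcBeta δ k * #S ≤ #(S.filter fun ω => ∀ i, N (f i) ω)), ← hTg]
    gcongr ?_ + ?_
    · rw [← nsmul_eq_mul]
      refine Finset.sum_le_card_nsmul _ _ _ fun f _ => ?_
      gcongr
      exact Finset.filter_subset _ _
    · refine (Finset.sum_le_card_nsmul _ _ ((drcBeta δ k * #S) ^ k) fun f hf => ?_).trans ?_
      · gcongr
        exact (not_le.1 (Finset.mem_filter.1 hf).2).le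
      · rw [nsmul_eq_mul]
        have := drcBeta_pos hδ k
        gcongr
        have h4 : #((transTuples G k A).filter fun f =>
            ¬ drcBeta δ k * #S ≤ #(S.filter fun ω => ∀ i, N (f i) ω))
            ≤ #(Fintype.piFinset fun _ : Fin k => A) :=
          Finset.card_le_card ((Finset.filter_subset _ _).trans (Finset.filter_subset _ _))
        rw [Fintype.card_piFinset, Finset.prod_const, Finset.card_univ, Fintype.card_fin] at h4
        exact_mod_cast h4
  have hfin := hT.trans hbound
  have hSk : (0 : ℝ) < #S ^ k := by positivity
  have hβ := drcBeta_pow_le hδ hk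
  have e1 : δ ^ k / 2 * #S ^ k * (m / 5 ^ k) ^ k
      = #S ^ k * (2 * (drcGamma δ k * #A ^ k)) := by
    have : m / 5 ^ k = δ ^ k / (2 * 5 ^ k) * #A := by rw [hm]; field_simp
    rw [this, mul_pow, drcGamma]; ring
  have hAk : (0 : ℝ) ≤ #A ^ k := by positivity
  have h5 : #S ^ k * (drcGamma δ k * #A ^ k) ≤ #S ^ k * #Tg := by
    rw [e1, mul_pow] at hfin
    have h6 : (#A : ℝ) ^ k * (drcBeta δ k ^ k * #S ^ k) ≤ #A ^ k * (drcGamma δ k * #S ^ k) := by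
      gcongr
    nlinarith
  exact le_of_mul_le_mul_left h5 hSk

lemma exists_transitive_list (hG : ∀ u v, G u v → ¬ G v u) {Ω : Type*} (S : Finset Ω)
    (N : V → Ω → Prop) (A : Finset V) {δ t : ℝ} (hδ : 0 < δ) (ht0 : 0 ≤ t) {k : ℕ} (hk : 1 ≤ k)
    (hN : ∀ a ∈ A, δ * #S ≤ #(S.filter (N a))) (hS : S.Nonempty)
    (ht : ∀ v, (#(nonIn G v A) : ℝ) ≤ t) (hA : 20 * 4 ^ k * t ≤ δ ^ k * #A) (hA0 : A.Nonempty) :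
    ∃ l : List V, l.length = k ∧ l.Pairwise G ∧ (∀ x ∈ l, x ∈ A) ∧
      drcBeta δ k * #S ≤ #(S.filter fun ω => ∀ x ∈ l, N x ω) := by
  have h := dependent_random_choice hG S N A hδ ht0 hk hN hS ht hA
  have hpos : (0 : ℝ) < drcGamma δ k * #A ^ k := by
    have := drcGamma_pos hδ k
    have : (0 : ℝ) < #A := by exact_mod_cast hA0.card_pos
    positivity
  obtain ⟨f, hf⟩ := Finset.card_pos.1 (by exact_mod_cast hpos.trans_le h)
  obtain ⟨hf1, hf2⟩ := Finset.mem_filter.1 hf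
  obtain ⟨hf3, hf4⟩ := mem_transTuples.1 hf1
  refine ⟨List.ofFn f, by simp, List.pairwise_ofFn.2 fun i j hij => hf4 i j hij, ?_, ?_⟩
  · simpa [List.mem_ofFn] using hf3
  · simpa [List.mem_ofFn] using hf2

/-- A set into which every vertex has in- and out-degree of proportion at least `9/20`, and at most
a proportion `τ` of non-neighbours. -/
structure IsReservoir (G : V → V → Prop) (τ : ℝ) (R : Finset V) : Prop where
  out_le : ∀ v, 9 / 20 * (#R : ℝ) ≤ #(outIn G v R)
  inn_le : ∀ v, 9 / 20 * (#R : ℝ) ≤ #(innIn G v R)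
  non_le : ∀ v, (#(nonIn G v R) : ℝ) ≤ τ * #R

lemma IsReservoir.non_le_of_subset {τ : ℝ} {R A : Finset V} (hR : IsReservoir G τ R) (h : A ⊆ R)
    (v : V) : (#(nonIn G v A) : ℝ) ≤ τ * #R :=
  le_trans (by exact_mod_cast Finset.card_le_card (nonIn_mono h v)) (hR.non_le v)

lemma nodup_of_pairwise (hG : ∀ u v, G u v → ¬ G v u) {l : List V} (h : l.Pairwise G) :
    l.Nodup :=
  h.imp fun {a b} hab e => by subst e; exact hG _ _ hab hab

lemma exists_two_mul_outIn_le (hG : ∀ u v, G u v → ¬ G v u) {U : Finset V} (hU : U.Nonempty) :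
    ∃ u ∈ U, 2 * (#(outIn G u U) : ℝ) ≤ #U := by
  by_contra! h
  have h1 : ∑ u ∈ U, (#U : ℝ) < ∑ u ∈ U, 2 * (#(outIn G u U) : ℝ) :=
    Finset.sum_lt_sum_of_nonempty hU h
  have h2 := two_mul_sum_outIn_le hG U
  rw [Finset.sum_const, nsmul_eq_mul, ← Finset.mul_sum] at h1
  nlinarith

lemma exists_le_two_mul_outIn (hG : ∀ u v, G u v → ¬ G v u) {U : Finset V} (hU : U.Nonempty)
    {t : ℝ} (ht : ∀ v, (#(nonIn G v U) : ℝ) ≤ t) :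
    ∃ u ∈ U, (#U : ℝ) - t ≤ 2 * #(outIn G u U) := by
  by_contra! h
  have h1 : ∑ u ∈ U, 2 * (#(outIn G u U) : ℝ) < ∑ u ∈ U, ((#U : ℝ) - t) :=
    Finset.sum_lt_sum_of_nonempty hU h
  have h2 := le_two_mul_sum_outIn hG U ht
  rw [Finset.sum_const, nsmul_eq_mul, ← Finset.mul_sum] at h1
  linarith

lemma card_outIn_le_add {A B C : Finset V} (h : A ⊆ B ∪ C) (v : V) :
    (#(outIn G v A) : ℝ) ≤ #(outIn G v B) + #(outIn G v C) := by
  have : outIn G v A ⊆ outIn G v B ∪ outIn G v C := by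
    rw [outIn, outIn, outIn, ← Finset.filter_union]
    exact Finset.filter_subset_filter _ h
  exact_mod_cast (Finset.card_le_card this).trans (Finset.card_union_le _ _)

lemma card_outIn_le (A : Finset V) (v : V) : (#(outIn G v A) : ℝ) ≤ #A := by
  exact_mod_cast Finset.card_le_card (Finset.filter_subset _ _)

/-- Almost half of a reservoir sends many edges to any given nonempty subset. -/
lemma IsReservoir.card_one_step {τ : ℝ} {R S : Finset V} (hR : IsReservoir G τ R)
    (hS : S.Nonempty) :
    43 / 100 * (#R : ℝ) ≤ #(R.filter fun w => 1 / 50 * (#S : ℝ) ≤ #(outIn G w S)) := by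
  have hSpos : (0 : ℝ) < #S := by exact_mod_cast hS.card_pos
  have h1 : #S * (9 / 20 * (#R : ℝ)) ≤ ∑ s ∈ S, (#(innIn G s R) : ℝ) := by
    rw [← nsmul_eq_mul]
    exact Finset.card_nsmul_le_sum _ _ _ fun s _ => hR.inn_le s
  rw [← sum_card_outIn_eq] at h1
  have h2 := sum_le_card_filter_mul_add R (fun w => (#(outIn G w S) : ℝ))
    (m := 1 / 50 * (#S : ℝ)) (M := #S) (fun i _ => card_outIn_le _ _) (by positivity)
  have h3 : (#S : ℝ) * (43 / 100 * (#R : ℝ))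
      ≤ #S * #(R.filter fun w => 1 / 50 * (#S : ℝ) ≤ #(outIn G w S)) := by
    linarith
  exact le_of_mul_le_mul_left h3 hSpos

/-- All but a bounded proportion of a reservoir sends many edges to any subset `B` of size
almost half. -/
lemma IsReservoir.card_two_step (hG : ∀ u v, G u v → ¬ G v u) {τ : ℝ} (hτ : τ ≤ 1 / 100)
    {R B : Finset V} (hR : IsReservoir G τ R) (hB : B ⊆ R) (hBcard : 43 / 100 * (#R : ℝ) ≤ #B) :
    (#(R.filter fun w => ¬ 1 / 50 * (#R : ℝ) ≤ #(outIn G w B)) : ℝ) ≤ 35 / 100 * #R := by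
  set C := R.filter fun w => ¬ 1 / 50 * (#R : ℝ) ≤ #(outIn G w B) with hC
  have hR0 : (0 : ℝ) ≤ #R := by positivity
  have hCmem : ∀ w ∈ C, (#(outIn G w B) : ℝ) ≤ 1 / 50 * #R := fun w hw =>
    (not_le.1 (Finset.mem_filter.1 hw).2).le
  have h1 : (#(C ∩ B) : ℝ) ≤ 5 / 100 * #R := by
    rcases (C ∩ B).eq_empty_or_nonempty with h | h
    · rw [h]; simp
    obtain ⟨u, hu, hu2⟩ := exists_le_two_mul_outIn hG h (t := τ * #R)
      (hR.non_le_of_subset (Finset.inter_subset_right.trans hB))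
    have h3 : (#(outIn G u (C ∩ B)) : ℝ) ≤ #(outIn G u B) := by
      exact_mod_cast Finset.card_le_card (Finset.filter_subset_filter _ Finset.inter_subset_right)
    have h4 := hCmem u (Finset.mem_of_mem_inter_left hu)
    nlinarith
  have h2 : (#(C \ B) : ℝ) ≤ 28 / 100 * #R := by
    rcases (C \ B).eq_empty_or_nonempty with h | h
    · rw [h]; simp
    obtain ⟨u, hu, hu2⟩ := exists_two_mul_outIn_le hG h
    have hsub : R ⊆ B ∪ ((C \ B) ∪ ((R \ B) \ (C \ B))) := by
      intro x hx
      simp only [mem_union, mem_sdiff]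
      tauto
    have h3 := card_outIn_le_add (G := G) hsub u
    have h4 := card_outIn_le_add (G := G)
      (subset_refl ((C \ B) ∪ ((R \ B) \ (C \ B)))) u
    have h5 := hCmem u (Finset.mem_sdiff.1 hu).1
    have h6 := card_outIn_le (G := G) ((R \ B) \ (C \ B)) u
    have h7 : (#((R \ B) \ (C \ B)) : ℝ) + #(C \ B) = #R - #B := by
      have hCR : C \ B ⊆ R \ B := Finset.sdiff_subset_sdiff (Finset.filter_subset _ _) subset_rfl
      have e1 := Finset.card_sdiff_add_card_eq_card hCR
      have e2 := Finset.card_sdiff_add_card_eq_card hB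
      have e3 : (#((R \ B) \ (C \ B)) : ℝ) + #(C \ B) = #(R \ B) := by exact_mod_cast e1
      have e4 : (#(R \ B) : ℝ) + #B = #R := by exact_mod_cast e2
      linarith
    have h8 := hR.out_le u
    linarith
  have h3 : (#(C ∩ B) : ℝ) + #(C \ B) = #C := by
    exact_mod_cast Finset.card_inter_add_card_sdiff C B
  linarith

lemma card_sdiff_ge (A Z : Finset V) : (#A : ℝ) - #Z ≤ #(A \ Z) := by
  have : (#A : ℝ) ≤ #(A \ Z) + #Z := by exact_mod_cast Finset.card_le_card_sdiff_add_card
  linarith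

lemma card_toFinset_le (l : List V) : (#l.toFinset : ℝ) ≤ l.length := by
  exact_mod_cast List.toFinset_card_le l

/-- `X` dominates `Y`: every vertex of `X` sends an edge to every vertex of `Y`. -/
def Dominates (G : V → V → Prop) (X Y : List V) : Prop := ∀ x ∈ X, ∀ y ∈ Y, G x y

/-- A transitive list of `k` vertices. -/
def IsBlock (G : V → V → Prop) (k : ℕ) (X : List V) : Prop := X.length = k ∧ X.Pairwise G

/-- In a reservoir any two sets of positive density are joined by four transitive blocks, each
dominating the next, that avoid a prescribed small set `Z`. -/
lemma IsReservoir.exists_connection (hG : ∀ u v, G u v → ¬ G v u) {k : ℕ} (hk : 1 ≤ k)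
    {τ σ : ℝ} (hτ0 : 0 ≤ τ) (hτ : τ ≤ 1 / 100) (hσ0 : 0 < σ) (hσ1 : σ ≤ 1)
    (hτσ : 20 * 4 ^ k * τ ≤ (1 / 50) ^ k * (drcBeta (1 / 50) k * σ / 2))
    {R S S' Z : Finset V} (hR : IsReservoir G τ R) (hR0 : R.Nonempty) (hS : S ⊆ R) (hS' : S' ⊆ R)
    (hScard : σ * #R ≤ #S) (hScard' : σ * #R ≤ #S')
    (hZ : (#Z : ℝ) + 3 * k < drcBeta (1 / 50) k * σ / 2 * #R) :
    ∃ X₁ X₂ X₃ X₄ : List V, IsBlock G k X₁ ∧ IsBlock G k X₂ ∧ IsBlock G k X₃ ∧ IsBlock G k X₄ ∧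
      Dominates G X₁ X₂ ∧ Dominates G X₂ X₃ ∧ Dominates G X₃ X₄ ∧
      (∀ x ∈ X₁, x ∈ S) ∧ (∀ x ∈ X₄, x ∈ S') ∧
      (∀ x ∈ X₁ ++ X₂ ++ X₃ ++ X₄, x ∈ R ∧ x ∉ Z) ∧ (X₁ ++ X₂ ++ X₃ ++ X₄).Nodup := by
  set b := drcBeta (1 / 50) k with hb
  have hb0 : 0 < b := drcBeta_pos (by norm_num) k
  have hb1 : b ≤ 1 := by
    rw [hb, drcBeta]
    refine div_le_one_of_le₀ ?_ (by positivity)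
    have h1 : ((1 : ℝ) / 50) ^ (k + 1) ≤ 1 := pow_le_one₀ (by norm_num) (by norm_num)
    have h2 : (1 : ℝ) ≤ 5 ^ k := one_le_pow₀ (by norm_num)
    linarith
  have hRpos : (0 : ℝ) < #R := by exact_mod_cast hR0.card_pos
  have hbσ : b * σ ≤ b := by nlinarith
  have hbσ' : b * σ ≤ σ := by nlinarith
  have hkpos : (0 : ℝ) ≤ k := by positivity
  have hpos : (0 : ℝ) < b * σ / 2 * #R := by positivity
  have hS'0 : S'.Nonempty := by
    refine Finset.card_pos.1 ?_
    have : (0 : ℝ) < #S' := lt_of_lt_of_le (by positivity) hScard'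
    exact_mod_cast this
  set B₁ := R.filter fun w => 1 / 50 * (#S' : ℝ) ≤ #(outIn G w S') with hB₁
  have hB₁card := hR.card_one_step hS'0
  rw [← hB₁] at hB₁card
  set B₂ := R.filter fun w => 1 / 50 * (#R : ℝ) ≤ #(outIn G w B₁) with hB₂
  have hC := hR.card_two_step hG hτ (Finset.filter_subset _ _) hB₁card
  have hout₂ : ∀ v, 1 / 50 * (#R : ℝ) ≤ #(outIn G v B₂) := by
    intro v
    have h1 := card_outIn_le_add (G := G) (Finset.filter_union_filter_not_eq
      (fun w => 1 / 50 * (#R : ℝ) ≤ #(outIn G w B₁)) R).symm.subset v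
    have h2 := card_outIn_le (G := G) (R.filter fun w => ¬ 1 / 50 * (#R : ℝ) ≤ #(outIn G w B₁)) v
    have h3 := hR.out_le v
    rw [← hB₂] at h1
    linarith
  -- one step of dependent random choice towards a set `B`, avoiding `Z'`
  have step : ∀ (A B T Z' : Finset V), A ⊆ R → B ⊆ T → T.Nonempty →
      (∀ a ∈ A, 1 / 50 * (#T : ℝ) ≤ #(outIn G a B)) → b * σ * #R ≤ #A →
      (#Z' : ℝ) < b * σ / 2 * #R →
      ∃ X : List V, IsBlock G k X ∧ (∀ x ∈ X, x ∈ A \ Z') ∧ b * #T ≤ #(commonOut G X B) := by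
    intro A B T Z' hAR hBT hT hA hAcard hZ'
    have h1 := card_sdiff_ge A Z'
    have h2 : b * σ / 2 * #R ≤ #(A \ Z') := by linarith
    have hsub : A \ Z' ⊆ R := Finset.sdiff_subset.trans hAR
    obtain ⟨X, hX1, hX2, hX3, hX4⟩ := exists_transitive_list hG T (fun a w => w ∈ B ∧ G a w)
      (A \ Z') (δ := 1 / 50) (t := τ * #R) (k := k) (by norm_num) (by positivity) hk
      (fun a ha => by
        refine (hA a (Finset.mem_sdiff.1 ha).1).trans ?_
        refine Nat.cast_le.2 (Finset.card_le_card fun w hw => ?_)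
        simp only [outIn, mem_filter] at hw ⊢
        exact ⟨hBT hw.1, hw⟩)
      hT (hR.non_le_of_subset hsub)
      (by
        have : 20 * 4 ^ k * τ * #R ≤ (1 / 50) ^ k * (b * σ / 2) * #R := by gcongr
        have h3 : ((1 : ℝ) / 50) ^ k * (b * σ / 2 * #R) ≤ (1 / 50) ^ k * #(A \ Z') := by gcongr
        linarith)
      (Finset.card_pos.1 (by exact_mod_cast hpos.trans_le h2))
    refine ⟨X, ⟨hX1, hX2⟩, hX3, hX4.trans ?_⟩
    have hX0 : X ≠ [] := by rintro rfl; simp at hX1; omega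
    obtain ⟨x, hx⟩ := List.exists_mem_of_ne_nil X hX0
    refine Nat.cast_le.2 (Finset.card_le_card fun w hw => ?_)
    simp only [commonOut, mem_filter] at hw ⊢
    exact ⟨(hw.2 x hx).1, fun y hy => (hw.2 y hy).2⟩
  have hlen : ∀ {X : List V}, IsBlock G k X → (#X.toFinset : ℝ) ≤ k := fun hX =>
    (card_toFinset_le _).trans (by rw [hX.1])
  have hun : ∀ A B : Finset V, (#(A ∪ B) : ℝ) ≤ #A + #B := fun A B => by
    exact_mod_cast Finset.card_union_le A B
  obtain ⟨X₁, hX₁, hX₁S, hc₁⟩ := step S B₂ R Z hS (Finset.filter_subset _ _) hR0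
    (fun a _ => hout₂ a) (by nlinarith) (by linarith)
  have z₁ := hun Z X₁.toFinset
  have := hlen hX₁
  obtain ⟨X₂, hX₂, hX₂S, hc₂⟩ := step (commonOut G X₁ B₂) B₁ R (Z ∪ X₁.toFinset)
    ((Finset.filter_subset _ _).trans (Finset.filter_subset _ _)) (Finset.filter_subset _ _) hR0
    (fun a ha => (Finset.mem_filter.1 (Finset.mem_filter.1 ha).1).2) (by nlinarith) (by linarith)
  have z₂ := hun (Z ∪ X₁.toFinset) X₂.toFinset
  have := hlen hX₂
  obtain ⟨X₃, hX₃, hX₃S, hc₃⟩ := step (commonOut G X₂ B₁) S' S' (Z ∪ X₁.toFinset ∪ X₂.toFinset)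
    ((Finset.filter_subset _ _).trans (Finset.filter_subset _ _)) subset_rfl hS'0
    (fun a ha => (Finset.mem_filter.1 (Finset.mem_filter.1 ha).1).2) (by nlinarith) (by linarith)
  have z₃ := hun (Z ∪ X₁.toFinset ∪ X₂.toFinset) X₃.toFinset
  have := hlen hX₃
  obtain ⟨X₄, hX₄, hX₄S, -⟩ := step (commonOut G X₃ S') R R
    (Z ∪ X₁.toFinset ∪ X₂.toFinset ∪ X₃.toFinset) ((Finset.filter_subset _ _).trans hS') subset_rfl
    hR0 (fun a _ => by linarith [hR.out_le a]) (by nlinarith) (by linarith)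
  simp only [mem_sdiff, mem_union, List.mem_toFinset, not_or, commonOut, mem_filter]
    at hX₁S hX₂S hX₃S hX₄S
  refine ⟨X₁, X₂, X₃, X₄, hX₁, hX₂, hX₃, hX₄, fun x hx y hy => (hX₂S y hy).1.2 x hx,
    fun x hx y hy => (hX₃S y hy).1.2 x hx, fun x hx y hy => (hX₄S y hy).1.2 x hx,
    fun x hx => (hX₁S x hx).1, fun x hx => (hX₄S x hx).1.1, ?_, ?_⟩
  · intro x hx
    simp only [List.mem_append] at hx
    rcases hx with ((hx | hx) | hx) | hx
    · exact ⟨hS (hX₁S x hx).1, (hX₁S x hx).2⟩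
    · exact ⟨Finset.filter_subset _ _ (hX₂S x hx).1.1, (hX₂S x hx).2.1⟩
    · exact ⟨Finset.filter_subset _ _ (hX₃S x hx).1.1, (hX₃S x hx).2.1.1⟩
    · exact ⟨hS' (hX₄S x hx).1.1, (hX₄S x hx).2.1.1.1⟩
  · have n₁ := nodup_of_pairwise hG hX₁.2
    have n₂ := nodup_of_pairwise hG hX₂.2
    have n₃ := nodup_of_pairwise hG hX₃.2
    have n₄ := nodup_of_pairwise hG hX₄.2
    have d₂ := fun x hx => (hX₂S x hx).2
    have d₃ := fun x hx => (hX₃S x hx).2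
    have d₄ := fun x hx => (hX₄S x hx).2
    simp only [List.nodup_append', List.disjoint_left, List.mem_append, n₁, n₂, n₃, n₄, true_and]
    refine ⟨⟨fun x h1 h2 => (d₂ x h2).2 h1, ?_⟩, ?_⟩
    · rintro x (h1 | h1) h2
      · exact (d₃ x h2).1.2 h1
      · exact (d₃ x h2).2 h1
    · rintro x ((h1 | h1) | h1) h2
      · exact (d₄ x h2).1.1.2 h1
      · exact (d₄ x h2).1.2 h1
      · exact (d₄ x h2).2 h1

/-- Inside any set `Q` that is large compared with its non-adjacencies there is a transitive list
with many common in-neighbours in one reservoir and many common out-neighbours in another. -/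
lemma exists_piece (hG : ∀ u v, G u v → ¬ G v u) {L : ℕ} (hL : 1 ≤ L) {τ τ' t : ℝ} (ht0 : 0 ≤ t)
    {Q R R' : Finset V} (hQ : Q.Nonempty) (hR : IsReservoir G τ R) (hR' : IsReservoir G τ' R')
    (hR0 : R.Nonempty) (hR0' : R'.Nonempty)
    (ht : ∀ v, (#(nonIn G v Q) : ℝ) ≤ t) (hQcard : 20 * 4 ^ L * t ≤ (1 / 50) ^ L * #Q) :
    ∃ E : List V, IsBlock G L E ∧ (∀ x ∈ E, x ∈ Q) ∧
      drcBeta (1 / 50) L * #R ≤ #(commonIn G E R) ∧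
      drcBeta (1 / 50) L * #R' ≤ #(commonOut G E R') := by
  have hRpos : (0 : ℝ) < #R := by exact_mod_cast hR0.card_pos
  have hRpos' : (0 : ℝ) < #R' := by exact_mod_cast hR0'.card_pos
  obtain ⟨N, hN⟩ : ∃ N : V → V × V → Prop, ∀ a p, N a p ↔ (G p.1 a ∧ G a p.2) :=
    ⟨_, fun _ _ => Iff.rfl⟩
  obtain ⟨E, h1, h2, h3, h4⟩ := exists_transitive_list hG (R ×ˢ R') N Q (δ := 1 / 50) (t := t) (k := L) (by norm_num) ht0 hL
    (fun a _ => by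
      have e : (R ×ˢ R').filter (N a) = innIn G a R ×ˢ outIn G a R' := by
        ext p; simp only [mem_filter, mem_product, innIn, outIn, hN]; tauto
      have i1 := hR.inn_le a
      have i2 := hR'.out_le a
      have : 1 / 50 * ((#R : ℝ) * #R') ≤ #(innIn G a R) * #(outIn G a R') := by
        calc _ ≤ 9 / 20 * (#R : ℝ) * (9 / 20 * #R') := by nlinarith [mul_pos hRpos hRpos']
          _ ≤ _ := by gcongr
      rw [e, card_product, card_product, Nat.cast_mul, Nat.cast_mul]
      exact this)
    (hR0.product hR0') ht hQcard hQ
  have e : (#((R ×ˢ R').filter (fun p => ∀ x ∈ E, N x p)) : ℝ)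
      = #(commonIn G E R) * #(commonOut G E R') := by
    rw [← Nat.cast_mul, ← card_product]
    congr 2
    ext p
    simp only [mem_filter, mem_product, commonIn, commonOut, forall_and, hN]
    tauto
  have h5 : drcBeta (1 / 50) L * (#R * #R') ≤ #(commonIn G E R) * #(commonOut G E R') := by
    rw [← e, ← Nat.cast_mul, ← card_product]
    exact h4
  have i1 : (#(commonIn G E R) : ℝ) ≤ #R := by
    exact_mod_cast Finset.card_le_card (Finset.filter_subset _ _)
  have i2 : (#(commonOut G E R') : ℝ) ≤ #R' := by
    exact_mod_cast Finset.card_le_card (Finset.filter_subset _ _)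
  refine ⟨E, ⟨h1, h2⟩, h3, ?_, ?_⟩
  · refine le_of_mul_le_mul_right ?_ hRpos'
    calc _ = drcBeta (1 / 50) L * (#R * #R') := by ring
      _ ≤ _ := h5
      _ ≤ _ := by gcongr
  · refine le_of_mul_le_mul_left ?_ hRpos
    calc _ = drcBeta (1 / 50) L * (#R * #R') := by ring
      _ ≤ _ := h5
      _ ≤ _ := by gcongr

/-- The list `E` consists of two blocks between which `v` can be inserted. -/
def Absorbs (G : V → V → Prop) (k : ℕ) (v : V) (E : List V) : Prop :=
  ∃ X Y, E = X ++ Y ∧ X.length = k ∧ Y.length = k ∧ (X ++ v :: Y).Pairwise G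

/-- The pair of tuples `p` lies in `R`, has many common in- and out-neighbours there, and the vertex
`v` can be inserted in its middle. -/
def IsAbsorbingPair (G : V → V → Prop) (k : ℕ) (R : Finset V) (v : V)
    (p : (Fin k → V) × (Fin k → V)) : Prop :=
  (List.ofFn p.1 ++ v :: List.ofFn p.2).Pairwise G ∧
    drcBeta (1 / 50) k * #R ≤ #(commonIn G (List.ofFn p.1) R) ∧
    drcBeta (1 / 50) k * #R ≤ #(commonOut G (List.ofFn p.2) R)

/-- The in-neighbourhood of a vertex contains many vertices sending many edges to its
out-neighbourhood. -/
lemma IsReservoir.card_inn_to_out (hG : ∀ u v, G u v → ¬ G v u) {τ : ℝ} (hτ : τ ≤ 1 / 100)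
    {R : Finset V} (hR : IsReservoir G τ R) (hR0 : R.Nonempty) (v : V) :
    1 / 20 * (#R : ℝ) ≤
      #((innIn G v R).filter fun a => 1 / 20 * (#R : ℝ) ≤ #(outIn G a (outIn G v R))) := by
  have hRpos : (0 : ℝ) < #R := by exact_mod_cast hR0.card_pos
  set A := innIn G v R with hA
  set B := outIn G v R with hB
  have hA1 := hR.inn_le v
  have hB1 := hR.out_le v
  rw [← hA] at hA1
  rw [← hB] at hB1
  have hsum := card_out_add_inn_add_non hG v R
  rw [← hA, ← hB] at hsum
  have hnon := hR.non_le v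
  have hBR : B ⊆ R := Finset.filter_subset _ _
  have key : ∀ b, (#(innIn G b R) : ℝ) ≤ #(innIn G b A) + #(innIn G b B) + #(nonIn G v R) := by
    intro b
    have : innIn G b R ⊆ innIn G b A ∪ innIn G b B ∪ nonIn G v R := by
      intro x hx
      simp only [hA, hB, innIn, outIn, nonIn, mem_union, mem_filter] at hx ⊢
      tauto
    have h := (Finset.card_le_card this).trans (Finset.card_union_le _ _)
    have h' := Finset.card_union_le (innIn G b A) (innIn G b B)
    exact_mod_cast h.trans (Nat.add_le_add_right h' _)
  have h1 : ∑ b ∈ B, (9 / 20 * (#R : ℝ) - τ * #R)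
      ≤ ∑ b ∈ B, ((#(innIn G b A) : ℝ) + #(innIn G b B)) :=
    Finset.sum_le_sum fun b _ => by linarith [key b, hR.inn_le b]
  rw [Finset.sum_add_distrib, ← sum_card_outIn_eq, ← sum_card_outIn_eq, Finset.sum_const,
    nsmul_eq_mul] at h1
  have h2 := two_mul_sum_outIn_le hG B
  have h3 := sum_le_card_filter_mul_add A (fun a => (#(outIn G a B) : ℝ)) (m := 1 / 20 * (#R : ℝ))
    (M := #B) (fun a _ => card_outIn_le _ _) (by positivity)
  set s : ℝ := (#(A.filter fun a => 1 / 20 * (#R : ℝ) ≤ #(outIn G a B)) : ℝ) with hs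
  have hs0 : 0 ≤ s := by positivity
  have hnon0 : (0 : ℝ) ≤ #(nonIn G v R) := by positivity
  by_contra! hlt
  set r : ℝ := (#R : ℝ)
  set x : ℝ := (#B : ℝ)
  set y : ℝ := (#A : ℝ)
  have hx : x ≤ 11 / 20 * r := by linarith
  have hy : y ≤ 11 / 20 * r := by linarith
  have f1 : x * (44 / 100 * r) ≤ x * (9 / 20 * r - τ * r) := by
    gcongr; nlinarith
  have f2 : s * x ≤ 1 / 20 * r * x := by gcongr
  nlinarith

/-- A positive proportion of the pairs of `k`-tuples in a reservoir absorb a given vertex. -/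
lemma IsReservoir.card_absorbingPairs (hG : ∀ u v, G u v → ¬ G v u) {k : ℕ} (hk : 1 ≤ k)
    {τ : ℝ} (hτ0 : 0 ≤ τ) (hτ : τ ≤ 1 / 100)
    (hτk : 20 * 4 ^ k * τ ≤ (1 / 50) ^ k * drcBeta (1 / 50) k)
    {R : Finset V} (hR : IsReservoir G τ R) (hR0 : R.Nonempty) (v : V) :
    drcGamma (1 / 50) k * (1 / 20) ^ k * (drcGamma (1 / 50) k * drcBeta (1 / 50) k ^ k)
        * ((#R : ℝ) ^ k * #R ^ k) ≤
      #(((Fintype.piFinset fun _ : Fin k => R) ×ˢ (Fintype.piFinset fun _ : Fin k => R)).filter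
        (IsAbsorbingPair G k R v)) := by
  have hRpos : (0 : ℝ) < #R := by exact_mod_cast hR0.card_pos
  set b := drcBeta (1 / 50) k with hb
  set g := drcGamma (1 / 50) k with hg
  have hb0 : 0 < b := drcBeta_pos (by norm_num) k
  have hg0 : 0 < g := drcGamma_pos (by norm_num) k
  have hb1 : b ≤ 1 / 20 := by
    rw [hb, drcBeta, div_le_iff₀ (by positivity), pow_succ]
    have h1 : ((1 : ℝ) / 50) ^ k ≤ 1 := pow_le_one₀ (by norm_num) (by norm_num)
    have h2 : (1 : ℝ) ≤ 5 ^ k := one_le_pow₀ (by norm_num)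
    linarith
  set A := (innIn G v R).filter fun a => 1 / 20 * (#R : ℝ) ≤ #(outIn G a (outIn G v R)) with hA
  have hAcard := hR.card_inn_to_out hG hτ hR0 v
  rw [← hA] at hAcard
  have hAR : A ⊆ R := (Finset.filter_subset _ _).trans (Finset.filter_subset _ _)
  set B := outIn G v R with hB
  have hτ' : ∀ s : Finset V, b * #R ≤ #s → 20 * 4 ^ k * (τ * #R) ≤ (1 / 50) ^ k * (#s : ℝ) := by
    intro s hs
    have h1 : 20 * 4 ^ k * τ * #R ≤ (1 / 50) ^ k * b * #R := by gcongr
    have h2 : ((1 : ℝ) / 50) ^ k * (b * #R) ≤ (1 / 50) ^ k * #s := by gcongr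
    linarith
  obtain ⟨N, hN⟩ : ∃ N : V → V × V → Prop, ∀ a p, N a p ↔ (G p.1 a ∧ (G v p.2 ∧ G a p.2)) :=
    ⟨_, fun _ _ => Iff.rfl⟩
  have hX := dependent_random_choice hG (R ×ˢ R) N A
    (δ := 1 / 50) (t := τ * #R) (k := k) (by norm_num) (by positivity) hk
    (fun a ha => by
      have e : (#((R ×ˢ R).filter (N a)) : ℝ)
          = #(innIn G a R) * #(outIn G a B) := by
        rw [← Nat.cast_mul, ← card_product]
        congr 2
        ext p; simp only [mem_filter, mem_product, innIn, outIn, hB, hN]; tauto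
      have i1 := hR.inn_le a
      have i2 := (Finset.mem_filter.1 ha).2
      have : 1 / 50 * ((#R : ℝ) * #R) ≤ #(innIn G a R) * #(outIn G a B) := by
        calc _ ≤ 9 / 20 * (#R : ℝ) * (1 / 20 * #R) := by nlinarith [mul_pos hRpos hRpos]
          _ ≤ _ := by gcongr
      rw [card_product, Nat.cast_mul]
      rw [e]
      exact this)
    (hR0.product hR0) (hR.non_le_of_subset hAR) (hτ' A (le_trans (by gcongr) hAcard))
  set T := (transTuples G k A).filter fun f => drcBeta (1 / 50) k * #(R ×ˢ R)
    ≤ #((R ×ˢ R).filter fun p => ∀ i, N (f i) p) with hT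
  set H : (Fin k → V) → Finset (Fin k → V) := fun f =>
    (transTuples G k (commonOut G (List.ofFn f) B)).filter fun h =>
      drcBeta (1 / 50) k * #R ≤ #(R.filter fun w => ∀ i, G (h i) w) with hH
  have hTprop : ∀ f ∈ T, b * #R ≤ #(commonIn G (List.ofFn f) R) ∧
      b * #R ≤ #(commonOut G (List.ofFn f) B) := by
    intro f hf
    have h1 := (Finset.mem_filter.1 hf).2
    have e : (#((R ×ˢ R).filter fun p => ∀ i, N (f i) p) : ℝ)
        ≤ #(commonIn G (List.ofFn f) R) * #(commonOut G (List.ofFn f) B) := by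
      rw [← Nat.cast_mul, ← card_product]
      refine Nat.cast_le.2 (Finset.card_le_card fun p hp => ?_)
      simp only [mem_filter, mem_product, commonIn, commonOut, hB, outIn, List.mem_ofFn, hN,
        forall_exists_index, forall_apply_eq_imp_iff] at hp ⊢
      exact ⟨⟨hp.1.1, fun i => (hp.2 i).1⟩, ⟨hp.1.2, (hp.2 ⟨0, hk⟩).2.1⟩, fun i => (hp.2 i).2.2⟩
    have h2 := h1.trans e
    rw [card_product, Nat.cast_mul, ← hb] at h2
    have i1 : (#(commonIn G (List.ofFn f) R) : ℝ) ≤ #R := by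
      exact_mod_cast Finset.card_le_card (Finset.filter_subset _ _)
    have i2 : (#(commonOut G (List.ofFn f) B) : ℝ) ≤ #R := by
      exact_mod_cast Finset.card_le_card
        ((Finset.filter_subset _ _).trans (Finset.filter_subset _ _))
    constructor
    · refine le_of_mul_le_mul_right ?_ hRpos
      calc _ = b * (#R * #R) := by ring
        _ ≤ _ := h2
        _ ≤ _ := by gcongr
    · refine le_of_mul_le_mul_left ?_ hRpos
      calc _ = b * (#R * #R) := by ring
        _ ≤ _ := h2
        _ ≤ _ := by gcongr
  have hHcard : ∀ f ∈ T, g * (b ^ k * #R ^ k) ≤ #(H f) := by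
    intro f hf
    have h2 := (hTprop f hf).2
    have hsub : commonOut G (List.ofFn f) B ⊆ R :=
      (Finset.filter_subset _ _).trans (Finset.filter_subset _ _)
    have h := dependent_random_choice hG R (fun a w => G a w) (commonOut G (List.ofFn f) B)
      (δ := 1 / 50) (t := τ * #R) (k := k) (by norm_num) (by positivity) hk
      (fun a _ => by
        have := hR.out_le a
        rw [outIn] at this
        linarith)
      hR0 (hR.non_le_of_subset hsub) (hτ' _ h2)
    refine le_trans ?_ h
    rw [← mul_pow, ← hg]
    gcongr
  have hcount : (#T : ℝ) * (g * (b ^ k * #R ^ k)) ≤ #(T.sigma H) := by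
    rw [Finset.card_sigma, Nat.cast_sum, ← nsmul_eq_mul]
    exact Finset.card_nsmul_le_sum _ _ _ hHcard
  have hinj : #(T.sigma H) ≤ #(((Fintype.piFinset fun _ : Fin k => R) ×ˢ
      (Fintype.piFinset fun _ : Fin k => R)).filter (IsAbsorbingPair G k R v)) := by
    refine Finset.card_le_card_of_injOn (fun p => (p.1, p.2)) ?_ ?_
    · rintro ⟨f, h⟩ hp
      simp only [coe_sigma, Set.mem_sigma_iff, mem_coe] at hp
      obtain ⟨hf, hh⟩ := hp
      have hf1 := hTprop f hf
      obtain ⟨hf2, hf3⟩ := mem_transTuples.1 (Finset.mem_filter.1 hf).1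
      obtain ⟨hh1, hh4⟩ := Finset.mem_filter.1 hh
      obtain ⟨hh2, hh3⟩ := mem_transTuples.1 hh1
      simp only [commonOut, hB, outIn, mem_filter, List.mem_ofFn, forall_exists_index,
        forall_apply_eq_imp_iff] at hh2
      simp only [coe_filter, mem_product, Fintype.mem_piFinset, Set.mem_ofPred_eq]
      refine ⟨⟨fun i => hAR (hf2 i), fun i => (hh2 i).1.1⟩, ?_, hf1.1, ?_⟩
      · simp only [List.pairwise_append, List.pairwise_cons, List.pairwise_ofFn, List.mem_cons,
          List.mem_ofFn, forall_exists_index, forall_apply_eq_imp_iff, forall_eq_or_imp]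
        refine ⟨fun i j hij => hf3 i j hij, ⟨fun i => (hh2 i).1.2, fun i j hij => hh3 i j hij⟩,
          fun i => ⟨?_, fun j => (hh2 j).2 i⟩⟩
        exact (Finset.mem_filter.1 (Finset.mem_filter.1 (hf2 i)).1).2
      · refine hh4.trans (Nat.cast_le.2 (Finset.card_le_card fun w hw => ?_))
        simpa [commonOut, List.mem_ofFn] using hw
    · rintro ⟨f, h⟩ _ ⟨f', h'⟩ _ e
      simp only [Prod.mk.injEq] at e
      obtain ⟨rfl, rfl⟩ := e
      rfl
  have hTcard : g * (1 / 20) ^ k * #R ^ k ≤ #T := by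
    refine le_trans ?_ hX
    rw [mul_assoc, ← mul_pow, ← hg]
    gcongr
  calc _ = g * (1 / 20) ^ k * #R ^ k * (g * (b ^ k * #R ^ k)) := by ring
    _ ≤ #T * (g * (b ^ k * #R ^ k)) := by gcongr
    _ ≤ #(T.sigma H) := hcount
    _ ≤ _ := by exact_mod_cast hinj

/-- Every vertex of the list sends an edge to each of the next `k` vertices. -/
def KChain (G : V → V → Prop) (k : ℕ) : List V → Prop
  | [] => True
  | a :: l => (∀ b ∈ l.take k, G a b) ∧ KChain G k l

lemma KChain.append {k : ℕ} {E M : List V} (hE : E.Pairwise G) (hM : KChain G k M)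
    (h : Dominates G (E.rtake k) (M.take k)) : KChain G k (E ++ M) := by
  induction E with
  | nil => exact hM
  | cons a E ih =>
    rw [List.pairwise_cons] at hE
    refine ⟨fun b hb => ?_, ih hE.2 fun x hx y hy => h x ?_ y hy⟩
    · change b ∈ (E ++ M).take k at hb
      rw [List.take_append, List.mem_append] at hb
      rcases hb with hb | hb
      · exact hE.1 b (List.mem_of_mem_take hb)
      · have hlt : E.length < k := by
          by_contra! hle
          simp [Nat.sub_eq_zero_of_le hle] at hb
        refine h a ?_ b ((List.take_subset_take_left M (Nat.sub_le _ _)) hb)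
        have : (a :: E).length - k = 0 := by simp; omega
        rw [List.rtake, this]
        exact List.mem_cons_self
    · simp only [List.rtake] at hx ⊢
      rcases le_or_gt k E.length with hle | hlt
      · rw [List.length_cons, Nat.succ_sub hle, List.drop_succ_cons]
        exact hx
      · have : (a :: E).length - k = 0 := by simp; omega
        rw [this]
        exact List.mem_cons_of_mem _ (List.mem_of_mem_drop hx)

lemma KChain.getElem {k : ℕ} {l : List V} (hl : KChain G k l) {i j : ℕ} (hij : i < j)
    (hjk : j ≤ i + k) (hj : j < l.length) : G l[i] l[j] := by
  induction l generalizing i j with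
  | nil => simp at hj
  | cons a l ih =>
    obtain ⟨j, rfl⟩ : ∃ m, j = m + 1 := ⟨j - 1, by omega⟩
    rw [List.length_cons] at hj
    cases i with
    | zero =>
      refine hl.1 _ ?_
      rw [List.mem_take_iff_getElem]
      exact ⟨j, by omega, by simp⟩
    | succ i => exact ih hl.2 (by omega) (by omega) (by omega)

/-- A cyclic list of all the vertices, each sending an edge to the next `k`, is a `k`-th power of a
Hamilton cycle. -/
lemma hasPowHamCycle_of_kChain {n k : ℕ} (hkn : k ≤ n) {G : Fin n → Fin n → Prop}
    {C : List (Fin n)} (hC : C.Nodup) (hall : ∀ v, v ∈ C) (h : KChain G k (C ++ C.take k)) :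
    HasPowHamCycle k G := by
  have hlen : C.length = n := by
    have h1 := List.toFinset_card_of_nodup hC
    rw [Finset.eq_univ_of_forall fun v => List.mem_toFinset.2 (hall v), Finset.card_univ,
      Fintype.card_fin] at h1
    exact h1.symm
  have hinj : Function.Injective fun i : Fin n => C[(i : ℕ)]'(hlen.symm ▸ i.2) := by
    intro i j hij
    exact Fin.ext ((hC.getElem_inj_iff).1 hij)
  refine ⟨Equiv.ofBijective _ (Finite.injective_iff_bijective.1 hinj), fun i j hj hjk => ?_⟩
  have hi := i.2
  have h1 := h.getElem (i := i) (j := i + j) (by omega) (by omega)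
    (by rw [List.length_append, List.length_take, hlen]; omega)
  rw [List.getElem_append_left (by omega)] at h1
  simp only [Equiv.ofBijective_apply]
  rcases lt_or_ge ((i : ℕ) + j) n with hlt | hge
  · rw [List.getElem_append_left (by omega)] at h1
    simpa only [Nat.mod_eq_of_lt hlt] using h1
  · rw [List.getElem_append_right (by omega), List.getElem_take] at h1
    have : ((i : ℕ) + j) % n = i + j - C.length := by
      rw [hlen, Nat.mod_eq_sub_mod hge, Nat.mod_eq_of_lt (by omega)]
    simpa only [this] using h1

/-- The first and the last `k` vertices of a list. -/
def ends (k : ℕ) (E : List V) : List V × List V := (E.take k, E.rtake k)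

/-- A transitive list of at least `k` vertices. -/
def IsEntry (G : V → V → Prop) (k : ℕ) (E : List V) : Prop := k ≤ E.length ∧ E.Pairwise G

/-- A sequence of disjoint transitive lists such that the last `k` vertices of each dominate the
first `k` vertices of the next one. -/
structure IsPath (G : V → V → Prop) (k : ℕ) (l : List (List V)) : Prop where
  entry : ∀ E ∈ l, IsEntry G k E
  chain : (l.map (ends k)).IsChain fun p q => Dominates G p.2 q.1
  nodup : l.flatten.Nodup

lemma take_flatten_cons {k : ℕ} {E : List V} (hE : k ≤ E.length) (l : List (List V)) :
    (E :: l).flatten.take k = E.take k := by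
  rw [List.flatten_cons, List.take_append_of_le_length hE]

lemma kChain_flatten {k : ℕ} {l : List (List V)} (he : ∀ E ∈ l, IsEntry G k E)
    (hc : (l.map (ends k)).IsChain fun p q => Dominates G p.2 q.1) : KChain G k l.flatten := by
  induction l with
  | nil => trivial
  | cons E l ih =>
    rw [List.flatten_cons]
    refine KChain.append (he E List.mem_cons_self).2
      (ih (fun F hF => he F (List.mem_cons_of_mem _ hF)) (List.IsChain.tail hc)) ?_
    cases l with
    | nil => intro x _ y hy; simp at hy
    | cons F l =>
      rw [take_flatten_cons (he F (by simp)).1]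
      rw [List.map_cons, List.map_cons, List.isChain_cons_cons] at hc
      exact hc.1

/-- A cyclic sequence of entries covering all vertices gives a power of a Hamilton cycle. -/
lemma hasPowHamCycle_of_isPath {n k : ℕ} (hkn : k ≤ n) {G : Fin n → Fin n → Prop}
    {l : List (List (Fin n))} {E₀ E₁ : List (Fin n)} (hl : IsPath G k (E₀ :: l))
    (hlast : (((E₀ :: l).map (ends k)).getLast?) = some (ends k E₁))
    (hall : ∀ v, v ∈ (E₀ :: l).flatten) (hcl : Dominates G (E₁.rtake k) (E₀.take k)) :
    HasPowHamCycle k G := by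
  refine hasPowHamCycle_of_kChain hkn hl.nodup hall ?_
  have hE₀ := hl.entry E₀ List.mem_cons_self
  rw [take_flatten_cons hE₀.1]
  have h := kChain_flatten (k := k) (G := G) (l := (E₀ :: l) ++ [E₀.take k]) ?_ ?_
  · simpa using h
  · intro E hE
    rcases List.mem_append.1 hE with h | h
    · exact hl.entry E h
    · rw [List.mem_singleton] at h
      subst h
      exact ⟨by rw [List.length_take]; have := hE₀.1; omega, hE₀.2.sublist (List.take_sublist _ _)⟩
  · rw [List.map_append, List.isChain_append]
    refine ⟨hl.chain, by simp, ?_⟩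
    intro x hx y hy
    rw [hlast] at hx
    simp only [Option.mem_def, Option.some.injEq, List.map_cons, List.map_nil,
      List.head?_cons] at hx hy
    subst hx hy
    simpa [ends, List.take_take] using hcl

lemma Absorbs.exists_insert {k : ℕ} {v : V} {E : List V} (h : Absorbs G k v E) :
    ∃ E', ends k E' = ends k E ∧ IsEntry G k E' ∧ E'.Perm (v :: E) := by
  obtain ⟨X, Y, rfl, hX, hY, hp⟩ := h
  refine ⟨X ++ v :: Y, ?_, ⟨by simp; omega, hp⟩, List.perm_middle⟩
  simp only [ends, List.rtake, Prod.mk.injEq]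
  constructor
  · rw [List.take_append_of_le_length hX.ge, List.take_append_of_le_length hX.ge]
  · rw [List.drop_append, List.drop_append]
    have e1 : (X ++ v :: Y).length - k = k + 1 := by simp; omega
    have e2 : (X ++ Y).length - k = k := by simp; omega
    have e3 : X.drop (k + 1) = [] := List.drop_of_length_le (by omega)
    have e4 : X.drop k = [] := List.drop_of_length_le (by omega)
    rw [e1, e2, e3, e4, hX]
    simp

/-- Vertices that are absorbed by sufficiently many entries can all be inserted. -/
lemma exists_absorb_list {k : ℕ} (W : List V) (l : List (List V)) (he : ∀ E ∈ l, IsEntry G k E)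
    (hW : ∀ v ∈ W, W.length ≤ l.countP fun E => Absorbs G k v E) :
    ∃ l' : List (List V), l'.map (ends k) = l.map (ends k) ∧ (∀ E ∈ l', IsEntry G k E) ∧
      l'.flatten.Perm (W ++ l.flatten) := by
  induction W generalizing l with
  | nil => exact ⟨l, rfl, he, List.Perm.refl _⟩
  | cons v W ih =>
    have h1 := hW v List.mem_cons_self
    rw [List.length_cons] at h1
    obtain ⟨E, hE, hEv⟩ := List.countP_pos_iff.1 (lt_of_lt_of_le (Nat.succ_pos _) h1)
    obtain ⟨l₁, l₂, rfl⟩ := List.append_of_mem hE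
    obtain ⟨E', hE'1, hE'2, hE'3⟩ := Absorbs.exists_insert (of_decide_eq_true hEv)
    have he' : ∀ F ∈ l₁ ++ E' :: l₂, IsEntry G k F := by
      intro F hF
      rcases List.mem_append.1 hF with h | h
      · exact he F (List.mem_append_left _ h)
      · rcases List.mem_cons.1 h with rfl | h
        · exact hE'2
        · exact he F (List.mem_append_right _ (List.mem_cons_of_mem _ h))
    have hW' : ∀ w ∈ W, W.length ≤ (l₁ ++ E' :: l₂).countP fun E => Absorbs G k w E := by
      intro w hw
      have := hW w (List.mem_cons_of_mem _ hw)
      rw [List.countP_append, List.countP_cons, List.length_cons] at this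
      rw [List.countP_append, List.countP_cons]
      split_ifs at this <;> omega
    obtain ⟨l', h2, h3, h4⟩ := ih (l₁ ++ E' :: l₂) he' hW'
    refine ⟨l', by rw [h2]; simp [hE'1], h3, h4.trans ?_⟩
    simp only [List.flatten_append, List.flatten_cons, List.cons_append]
    refine (List.Perm.append_left W (List.Perm.append_left _ (hE'3.append_right _))).trans ?_
    rw [List.cons_append]
    exact (List.Perm.append_left W List.perm_middle).trans List.perm_middle

/-- The sequence `l` is a path with last entry `E` that avoids exactly the vertices in `U`. -/
structure IsState (G : V → V → Prop) (k : ℕ) (l : List (List V)) (E : List V) (U : Finset V) :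
    Prop where
  path : IsPath G k l
  last : l.getLast? = some E
  mem_iff : ∀ v, v ∈ U ↔ v ∉ l.flatten

lemma IsBlock.take_eq {k : ℕ} {X : List V} (h : IsBlock G k X) : X.take k = X :=
  List.take_of_length_le h.1.le

lemma IsBlock.rtake_eq {k : ℕ} {X : List V} (h : IsBlock G k X) : X.rtake k = X := by
  rw [List.rtake, h.1, Nat.sub_self, List.drop_zero]

lemma IsBlock.isEntry {k : ℕ} {X : List V} (h : IsBlock G k X) : IsEntry G k X := ⟨h.1.ge, h.2⟩

lemma IsState.append (hG : ∀ u v, G u v → ¬ G v u) {k : ℕ} {l : List (List V)} {E E' : List V}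
    {U : Finset V} (h : IsState G k l E U) (hE' : IsEntry G k E') (hsub : ∀ x ∈ E', x ∈ U)
    (hd : Dominates G (E.rtake k) (E'.take k)) :
    IsState G k (l ++ [E']) E' (U \ E'.toFinset) := by
  refine ⟨⟨?_, ?_, ?_⟩, by simp, ?_⟩
  · intro F hF
    rcases List.mem_append.1 hF with hF | hF
    · exact h.path.entry F hF
    · rw [List.mem_singleton.1 hF]
      exact hE'
  · rw [List.map_append, List.isChain_append]
    refine ⟨h.path.chain, by simp, ?_⟩
    intro x hx y hy
    rw [List.getLast?_map, h.last] at hx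
    simp only [Option.map_some, Option.mem_def, Option.some.injEq, List.map_cons, List.map_nil,
      List.head?_cons] at hx hy
    subst hx hy
    exact hd
  · rw [List.flatten_append, List.nodup_append']
    refine ⟨h.path.nodup, by simpa using nodup_of_pairwise hG hE'.2, ?_⟩
    intro x hx hx'
    rw [List.flatten_singleton] at hx'
    exact (h.mem_iff x).1 (hsub x hx') hx
  · intro v
    rw [mem_sdiff, List.mem_toFinset, h.mem_iff, List.flatten_append, List.flatten_singleton,
      List.mem_append, not_or]

/-- A path can be prolonged through a reservoir into a prescribed dense subset. -/
lemma IsState.connect (hG : ∀ u v, G u v → ¬ G v u) {k : ℕ} (hk : 1 ≤ k)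
    {τ σ : ℝ} (hτ0 : 0 ≤ τ) (hτ : τ ≤ 1 / 100) (hσ0 : 0 < σ) (hσ1 : σ ≤ 1)
    (hτσ : 20 * 4 ^ k * τ ≤ (1 / 50) ^ k * (drcBeta (1 / 50) k * σ / 2))
    {l : List (List V)} {E : List V} {U R S' Z : Finset V} (h : IsState G k l E U)
    (hR : IsReservoir G τ R) (hRU : R ⊆ U) (hS' : S' ⊆ R)
    (hS : σ * #R ≤ #(commonOut G (E.rtake k) R)) (hScard' : σ * #R ≤ #S')
    (hZ : (#Z : ℝ) + 3 * k < drcBeta (1 / 50) k * σ / 2 * #R) :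
    ∃ (M : List (List V)) (X : List V) (W : Finset V), IsState G k (l ++ M) X (U \ W) ∧
      IsBlock G k X ∧ (∀ x ∈ X, x ∈ S') ∧ W ⊆ R ∧ Disjoint W Z ∧ #W ≤ 4 * k := by
  have hR0 : R.Nonempty := by
    rw [Finset.nonempty_iff_ne_empty]
    rintro rfl
    have : (0 : ℝ) ≤ (#Z : ℝ) + 3 * k := by positivity
    simp at hZ
    linarith
  obtain ⟨X₁, X₂, X₃, X₄, b1, b2, b3, b4, d1, d2, d3, hX1, hX4, hX, hnd⟩ :=
    hR.exists_connection hG hk hτ0 hτ hσ0 hσ1 hτσ hR0 (Finset.filter_subset _ _) hS' hS hScard' hZ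
  set U₁ := U \ X₁.toFinset with hU1
  set U₂ := U₁ \ X₂.toFinset with hU2
  set U₃ := U₂ \ X₃.toFinset with hU3
  simp only [List.nodup_append', List.disjoint_append_left] at hnd
  obtain ⟨⟨⟨-, -, n12⟩, -, n13, n23⟩, -, ⟨n14, n24⟩, n34⟩ := hnd
  have s1 : IsState G k (l ++ [X₁]) X₁ U₁ := by
    refine h.append hG b1.isEntry (fun x hx => hRU (hX x (by simp [hx])).1) ?_
    rw [b1.take_eq]
    intro x hx y hy
    exact (Finset.mem_filter.1 (hX1 y hy)).2 x hx
  have s2 : IsState G k (l ++ [X₁] ++ [X₂]) X₂ U₂ := by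
    refine s1.append hG b2.isEntry (fun x hx => ?_) (by rwa [b1.rtake_eq, b2.take_eq])
    simp only [hU1, mem_sdiff, List.mem_toFinset]
    exact ⟨hRU (hX x (by simp [hx])).1, fun hx' => n12 hx' hx⟩
  have s3 : IsState G k (l ++ [X₁] ++ [X₂] ++ [X₃]) X₃ U₃ := by
    refine s2.append hG b3.isEntry (fun x hx => ?_) (by rwa [b2.rtake_eq, b3.take_eq])
    simp only [hU2, hU1, mem_sdiff, List.mem_toFinset]
    exact ⟨⟨hRU (hX x (by simp [hx])).1, fun hx' => n13 hx' hx⟩, fun hx' => n23 hx' hx⟩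
  have s4 : IsState G k (l ++ [X₁] ++ [X₂] ++ [X₃] ++ [X₄]) X₄ (U₃ \ X₄.toFinset) := by
    refine s3.append hG b4.isEntry (fun x hx => ?_) (by rwa [b3.rtake_eq, b4.take_eq])
    simp only [hU3, hU2, hU1, mem_sdiff, List.mem_toFinset]
    exact ⟨⟨⟨hRU (hX x (by simp [hx])).1, fun hx' => n14 hx' hx⟩, fun hx' => n24 hx' hx⟩,
      fun hx' => n34 hx' hx⟩
  refine ⟨[X₁, X₂, X₃, X₄], X₄, (X₁ ++ X₂ ++ X₃ ++ X₄).toFinset, ?_, b4, hX4, ?_, ?_, ?_⟩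
  · convert s4 using 1
    · simp
    · ext x
      simp only [hU3, hU2, hU1, mem_sdiff, List.mem_toFinset, List.mem_append]
      tauto
  · intro x hx
    exact (hX x (List.mem_toFinset.1 hx)).1
  · rw [Finset.disjoint_left]
    intro x hx
    exact (hX x (List.mem_toFinset.1 hx)).2
  · refine (List.toFinset_card_le _).trans ?_
    simp only [List.length_append, b1.1, b2.1, b3.1, b4.1]
    omega

/-- A path can be prolonged through a reservoir by a prescribed entry. -/
lemma IsState.step (hG : ∀ u v, G u v → ¬ G v u) {k : ℕ} (hk : 1 ≤ k)
    {τ σ : ℝ} (hτ0 : 0 ≤ τ) (hτ : τ ≤ 1 / 100) (hσ0 : 0 < σ) (hσ1 : σ ≤ 1)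
    (hτσ : 20 * 4 ^ k * τ ≤ (1 / 50) ^ k * (drcBeta (1 / 50) k * σ / 2))
    {l : List (List V)} {E E' : List V} {U R : Finset V} (h : IsState G k l E U)
    (hR : IsReservoir G τ R) (hRU : R ⊆ U) (hE' : IsEntry G k E') (hsub : ∀ x ∈ E', x ∈ U)
    (hS : σ * #R ≤ #(commonOut G (E.rtake k) R))
    (hS' : σ * #R ≤ #(commonIn G (E'.take k) R))
    (hsize : (E'.length : ℝ) + 3 * k < drcBeta (1 / 50) k * σ / 2 * #R) :
    ∃ (M : List (List V)) (W : Finset V),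
      IsState G k (l ++ M ++ [E']) E' ((U \ W) \ E'.toFinset) ∧ W ⊆ R ∧
        Disjoint W E'.toFinset ∧ #W ≤ 4 * k := by
  obtain ⟨M, X, W, s, hX, hXS, hW, hd, hc⟩ := h.connect hG hk hτ0 hτ hσ0 hσ1 hτσ hR hRU
    (Finset.filter_subset _ _) hS hS' (Z := E'.toFinset)
    (lt_of_le_of_lt (by gcongr; exact List.toFinset_card_le E') hsize)
  refine ⟨M, W, s.append hG hE' (fun x hx => ?_) ?_, hW, hd, hc⟩
  · rw [mem_sdiff]
    exact ⟨hsub x hx, fun hx' => Finset.disjoint_left.1 hd hx' (List.mem_toFinset.2 hx)⟩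
  · rw [hX.rtake_eq]
    intro x hx y hy
    exact (Finset.mem_filter.1 (hXS x hx)).2 y hy

/-- The density of common neighbourhoods maintained along the path. -/
noncomputable def linkDensity (k : ℕ) : ℝ := drcBeta (1 / 50) (200 * k)

/-- The admissible proportion of non-neighbours in a reservoir. -/
noncomputable def resTol (k : ℕ) : ℝ := 1 / 10 ^ (5000 * k)

/-- The size from which on reservoirs can be used for connections. -/
noncomputable def resSize (k : ℕ) : ℝ := 8000 * k / (drcBeta (1 / 50) k * linkDensity k)

lemma drcBeta_anti {δ : ℝ} (h0 : 0 < δ) (h1 : δ ≤ 1) {k L : ℕ} (h : k ≤ L) :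
    drcBeta δ L ≤ drcBeta δ k := by
  rw [drcBeta, drcBeta]
  gcongr ?_ / (8 * ?_)
  · exact pow_le_pow_of_le_one h0.le h1 (by omega)
  · exact pow_le_pow_right₀ (by norm_num) h

lemma drcBeta_le_one (k : ℕ) : drcBeta (1 / 50) k ≤ 1 := by
  rw [drcBeta]
  refine div_le_one_of_le₀ ?_ (by positivity)
  have h1 : ((1 : ℝ) / 50) ^ (k + 1) ≤ 1 := pow_le_one₀ (by norm_num) (by norm_num)
  have h2 : (1 : ℝ) ≤ 5 ^ k := one_le_pow₀ (by norm_num)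
  linarith

lemma linkDensity_pos (k : ℕ) : 0 < linkDensity k := drcBeta_pos (by norm_num) _

lemma linkDensity_le (k : ℕ) : linkDensity k ≤ drcBeta (1 / 50) k :=
  drcBeta_anti (by norm_num) (by norm_num) (by omega)

lemma linkDensity_le_one (k : ℕ) : linkDensity k ≤ 1 := drcBeta_le_one _

lemma linkDensity_eq (k : ℕ) : linkDensity k = 1 / (400 * 250 ^ (200 * k)) := by
  rw [linkDensity, drcBeta, pow_succ, one_div_pow]
  have : (250 : ℝ) ^ (200 * k) = 50 ^ (200 * k) * 5 ^ (200 * k) := by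
    rw [← mul_pow]; norm_num
  rw [this]
  field_simp
  norm_num

lemma resTol_pos (k : ℕ) : 0 < resTol k := by rw [resTol]; positivity

lemma resTol_le {k : ℕ} (hk : 1 ≤ k) : resTol k ≤ 1 / 100 := by
  rw [resTol]
  refine one_div_le_one_div_of_le (by norm_num) ?_
  calc (100 : ℝ) = 10 ^ 2 := by norm_num
    _ ≤ _ := pow_le_pow_right₀ (by norm_num) (by omega)

lemma resTol_link {k : ℕ} (hk : 1 ≤ k) :
    20 * 4 ^ k * resTol k ≤ (1 / 50) ^ k * (drcBeta (1 / 50) k * (linkDensity k / 4) / 2) := by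
  have h0 := linkDensity_pos k
  suffices h : 20 * 4 ^ k * resTol k ≤ (1 / 50) ^ k * (linkDensity k * (linkDensity k / 4) / 2) by
    refine h.trans ?_
    gcongr
    exact linkDensity_le k
  have e1 : (4 : ℝ) ^ k ≤ 10 ^ (2 * k) := by
    rw [pow_mul]; gcongr; norm_num
  have e2 : (50 : ℝ) ^ k ≤ 10 ^ (2 * k) := by
    rw [pow_mul]; gcongr; norm_num
  have e3 : (250 : ℝ) ^ (200 * k) ≤ 10 ^ (600 * k) := by
    rw [show 600 * k = 3 * (200 * k) by ring, pow_mul 10 3]; gcongr; norm_num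
  have e4 : (25600000 : ℝ) ≤ 10 ^ (10 * k) := by
    calc (25600000 : ℝ) ≤ 10 ^ 10 := by norm_num
      _ ≤ _ := pow_le_pow_right₀ (by norm_num) (by omega)
  have e5 : (25600000 : ℝ) * 4 ^ k * 50 ^ k * (250 ^ (200 * k) * 250 ^ (200 * k))
      ≤ 10 ^ (5000 * k) := by
    calc _ ≤ (10 : ℝ) ^ (10 * k) * 10 ^ (2 * k) * 10 ^ (2 * k)
            * (10 ^ (600 * k) * 10 ^ (600 * k)) := by gcongr
      _ = 10 ^ (10 * k + 2 * k + 2 * k + (600 * k + 600 * k)) := by simp only [pow_add]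
      _ ≤ _ := pow_le_pow_right₀ (by norm_num) (by omega)
  rw [resTol, linkDensity_eq, one_div_pow, mul_one_div, div_le_iff₀ (by positivity)]
  have e6 : (1 : ℝ) / 50 ^ k * (1 / (400 * 250 ^ (200 * k))
      * (1 / (400 * 250 ^ (200 * k)) / 4) / 2) * 10 ^ (5000 * k)
      = 10 ^ (5000 * k) / (1280000 * 50 ^ k * (250 ^ (200 * k) * 250 ^ (200 * k))) := by
    field_simp
    norm_num
  rw [e6, le_div_iff₀ (by positivity)]
  linarith

lemma resTol_piece {k : ℕ} (hk : 1 ≤ k) :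
    20 * 4 ^ (200 * k) * resTol k ≤ (1 / 50) ^ (200 * k) * (1 / (1000 * k)) := by
  have hk0 : (0 : ℝ) < k := by exact_mod_cast hk
  have e1 : (4 : ℝ) ^ (200 * k) ≤ 10 ^ (400 * k) := by
    rw [show 400 * k = 2 * (200 * k) by ring, pow_mul 10 2]; gcongr; norm_num
  have e2 : (50 : ℝ) ^ (200 * k) ≤ 10 ^ (400 * k) := by
    rw [show 400 * k = 2 * (200 * k) by ring, pow_mul 10 2]; gcongr; norm_num
  have e3 : (k : ℝ) ≤ 10 ^ k := by exact_mod_cast (Nat.lt_pow_self (by norm_num)).le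
  have e4 : (20000 : ℝ) ≤ 10 ^ (10 * k) := by
    calc (20000 : ℝ) ≤ 10 ^ 10 := by norm_num
      _ ≤ _ := pow_le_pow_right₀ (by norm_num) (by omega)
  have e5 : (20000 : ℝ) * 4 ^ (200 * k) * 50 ^ (200 * k) * k ≤ 10 ^ (5000 * k) := by
    calc _ ≤ (10 : ℝ) ^ (10 * k) * 10 ^ (400 * k) * 10 ^ (400 * k) * 10 ^ k := by gcongr
      _ = 10 ^ (10 * k + 400 * k + 400 * k + k) := by simp only [pow_add]
      _ ≤ _ := pow_le_pow_right₀ (by norm_num) (by omega)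
  rw [resTol, one_div_pow, mul_one_div, div_le_iff₀ (by positivity)]
  have e6 : (1 : ℝ) / 50 ^ (200 * k) * (1 / (1000 * k)) * 10 ^ (5000 * k)
      = 10 ^ (5000 * k) / (1000 * 50 ^ (200 * k) * k) := by
    field_simp
  rw [e6, le_div_iff₀ (by positivity)]
  linarith

lemma resSize_nonneg (k : ℕ) : 0 ≤ resSize k := by
  have h1 := linkDensity_pos k
  have h2 : 0 < drcBeta (1 / 50) k := drcBeta_pos (by norm_num) k
  rw [resSize]
  positivity

lemma lt_of_resSize_lt {k : ℕ} {r : ℝ} (h : resSize k < r) :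
    1000 * k < drcBeta (1 / 50) k * (linkDensity k / 4) / 2 * r := by
  have h1 := linkDensity_pos k
  have h2 : 0 < drcBeta (1 / 50) k := drcBeta_pos (by norm_num) k
  rw [resSize, div_lt_iff₀ (by positivity)] at h
  linarith

lemma lt_of_resSize_lt' {k : ℕ} {r : ℝ} (h : resSize k < r) :
    8000 * k < linkDensity k * r := by
  have h1 := linkDensity_pos k
  have h3 := lt_of_resSize_lt h
  have h2 := drcBeta_le_one k
  have h5 : 0 ≤ r := (resSize_nonneg k).trans h.le
  have h4 : drcBeta (1 / 50) k * (linkDensity k * r) ≤ 1 * (linkDensity k * r) := by gcongr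
  linarith

/-- Prolonging a path by an entry with dense common neighbourhoods in a reservoir. -/
lemma IsState.extend (hG : ∀ u v, G u v → ¬ G v u) {k : ℕ} (hk : 1 ≤ k)
    {l : List (List V)} {E E' : List V} {U R : Finset V} (h : IsState G k l E U)
    (hR : IsReservoir G (resTol k) R) (hRU : R ⊆ U) (hsize : resSize k < #R)
    (hE' : IsEntry G k E') (hlen : E'.length ≤ 300 * k) (hsub : ∀ x ∈ E', x ∈ U)
    (hS : linkDensity k / 4 * #R ≤ #(commonOut G (E.rtake k) R))
    (hS' : linkDensity k * #R ≤ #(commonIn G (E'.take k) R))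
    (hS'' : linkDensity k * #R ≤ #(commonOut G (E'.rtake k) R)) :
    ∃ (M : List (List V)) (W : Finset V),
      IsState G k (l ++ M ++ [E']) E' ((U \ W) \ E'.toFinset) ∧ W ⊆ R ∧
        Disjoint W E'.toFinset ∧ #W ≤ 4 * k ∧
        linkDensity k / 4 * #((R \ W) \ E'.toFinset)
          ≤ #(commonOut G (E'.rtake k) ((R \ W) \ E'.toFinset)) := by
  have hβ := linkDensity_pos k
  have hlen' : (E'.length : ℝ) ≤ 300 * k := by exact_mod_cast hlen
  have hk' : (1 : ℝ) ≤ k := by exact_mod_cast hk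
  obtain ⟨M, W, h1, h2, h3, h4⟩ := h.step hG hk (resTol_pos k).le (resTol_le hk)
    (by positivity : 0 < linkDensity k / 4) (by linarith [linkDensity_le_one k]) (resTol_link hk) hR
    hRU hE' hsub hS (le_trans (by gcongr; linarith) hS') (by linarith [lt_of_resSize_lt hsize])
  refine ⟨M, W, h1, h2, h3, h4, ?_⟩
  have e1 : (#((R \ W) \ E'.toFinset) : ℝ) ≤ #R := by
    exact_mod_cast Finset.card_le_card (Finset.sdiff_subset.trans Finset.sdiff_subset)
  have e2 : commonOut G (E'.rtake k) ((R \ W) \ E'.toFinset)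
      = (commonOut G (E'.rtake k) R \ W) \ E'.toFinset := by
    ext x; simp only [commonOut, mem_sdiff, mem_filter]; tauto
  have e3 := card_sdiff_ge (commonOut G (E'.rtake k) R) W
  have e4 := card_sdiff_ge (commonOut G (E'.rtake k) R \ W) E'.toFinset
  have e5 := card_toFinset_le E'
  have e6 : (#W : ℝ) ≤ 4 * k := by exact_mod_cast h4
  have e7 := lt_of_resSize_lt' hsize
  rw [e2]
  have : linkDensity k / 4 * (#((R \ W) \ E'.toFinset) : ℝ) ≤ linkDensity k / 4 * #R := by gcongr
  linarith

/-- A set into which every vertex has in- and out-degree of proportion almost one half. -/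
structure IsFresh (G : V → V → Prop) (k : ℕ) (D : Finset V) : Prop where
  out_le : ∀ v, 49 / 100 * (#D : ℝ) ≤ #(outIn G v D)
  inn_le : ∀ v, 49 / 100 * (#D : ℝ) ≤ #(innIn G v D)
  non_le : ∀ v, (#(nonIn G v D) : ℝ) ≤ resTol k / 2 * #D

lemma IsFresh.isReservoir {k : ℕ} {D R : Finset V} (hD : IsFresh G k D) (hRD : R ⊆ D)
    (hcard : (#(D \ R) : ℝ) ≤ 4 / 100 * #D) : IsReservoir G (resTol k) R := by
  have hle : (#R : ℝ) ≤ #D := by exact_mod_cast Finset.card_le_card hRD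
  have hge : (#(D \ R) : ℝ) + #R = #D := by
    exact_mod_cast Finset.card_sdiff_add_card_eq_card hRD
  have hτ := resTol_pos k
  refine ⟨fun v => ?_, fun v => ?_, fun v => ?_⟩
  · have h1 : outIn G v D ⊆ outIn G v R ∪ (D \ R) := by
      intro x; simp only [outIn, mem_union, mem_filter, mem_sdiff]; tauto
    have h2 : (#(outIn G v D) : ℝ) ≤ #(outIn G v R) + #(D \ R) := by
      exact_mod_cast (Finset.card_le_card h1).trans (Finset.card_union_le _ _)
    linarith [hD.out_le v]
  · have h1 : innIn G v D ⊆ innIn G v R ∪ (D \ R) := by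
      intro x; simp only [innIn, mem_union, mem_filter, mem_sdiff]; tauto
    have h2 : (#(innIn G v D) : ℝ) ≤ #(innIn G v R) + #(D \ R) := by
      exact_mod_cast (Finset.card_le_card h1).trans (Finset.card_union_le _ _)
    linarith [hD.inn_le v]
  · have h1 : (#(nonIn G v R) : ℝ) ≤ #(nonIn G v D) := by
      exact_mod_cast Finset.card_le_card (nonIn_mono hRD v)
    have h2 := hD.non_le v
    have h3 : resTol k / 2 * #D ≤ resTol k / 2 * (2 * #R) := by gcongr; linarith
    linarith

lemma card_commonOut_mono {l l' : List V} (h : ∀ x ∈ l', x ∈ l) (R : Finset V) :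
    (#(commonOut G l R) : ℝ) ≤ #(commonOut G l' R) := by
  refine Nat.cast_le.2 (Finset.card_le_card fun x hx => ?_)
  rw [commonOut, mem_filter] at hx ⊢
  exact ⟨hx.1, fun y hy => hx.2 y (h y hy)⟩

lemma card_commonIn_mono {l l' : List V} (h : ∀ x ∈ l', x ∈ l) (R : Finset V) :
    (#(commonIn G l R) : ℝ) ≤ #(commonIn G l' R) := by
  refine Nat.cast_le.2 (Finset.card_le_card fun x hx => ?_)
  rw [commonIn, mem_filter] at hx ⊢
  exact ⟨hx.1, fun y hy => hx.2 y (h y hy)⟩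

/-- A long transitive piece inside `Q` with dense common neighbourhoods. -/
lemma exists_long_piece (hG : ∀ u v, G u v → ¬ G v u) {k : ℕ} (hk : 1 ≤ k) {τ τ' d : ℝ}
    {Q R R' : Finset V} (hR : IsReservoir G τ R) (hR' : IsReservoir G τ' R')
    (hR0 : R.Nonempty) (hR0' : R'.Nonempty) (hd : 0 < d)
    (hQ : ∀ v, (#(nonIn G v Q) : ℝ) ≤ resTol k * d) (hQcard : d / (1000 * k) ≤ #Q) :
    ∃ E : List V, IsEntry G k E ∧ E.length = 200 * k ∧ (∀ x ∈ E, x ∈ Q) ∧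
      linkDensity k * #R ≤ #(commonIn G (E.take k) R) ∧
      linkDensity k * #R' ≤ #(commonOut G (E.rtake k) R') := by
  have hk' : (0 : ℝ) < k := by exact_mod_cast hk
  have hQ0 : Q.Nonempty := by
    rw [← Finset.card_pos]
    have : 0 < d / (1000 * k) := by positivity
    exact_mod_cast this.trans_le hQcard
  obtain ⟨E, h1, h2, h3, h4⟩ := exists_piece hG (L := 200 * k) (by omega) (t := resTol k * d)
    (by have := resTol_pos k; positivity) hQ0 hR hR' hR0 hR0' hQ (by
      calc _ = 20 * 4 ^ (200 * k) * resTol k * d := by ring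
        _ ≤ (1 / 50) ^ (200 * k) * (1 / (1000 * k)) * d :=
          mul_le_mul_of_nonneg_right (resTol_piece hk) hd.le
        _ = (1 / 50) ^ (200 * k) * (d / (1000 * k)) := by ring
        _ ≤ _ := by gcongr)
  refine ⟨E, ⟨by rw [h1.1]; omega, h1.2⟩, h1.1, h2, ?_, ?_⟩
  · exact h3.trans (card_commonIn_mono (fun x hx => List.mem_of_mem_take hx) R)
  · exact h4.trans (card_commonOut_mono (fun x hx => List.mem_of_mem_drop hx) R')

/-- An entry through a prescribed vertex with both ends in a reservoir. -/
lemma IsReservoir.exists_through (hG : ∀ u v, G u v → ¬ G v u) {k : ℕ} (hk : 1 ≤ k)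
    {R : Finset V} (hR : IsReservoir G (resTol k) R) (hR0 : R.Nonempty) (v : V) :
    ∃ X Y : List V, X.length = k ∧ Y.length = k ∧ (X ++ v :: Y).Pairwise G ∧
      (∀ x ∈ X ++ Y, x ∈ R) ∧
      linkDensity k * #R ≤ #(commonIn G X R) ∧ linkDensity k * #R ≤ #(commonOut G Y R) := by
  have hRpos : (0 : ℝ) < #R := by exact_mod_cast hR0.card_pos
  have hb : 0 < drcBeta (1 / 50) k := drcBeta_pos (by norm_num) k
  have hg : 0 < drcGamma (1 / 50) k := drcGamma_pos (by norm_num) k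
  have h := hR.card_absorbingPairs hG hk (resTol_pos k).le (resTol_le hk)
    ((resTol_link hk).trans (by
      gcongr
      have := linkDensity_le_one k
      have := linkDensity_pos k
      nlinarith)) hR0 v
  have hpos := lt_of_lt_of_le (by positivity) h
  rw [Nat.cast_pos, Finset.card_pos] at hpos
  obtain ⟨p, hp⟩ := hpos
  rw [mem_filter, mem_product, Fintype.mem_piFinset, Fintype.mem_piFinset] at hp
  obtain ⟨⟨p1, p2⟩, p3, p4, p5⟩ := hp
  refine ⟨List.ofFn p.1, List.ofFn p.2, by simp, by simp, p3, ?_, le_trans ?_ p4, le_trans ?_ p5⟩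
  · intro x hx
    simp only [List.mem_append, List.mem_ofFn] at hx
    rcases hx with ⟨i, rfl⟩ | ⟨i, rfl⟩
    · exact p1 i
    · exact p2 i
  · gcongr; exact linkDensity_le k
  · gcongr; exact linkDensity_le k

lemma take_rtake_of_append {k : ℕ} {X Y Z : List V} (hX : X.length = k) (hY : Y.length = k) :
    (X ++ (Z ++ Y)).take k = X ∧ (X ++ (Z ++ Y)).rtake k = Y := by
  constructor
  · rw [List.take_append_of_le_length hX.ge, List.take_of_length_le hX.le]
  · rw [List.rtake, ← List.append_assoc, List.drop_append]
    have e : ((X ++ Z) ++ Y).length - k = (X ++ Z).length := by simp; omega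
    rw [e]
    simp

/-- The path `l` has a prolongation that uses exactly `Q \ Q'` and `D \ R'`, with last entry linked
densely to `R'`. -/
def Reaches (G : V → V → Prop) (k : ℕ) (l : List (List V)) (U Q D Q' R' : Finset V) : Prop :=
  ∃ (M : List (List V)) (E : List V), IsState G k (l ++ M) E ((U \ (Q \ Q')) \ (D \ R')) ∧
    Q' ⊆ Q ∧ R' ⊆ D ∧ linkDensity k / 4 * #R' ≤ #(commonOut G (E.rtake k) R')

lemma Reaches.extend (hG : ∀ u v, G u v → ¬ G v u) {k : ℕ} (hk : 1 ≤ k) {l : List (List V)}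
    {U Q D Q' R' : Finset V} (hQU : Q ⊆ U) (hDU : D ⊆ U) (hQD : Disjoint Q D)
    (h : Reaches G k l U Q D Q' R') (hR : IsReservoir G (resTol k) R') (hsize : resSize k < #R')
    {E' : List V} (hE' : IsEntry G k E') (hlen : E'.length ≤ 300 * k)
    (hsub : ∀ x ∈ E', x ∈ Q' ∪ R')
    (hS' : linkDensity k * #R' ≤ #(commonIn G (E'.take k) R'))
    (hS'' : linkDensity k * #R' ≤ #(commonOut G (E'.rtake k) R')) :
    ∃ W, W ⊆ R' ∧ Disjoint W E'.toFinset ∧ #W ≤ 4 * k ∧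
      Reaches G k l U Q D (Q' \ E'.toFinset) ((R' \ W) \ E'.toFinset) := by
  obtain ⟨M, E, hs, hQ', hR', hc⟩ := h
  rw [Finset.disjoint_left] at hQD
  have hU : ∀ x ∈ Q' ∪ R', x ∈ (U \ (Q \ Q')) \ (D \ R') := by
    intro x hx
    simp only [mem_union, mem_sdiff, not_and, not_not] at hx ⊢
    rcases hx with hx | hx
    · exact ⟨⟨hQU (hQ' hx), fun _ => hx⟩, fun hxD => absurd hxD (hQD (hQ' hx))⟩
    · exact ⟨⟨hDU (hR' hx), fun hxQ => absurd (hR' hx) (hQD hxQ)⟩, fun _ => hx⟩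
  obtain ⟨N, W, h1, h2, h3, h4, h5⟩ := hs.extend hG hk hR
    (fun x hx => hU x (mem_union_right _ hx)) hsize hE' hlen (fun x hx => hU x (hsub x hx)) hc hS'
    hS''
  refine ⟨W, h2, h3, h4, M ++ N ++ [E'], E', ?_, ?_, ?_, h5⟩
  · convert h1 using 1
    · simp
    · ext x
      have f1 := hsub x
      have f2 := @h2 x
      have f3 := @hR' x
      have f4 := @hQ' x
      simp only [mem_sdiff, mem_union, List.mem_toFinset] at f1 ⊢
      by_cases hx : x ∈ E'
      · simp only [hx, not_true, and_false, not_false_eq_true, and_true, iff_false]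
        rcases f1 hx with hq | hr
        · exact fun hc => hc.1.2 (f4 hq)
        · exact fun hc => hc.2 (f3 hr)
      by_cases hw : x ∈ W
      · simp only [hx, hw, not_true, and_false, not_false_eq_true, and_true, iff_false]
        exact fun hc => hc.2 (f3 (f2 hw))
      · simp only [hx, hw, not_false_eq_true, and_true]
  · exact Finset.sdiff_subset.trans hQ'
  · exact Finset.sdiff_subset.trans (Finset.sdiff_subset.trans hR')

lemma card_sdiff_sdiff_le {D R W Z : Finset V} (hRD : R ⊆ D) :
    #(D \ ((R \ W) \ Z)) ≤ #(D \ R) + #W + #(R ∩ Z) := by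
  have : D \ ((R \ W) \ Z) ⊆ (D \ R) ∪ W ∪ (R ∩ Z) := by
    intro x; have := @hRD x; simp only [mem_sdiff, mem_union, mem_inter]; tauto
  refine (Finset.card_le_card this).trans ((Finset.card_union_le _ _).trans ?_)
  exact Nat.add_le_add_right (Finset.card_union_le _ _) _

/-- While `Q` is not too small, a long piece of it can be covered. -/
lemma Reaches.cover_piece (hG : ∀ u v, G u v → ¬ G v u) {k : ℕ} (hk : 1 ≤ k) {l : List (List V)}
    {U Q D Q' R' : Finset V} (hQU : Q ⊆ U) (hDU : D ⊆ U) (hQD : Disjoint Q D) (hD : IsFresh G k D)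
    (hD0 : 2 * resSize k < #D) (hQnon : ∀ v, (#(nonIn G v Q) : ℝ) ≤ resTol k * #D)
    (h : Reaches G k l U Q D Q' R') (hloss : (#(D \ R') : ℝ) ≤ 3 / 100 * #D)
    (hQ' : (#D : ℝ) / (1000 * k) ≤ #Q') :
    ∃ Q'' R'', Reaches G k l U Q D Q'' R'' ∧ #Q'' + 200 * k = #Q' ∧
      #(D \ R'') ≤ #(D \ R') + 4 * k := by
  obtain ⟨M, E, hs, hQ'Q, hR'D, hc⟩ := id h
  have hnn := resSize_nonneg k
  have hDpos : (0 : ℝ) < #D := by linarith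
  have hR := hD.isReservoir hR'D (hloss.trans (by linarith))
  have hge : (#(D \ R') : ℝ) + #R' = #D := by
    exact_mod_cast Finset.card_sdiff_add_card_eq_card hR'D
  have hsize : resSize k < #R' := by linarith
  have hR0 : R'.Nonempty := by
    rw [← Finset.card_pos]
    exact_mod_cast lt_of_le_of_lt hnn hsize
  obtain ⟨E', e1, e2, e3, e4, e5⟩ := exists_long_piece hG hk hR hR hR0 hR0 hDpos (Q := Q')
    (fun v => le_trans (by exact_mod_cast Finset.card_le_card (nonIn_mono hQ'Q v)) (hQnon v)) hQ'
  obtain ⟨W, h1, h2, h3, h4⟩ := h.extend hG hk hQU hDU hQD hR hsize e1 (by omega)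
    (fun x hx => mem_union_left _ (e3 x hx)) e4 e5
  refine ⟨_, _, h4, ?_, ?_⟩
  · have hsub : E'.toFinset ⊆ Q' := fun x hx => e3 x (List.mem_toFinset.1 hx)
    have := Finset.card_sdiff_add_card_eq_card hsub
    rw [List.toFinset_card_of_nodup (nodup_of_pairwise hG e1.2), e2] at this
    exact this
  · have hcap : R' ∩ E'.toFinset = ∅ := by
      ext x
      simp only [mem_inter, List.mem_toFinset, notMem_empty, iff_false, not_and]
      intro hx hx'
      exact Finset.disjoint_left.1 hQD (hQ'Q (e3 x hx')) (hR'D hx)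
    have := card_sdiff_sdiff_le (W := W) (Z := E'.toFinset) hR'D
    rw [hcap, Finset.card_empty] at this
    omega

/-- Any single vertex of `Q` can be covered. -/
lemma Reaches.cover_vertex (hG : ∀ u v, G u v → ¬ G v u) {k : ℕ} (hk : 1 ≤ k) {l : List (List V)}
    {U Q D Q' R' : Finset V} (hQU : Q ⊆ U) (hDU : D ⊆ U) (hQD : Disjoint Q D) (hD : IsFresh G k D)
    (hD0 : 2 * resSize k < #D)
    (h : Reaches G k l U Q D Q' R') (hloss : (#(D \ R') : ℝ) ≤ 3 / 100 * #D)
    (hQ' : Q'.Nonempty) :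
    ∃ Q'' R'', Reaches G k l U Q D Q'' R'' ∧ #Q'' + 1 = #Q' ∧
      #(D \ R'') ≤ #(D \ R') + 6 * k := by
  obtain ⟨M, E, hs, hQ'Q, hR'D, hc⟩ := id h
  have hnn := resSize_nonneg k
  have hR := hD.isReservoir hR'D (hloss.trans (by linarith))
  have hge : (#(D \ R') : ℝ) + #R' = #D := by
    exact_mod_cast Finset.card_sdiff_add_card_eq_card hR'D
  have hsize : resSize k < #R' := by linarith
  have hR0 : R'.Nonempty := by
    rw [← Finset.card_pos]
    exact_mod_cast lt_of_le_of_lt hnn hsize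
  obtain ⟨v, hv⟩ := hQ'
  obtain ⟨X, Y, hX, hY, hp, hXY, h1, h2⟩ := hR.exists_through hG hk hR0 v
  obtain ⟨t1, t2⟩ := take_rtake_of_append (Z := [v]) hX hY
  rw [List.singleton_append] at t1 t2
  have hmem : ∀ x, x ∈ X ++ v :: Y ↔ x = v ∨ x ∈ X ++ Y := by
    intro x; simp only [List.mem_append, List.mem_cons]; tauto
  have hvR : v ∉ R' := fun hvR => Finset.disjoint_left.1 hQD (hQ'Q hv) (hR'D hvR)
  have hXYQ : ∀ x ∈ X ++ Y, x ∉ Q' := fun x hx hxQ =>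
    Finset.disjoint_left.1 hQD (hQ'Q hxQ) (hR'D (hXY x hx))
  obtain ⟨W, g1, g2, g3, g4⟩ := h.extend hG hk hQU hDU hQD hR hsize (E' := X ++ v :: Y)
    ⟨by simp; omega, hp⟩ (by simp; omega) (fun x hx => by
      rcases (hmem x).1 hx with rfl | hx
      · exact mem_union_left _ hv
      · exact mem_union_right _ (hXY x hx)) (by rwa [t1]) (by rwa [t2])
  refine ⟨_, _, g4, ?_, ?_⟩
  · have : Q' \ (X ++ v :: Y).toFinset = Q'.erase v := by
      ext x
      have := hXYQ x
      simp only [mem_sdiff, List.mem_toFinset, hmem, mem_erase]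
      tauto
    rw [this, Finset.card_erase_add_one hv]
  · have hcap : R' ∩ (X ++ v :: Y).toFinset ⊆ (X ++ Y).toFinset := by
      intro x hx
      simp only [mem_inter, List.mem_toFinset, hmem] at hx ⊢
      rcases hx with ⟨hx, rfl | hx'⟩
      · exact absurd hx hvR
      · exact hx'
    have := card_sdiff_sdiff_le (W := W) (Z := (X ++ v :: Y).toFinset) hR'D
    have h5 := (Finset.card_le_card hcap).trans (List.toFinset_card_le _)
    rw [List.length_append] at h5
    omega

/-- One level: all of `Q` is covered using few vertices of the fresh set `D`. -/
lemma Reaches.cover (hG : ∀ u v, G u v → ¬ G v u) {k : ℕ} (hk : 1 ≤ k) {l : List (List V)}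
    {U Q D : Finset V} (hQU : Q ⊆ U) (hDU : D ⊆ U) (hQD : Disjoint Q D) (hD : IsFresh G k D)
    (hD0 : 2 * resSize k < #D) (hQnon : ∀ v, (#(nonIn G v Q) : ℝ) ≤ resTol k * #D)
    (hQcard : (#Q : ℝ) ≤ 101 / 100 * #D) (h : Reaches G k l U Q D Q D) :
    ∃ R, Reaches G k l U Q D ∅ R ∧ (#(D \ R) : ℝ) ≤ 3 / 100 * #D := by
  have hk' : (1 : ℝ) ≤ k := by exact_mod_cast hk
  have hDpos : (0 : ℝ) < #D := by linarith [resSize_nonneg k]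
  have loop1 : ∀ (N : ℕ) (Q' R' : Finset V), #Q' ≤ N → Reaches G k l U Q D Q' R' →
      200 * k * #(D \ R') + 4 * k * #Q' ≤ 4 * k * #Q →
      ∃ Q'' R'', Reaches G k l U Q D Q'' R'' ∧ (#Q'' : ℝ) ≤ #D / (1000 * k) ∧
        200 * k * #(D \ R'') + 4 * k * #Q'' ≤ 4 * k * #Q := by
    intro N
    induction N with
    | zero =>
      intro Q' R' hN hr hc
      have : (0 : ℝ) ≤ #D / (1000 * k) := by positivity
      refine ⟨Q', R', hr, ?_, hc⟩
      rw [Nat.le_zero.1 hN]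
      simpa using this
    | succ N ih =>
      intro Q' R' hN hr hc
      rcases le_or_gt (#Q' : ℝ) (#D / (1000 * k)) with hle | hgt
      · exact ⟨Q', R', hr, hle, hc⟩
      have hc' : 200 * (k : ℝ) * #(D \ R') + 4 * k * #Q' ≤ 4 * k * #Q := by exact_mod_cast hc
      have hloss : (#(D \ R') : ℝ) ≤ 3 / 100 * #D := by
        have h0 : (0 : ℝ) ≤ 4 * k * #Q' := by positivity
        have h1 : (k : ℝ) * (200 * #(D \ R')) ≤ k * (4 * #Q) := by linarith
        have h2 := le_of_mul_le_mul_left h1 (by linarith)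
        linarith
      obtain ⟨Q'', R'', h1, h2, h3⟩ :=
        hr.cover_piece hG hk hQU hDU hQD hD hD0 hQnon hloss hgt.le
      refine ih Q'' R'' (by omega) h1 ?_
      calc 200 * k * #(D \ R'') + 4 * k * #Q''
          ≤ 200 * k * (#(D \ R') + 4 * k) + 4 * k * #Q'' := by gcongr
        _ = 200 * k * #(D \ R') + 4 * k * (#Q'' + 200 * k) := by ring
        _ ≤ _ := by rw [h2]; exact hc
  obtain ⟨Q₁, R₁, h1, h2, h3⟩ := loop1 (#Q) Q D le_rfl h (by simp)
  have loop2 : ∀ (N : ℕ) (Q' R' : Finset V), #Q' = N → Reaches G k l U Q D Q' R' →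
      ((#(D \ R') : ℝ) + 6 * k * #Q' ≤ 3 / 100 * #D) →
      ∃ R'', Reaches G k l U Q D ∅ R'' ∧ (#(D \ R'') : ℝ) ≤ 3 / 100 * #D := by
    intro N
    induction N with
    | zero =>
      intro Q' R' hN hr hc
      rw [Finset.card_eq_zero] at hN
      subst hN
      exact ⟨R', hr, by simpa using hc⟩
    | succ N ih =>
      intro Q' R' hN hr hc
      have h0 : (0 : ℝ) ≤ 6 * k * #Q' := by positivity
      obtain ⟨Q'', R'', h1, h2, h3⟩ :=
        hr.cover_vertex hG hk hQU hDU hQD hD hD0 (by linarith) (Finset.card_pos.1 (by omega))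
      refine ih Q'' R'' (by omega) h1 ?_
      have h2' : (#Q'' : ℝ) + 1 = #Q' := by exact_mod_cast h2
      have h3' : (#(D \ R'') : ℝ) ≤ #(D \ R') + 6 * k := by exact_mod_cast h3
      rw [← h2'] at hc
      linarith
  refine loop2 _ Q₁ R₁ rfl h1 ?_
  have hc' : 200 * (k : ℝ) * #(D \ R₁) + 4 * k * #Q₁ ≤ 4 * k * #Q := by exact_mod_cast h3
  have e1 : (#(D \ R₁) : ℝ) ≤ 202 / 10000 * #D := by
    have h0 : (0 : ℝ) ≤ 4 * k * #Q₁ := by positivity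
    have h1 : (k : ℝ) * (200 * #(D \ R₁)) ≤ k * (4 * #Q) := by linarith
    have h2 := le_of_mul_le_mul_left h1 (by linarith)
    linarith
  rw [le_div_iff₀ (by positivity)] at h2
  linarith

/-- From a partially used set `R` the path can be prolonged so that it is linked densely to a new
fresh set. -/
lemma IsState.enter (hG : ∀ u v, G u v → ¬ G v u) {k : ℕ} (hk : 1 ≤ k) {l : List (List V)}
    {E : List V} {U D R D' : Finset V} (h : IsState G k l E U) (hD : IsFresh G k D)
    (hD' : IsFresh G k D') (hD0 : 2 * resSize k < #D) (hD0' : D'.Nonempty) (hRD : R ⊆ D)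
    (hloss : (#(D \ R) : ℝ) ≤ 3 / 100 * #D) (hRU : R ⊆ U)
    (hlink : linkDensity k / 4 * #R ≤ #(commonOut G (E.rtake k) R)) :
    ∃ (M : List (List V)) (E' : List V) (W : Finset V), IsState G k (l ++ M) E' (U \ W) ∧ W ⊆ R ∧
      linkDensity k * #D' ≤ #(commonOut G (E'.rtake k) D') := by
  have hk' : (1 : ℝ) ≤ k := by exact_mod_cast hk
  have hnn := resSize_nonneg k
  have hR := hD.isReservoir hRD (hloss.trans (by linarith))
  have hge : (#(D \ R) : ℝ) + #R = #D := by
    exact_mod_cast Finset.card_sdiff_add_card_eq_card hRD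
  have hsize : resSize k < #R := by linarith
  have hRpos : (0 : ℝ) < #R := by linarith
  have hR0 : R.Nonempty := Finset.card_pos.1 (by exact_mod_cast hRpos)
  have hcard : (#R : ℝ) / (1000 * k) ≤ #R := div_le_self hRpos.le (by linarith)
  obtain ⟨E', e1, e2, e3, e4, e5⟩ := exists_long_piece hG hk hR
    (hD'.isReservoir subset_rfl (by simp)) hR0 hD0' hRpos hR.non_le hcard
  have hlt := lt_of_resSize_lt hsize
  have hlen : (E'.length : ℝ) = 200 * k := by exact_mod_cast e2
  have hβ := linkDensity_pos k
  obtain ⟨M, W, h1, h2, -, -⟩ := h.step hG hk (resTol_pos k).le (resTol_le hk)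
    (by positivity : 0 < linkDensity k / 4) (by linarith [linkDensity_le_one k]) (resTol_link hk) hR
    hRU e1 (fun x hx => hRU (e3 x hx)) hlink (le_trans (by gcongr; linarith) e4) (by linarith)
  refine ⟨M ++ [E'], E', W ∪ E'.toFinset, ?_, ?_, e5⟩
  · convert h1 using 1
    · simp
    · ext x; simp only [mem_sdiff, mem_union]; tauto
  · exact Finset.union_subset h2 fun x hx => e3 x (List.mem_toFinset.1 hx)

/-- The path can be prolonged so as to cover all of `R` and a small part of a new fresh set. -/
lemma IsState.level (hG : ∀ u v, G u v → ¬ G v u) {k : ℕ} (hk : 1 ≤ k) {l : List (List V)}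
    {E : List V} {U D R D' : Finset V} (h : IsState G k l E U) (hD : IsFresh G k D)
    (hD' : IsFresh G k D') (hD0 : 2 * resSize k < #D) (hD0' : 2 * resSize k < #D')
    (hDD' : (#D : ℝ) ≤ 101 / 100 * #D') (hdisj : Disjoint D D') (hRD : R ⊆ D)
    (hloss : (#(D \ R) : ℝ) ≤ 3 / 100 * #D) (hRU : R ⊆ U) (hD'U : D' ⊆ U)
    (hlink : linkDensity k / 4 * #R ≤ #(commonOut G (E.rtake k) R)) :
    ∃ (M : List (List V)) (E' : List V) (R' : Finset V),
      IsState G k (l ++ M) E' ((U \ R) \ (D' \ R')) ∧ R' ⊆ D' ∧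
      (#(D' \ R') : ℝ) ≤ 3 / 100 * #D' ∧
      linkDensity k / 4 * #R' ≤ #(commonOut G (E'.rtake k) R') := by
  have hnn := resSize_nonneg k
  have hD'0 : D'.Nonempty := by
    have : (0 : ℝ) < #D' := by linarith
    exact Finset.card_pos.1 (by exact_mod_cast this)
  obtain ⟨M, E', W, h1, h2, h3⟩ := h.enter hG hk hD hD' hD0 hD'0 hRD hloss hRU hlink
  have hdisj' := Finset.disjoint_left.1 hdisj
  have hQD : R \ W ⊆ D := Finset.sdiff_subset.trans hRD
  have hβ := linkDensity_pos k
  have hτ := resTol_pos k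
  have hr : Reaches G k (l ++ M) (U \ W) (R \ W) D' (R \ W) D' := by
    refine ⟨[], E', by simpa using h1, subset_rfl, subset_rfl, le_trans ?_ h3⟩
    gcongr
    linarith
  have hQnon : ∀ v, (#(nonIn G v (R \ W)) : ℝ) ≤ resTol k * #D' := by
    intro v
    calc (#(nonIn G v (R \ W)) : ℝ) ≤ #(nonIn G v D) := by
          exact_mod_cast Finset.card_le_card (nonIn_mono hQD v)
      _ ≤ resTol k / 2 * #D := hD.non_le v
      _ ≤ resTol k / 2 * (2 * #D') := by
          gcongr
          have : (0 : ℝ) ≤ #D' := by positivity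
          linarith
      _ = _ := by ring
  obtain ⟨R', ⟨N, F, g1, g2, g3, g4⟩, g5⟩ := hr.cover hG hk
    (Finset.sdiff_subset_sdiff hRU subset_rfl) (fun x hx => mem_sdiff.2 ⟨hD'U hx, fun hxW =>
      hdisj' (hRD (h2 hxW)) hx⟩) (hdisj.mono_left hQD) hD' hD0' hQnon
    (le_trans (by exact_mod_cast Finset.card_le_card hQD) hDD')
  refine ⟨M ++ N, F, R', ?_, g3, g5, g4⟩
  convert g1 using 1
  · simp
  · congr 1
    ext x
    have := @h2 x
    simp only [mem_sdiff, notMem_empty, not_false_eq_true, and_true]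
    tauto

/-- Running through a sequence of fresh sets, the path is prolonged to one that covers all vertices
but those in two of the sets, and whose end dominates the prescribed list `B`. -/
lemma IsState.exists_cover (hG : ∀ u v, G u v → ¬ G v u) {k : ℕ} (hk : 1 ≤ k) {s : ℝ} {B : List V}
    (hs : 2 * resSize k < s) {Ds : List (Finset V)} :
    ∀ {D R U : Finset V} {l : List (List V)} {E : List V}, Ds ≠ [] → IsState G k l E U →
      (∀ F ∈ D :: Ds, IsFresh G k F ∧ s ≤ #F ∧ (#F : ℝ) ≤ 101 / 100 * s) →
      (D :: Ds).Pairwise Disjoint → R ⊆ D → (#(D \ R) : ℝ) ≤ 3 / 100 * #D → R ⊆ U →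
      (∀ F ∈ Ds, F ⊆ U) → (∀ x ∈ U, x ∈ R ∨ ∃ F ∈ Ds, x ∈ F) →
      linkDensity k / 4 * #R ≤ #(commonOut G (E.rtake k) R) →
      (∀ F ∈ Ds.getLast?, linkDensity k / 4 * #F ≤ #(commonIn G B F)) →
      ∃ (M : List (List V)) (E' : List V) (U' : Finset V), IsState G k (l ++ M) E' U' ∧
        U' ⊆ U ∧ (#U' : ℝ) ≤ 3 * s ∧ Dominates G (E'.rtake k) B := by
  have hnn := resSize_nonneg k
  induction Ds with
  | nil => exact fun h => absurd rfl h
  | cons D' Ds ih =>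
    intro D R U l E _ h hF hdisj hRD hloss hRU hDU hU hlink hB
    have hfD := hF D (by simp)
    have hfD' := hF D' (by simp)
    have hDD' : Disjoint D D' := (List.pairwise_cons.1 hdisj).1 D' (by simp)
    cases Ds with
    | nil =>
      have hlt := lt_of_resSize_lt (k := k) (r := #D') (by linarith)
      have hβ := linkDensity_pos k
      have hk' : (1 : ℝ) ≤ k := by exact_mod_cast hk
      have hD'0 : D'.Nonempty := by
        have : (0 : ℝ) < #D' := by linarith
        exact Finset.card_pos.1 (by exact_mod_cast this)
      obtain ⟨M, E', W, h1, h2, h3⟩ := h.enter hG hk hfD.1 hfD'.1 (by linarith)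
        hD'0 hRD hloss hRU hlink
      have hD'U : D' ⊆ U \ W := fun x hx => mem_sdiff.2 ⟨hDU D' (by simp) hx, fun hxW =>
        Finset.disjoint_left.1 hDD' (hRD (h2 hxW)) hx⟩
      obtain ⟨N, X, W', g1, g2, g3, -, -, -⟩ := h1.connect hG hk (resTol_pos k).le (resTol_le hk)
        (by positivity : 0 < linkDensity k / 4) (by linarith [linkDensity_le_one k])
        (resTol_link hk) (hfD'.1.isReservoir subset_rfl (by simp)) hD'U
        (Finset.filter_subset _ _ : commonIn G B D' ⊆ D')
        (le_trans (by gcongr; linarith) h3) (hB D' (by simp)) (Z := ∅)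
        (by rw [Finset.card_empty, Nat.cast_zero]; linarith)
      refine ⟨M ++ N, X, (U \ W) \ W', by simpa using g1,
        Finset.sdiff_subset.trans Finset.sdiff_subset, ?_, ?_⟩
      · have hsub : (U \ W) \ W' ⊆ D ∪ D' := by
          intro x hx
          rcases hU x (Finset.sdiff_subset (Finset.sdiff_subset hx)) with hx | ⟨F, hF, hx⟩
          · exact mem_union_left _ (hRD hx)
          · rw [List.mem_singleton] at hF
            exact mem_union_right _ (hF ▸ hx)
        have : (#((U \ W) \ W') : ℝ) ≤ #D + #D' := by
          exact_mod_cast (Finset.card_le_card hsub).trans (Finset.card_union_le _ _)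
        linarith
      · rw [g2.rtake_eq]
        intro x hx y hy
        exact (Finset.mem_filter.1 (g3 x hx)).2 y hy
    | cons D'' Ds =>
      obtain ⟨M, E', R', h1, h2, h3, h4⟩ := h.level hG hk hfD.1 hfD'.1 (by linarith) (by linarith)
        (by linarith) hDD' hRD hloss hRU (hDU D' (by simp)) hlink
      have hd' := (List.pairwise_cons.1 hdisj).2
      have hd1 := (List.pairwise_cons.1 hdisj).1
      have hd2 := (List.pairwise_cons.1 hd').1
      obtain ⟨N, F, U', g1, g2, g3, g4⟩ := ih (by simp) h1
        (fun F hF' => hF F (List.mem_cons_of_mem _ hF')) hd' h2 h3 (fun x hx => by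
          simp only [mem_sdiff, hx, not_true, and_false, not_false_eq_true, and_true]
          exact ⟨hDU D' (by simp) (h2 hx), fun hxR =>
            Finset.disjoint_left.1 hDD' (hRD hxR) (h2 hx)⟩) (fun F hF x hx => by
          simp only [mem_sdiff]
          exact ⟨⟨hDU F (List.mem_cons_of_mem _ hF) hx, fun hxR =>
            Finset.disjoint_left.1 (hd1 F (List.mem_cons_of_mem _ hF)) (hRD hxR) hx⟩, fun hxD =>
            Finset.disjoint_left.1 (hd2 F hF) hxD.1 hx⟩) (fun x hx => by
          simp only [mem_sdiff, not_and, not_not] at hx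
          rcases hU x hx.1.1 with hx' | ⟨F, hF, hx'⟩
          · exact absurd hx' hx.1.2
          · rcases List.mem_cons.1 hF with rfl | hF
            · exact Or.inl (hx.2 hx')
            · exact Or.inr ⟨F, hF, hx'⟩) h4 (by simpa using hB)
      exact ⟨M ++ N, F, U', by simpa using g1,
        g2.trans (Finset.sdiff_subset.trans Finset.sdiff_subset), g3, g4⟩

lemma sum_exp_mul_add_le {M : ℕ} {y : Fin M → ℝ} (hy : ∑ a, y a = 0) (hy1 : ∀ a, |y a| ≤ 1)
    {t : ℝ} (ht : |t| ≤ 1) (x : ℝ) :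
    ∑ a, Real.exp (t * (x + y a)) ≤ M * ((1 + t ^ 2) * Real.exp (t * x)) := by
  have h : ∀ a, Real.exp (t * (x + y a)) ≤ (1 + t * y a + t ^ 2) * Real.exp (t * x) := by
    intro a
    have h1 : |t * y a| ≤ 1 := by
      rw [abs_mul]
      exact mul_le_one₀ ht (abs_nonneg _) (hy1 a)
    have h2 := (abs_le.1 (Real.abs_exp_sub_one_sub_id_le h1)).2
    have h3 : (t * y a) ^ 2 ≤ t ^ 2 := by
      rw [mul_pow]
      have : y a ^ 2 ≤ 1 := (sq_le_one_iff_abs_le_one _).2 (hy1 a)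
      nlinarith [sq_nonneg t]
    rw [mul_add, Real.exp_add, mul_comm]
    gcongr
    linarith
  refine (Finset.sum_le_sum fun a _ => h a).trans_eq ?_
  rw [← Finset.sum_mul, Finset.sum_add_distrib, Finset.sum_add_distrib, ← Finset.mul_sum, hy]
  simp
  ring

/-- The deviation of the size of a colour class of `A` from the expected size. -/
noncomputable def deviation {M : ℕ} (f : V → Fin M) (A : Finset V) (c : Fin M) : ℝ :=
  #(A.filter fun x => f x = c) - #A / M

lemma deviation_insert {M : ℕ} (f : V → Fin M) {A : Finset V} {u : V} (hu : u ∉ A)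
    (a c : Fin M) :
    deviation (Function.update f u a) (insert u A) c
      = deviation f A c + ((if c = a then 1 else 0) - 1 / M) := by
  have e : A.filter (fun x => Function.update f u a x = c) = A.filter fun x => f x = c :=
    Finset.filter_congr fun x hx => by
      rw [Function.update_of_ne (fun h => hu (by rwa [← h]))]
  rw [deviation, deviation, Finset.filter_insert, Finset.card_insert_of_notMem hu, e]
  simp only [Function.update_self]
  by_cases h : a = c
  · rw [if_pos h, if_pos h.symm, Finset.card_insert_of_notMem (by simp [hu])]
    push_cast
    ring
  · rw [if_neg h, if_neg (Ne.symm h)]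
    push_cast
    ring

lemma deviation_update {M : ℕ} (f : V → Fin M) {A : Finset V} {u : V} (hu : u ∉ A)
    (a c : Fin M) : deviation (Function.update f u a) A c = deviation f A c := by
  rw [deviation, deviation]
  congr 3
  exact Finset.filter_congr fun x hx => by
    rw [Function.update_of_ne (fun h => hu (by rwa [← h]))]

lemma exists_sum_exp_deviation_le {M : ℕ} (hM : 0 < M) (F : Finset (Finset V)) {t : ℝ}
    (ht : |t| ≤ 1) (U : Finset V) :
    ∃ f : V → Fin M, ∑ A ∈ F, ∑ c, (Real.exp (t * deviation f (A ∩ U) c)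
      + Real.exp (-t * deviation f (A ∩ U) c)) ≤ (1 + t ^ 2) ^ #U * (2 * #F * M) := by
  have hM0 : (M : ℝ) ≠ 0 := by positivity
  have hM1 : (1 : ℝ) / M ≤ 1 := by
    rw [div_le_one (by positivity)]
    exact_mod_cast hM
  have hM2 : (0 : ℝ) ≤ 1 / M := by positivity
  induction U using Finset.induction_on with
  | empty =>
    refine ⟨fun _ => ⟨0, hM⟩, le_of_eq ?_⟩
    simp [deviation]
    ring
  | insert u U hu ih =>
    obtain ⟨f, hf⟩ := ih
    have key : ∀ A ∈ F, ∀ c, ∀ s : ℝ, |s| ≤ 1 →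
        ∑ a, Real.exp (s * deviation (Function.update f u a) (A ∩ insert u U) c)
          ≤ M * ((1 + s ^ 2) * Real.exp (s * deviation f (A ∩ U) c)) := by
      intro A _ c s hs
      have hu' : u ∉ A ∩ U := fun h => hu (mem_inter.1 h).2
      by_cases huA : u ∈ A
      · simp only [Finset.inter_insert_of_mem huA, deviation_insert f hu']
        refine sum_exp_mul_add_le ?_ ?_ hs _
        · simp [hM0]
        · intro a
          split_ifs
          · rw [abs_le]; constructor <;> linarith
          · rw [abs_le]; constructor <;> linarith
      · simp only [Finset.inter_insert_of_notMem huA, deviation_update f hu']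
        rw [Finset.sum_const, Finset.card_univ, Fintype.card_fin, nsmul_eq_mul]
        gcongr
        exact le_mul_of_one_le_left (Real.exp_pos _).le (by nlinarith [sq_nonneg s])
    have htot : ∑ a : Fin M, ∑ A ∈ F, ∑ c,
        (Real.exp (t * deviation (Function.update f u a) (A ∩ insert u U) c)
          + Real.exp (-t * deviation (Function.update f u a) (A ∩ insert u U) c))
        ≤ ∑ a : Fin M, (1 + t ^ 2) ^ #(insert u U) * (2 * #F * M) := by
      calc _ = ∑ A ∈ F, ∑ c, ((∑ a : Fin M,
              Real.exp (t * deviation (Function.update f u a) (A ∩ insert u U) c))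
              + ∑ a : Fin M,
              Real.exp (-t * deviation (Function.update f u a) (A ∩ insert u U) c)) := by
            rw [Finset.sum_comm]
            refine Finset.sum_congr rfl fun A _ => ?_
            rw [Finset.sum_comm]
            exact Finset.sum_congr rfl fun c _ => Finset.sum_add_distrib
        _ ≤ ∑ A ∈ F, ∑ c, (M * ((1 + t ^ 2) * Real.exp (t * deviation f (A ∩ U) c))
              + M * ((1 + (-t) ^ 2) * Real.exp (-t * deviation f (A ∩ U) c))) := by
            refine Finset.sum_le_sum fun A hA => Finset.sum_le_sum fun c _ => add_le_add ?_ ?_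
            · exact key A hA c t ht
            · exact key A hA c (-t) (by rwa [abs_neg])
        _ = M * (1 + t ^ 2) * ∑ A ∈ F, ∑ c, (Real.exp (t * deviation f (A ∩ U) c)
              + Real.exp (-t * deviation f (A ∩ U) c)) := by
            simp only [Finset.mul_sum]
            refine Finset.sum_congr rfl fun A _ => Finset.sum_congr rfl fun c _ => ?_
            ring
        _ ≤ M * (1 + t ^ 2) * ((1 + t ^ 2) ^ #U * (2 * #F * M)) := by gcongr
        _ = _ := by
            rw [Finset.sum_const, Finset.card_univ, Fintype.card_fin, nsmul_eq_mul,
              Finset.card_insert_of_notMem hu, pow_succ]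
            ring
    have : (univ : Finset (Fin M)).Nonempty := ⟨⟨0, hM⟩, mem_univ _⟩
    obtain ⟨a, -, ha⟩ := Finset.exists_le_of_sum_le this htot
    exact ⟨_, ha⟩

/-- A set can be coloured so that all members of a small family are coloured evenly. -/
lemma exists_even_coloring {M : ℕ} (hM : 0 < M) (F : Finset (Finset V)) {U : Finset V} {ξ n : ℝ}
    (hξ0 : 0 < ξ) (hξ1 : ξ ≤ 1) (hU : (#U : ℝ) ≤ n) (hF : ∀ A ∈ F, A ⊆ U)
    (hn : 2 * #F * M ≤ Real.exp (ξ ^ 2 / 4 * n)) :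
    ∃ f : V → Fin M, ∀ A ∈ F, ∀ c, |(#(A.filter fun x => f x = c) : ℝ) - #A / M| ≤ ξ * n := by
  have ht : |ξ / 2| ≤ 1 := by rw [abs_le]; constructor <;> linarith
  obtain ⟨f, hf⟩ := exists_sum_exp_deviation_le hM F ht U
  refine ⟨f, fun A hA c => ?_⟩
  have hb : (1 + (ξ / 2) ^ 2) ^ #U * (2 * #F * M) ≤ Real.exp (ξ ^ 2 / 2 * n) := by
    calc _ ≤ Real.exp (ξ ^ 2 / 4 * n) * Real.exp (ξ ^ 2 / 4 * n) := by
          gcongr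
          calc (1 + (ξ / 2) ^ 2) ^ #U ≤ Real.exp ((ξ / 2) ^ 2) ^ #U := by
                gcongr
                linarith [Real.add_one_le_exp ((ξ / 2) ^ 2)]
            _ = Real.exp (#U * (ξ / 2) ^ 2) := by rw [Real.exp_nat_mul]
            _ ≤ _ := by
                rw [Real.exp_le_exp]
                nlinarith [sq_nonneg ξ]
      _ = _ := by rw [← Real.exp_add]; congr 1; ring
  have h1 : Real.exp (ξ / 2 * deviation f A c) + Real.exp (-(ξ / 2) * deviation f A c)
      ≤ Real.exp (ξ ^ 2 / 2 * n) := by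
    refine le_trans ?_ (hf.trans hb)
    have h2 := Finset.single_le_sum (f := fun A => ∑ c, (Real.exp (ξ / 2 * deviation f (A ∩ U) c)
      + Real.exp (-(ξ / 2) * deviation f (A ∩ U) c))) (fun A _ => by positivity) hA
    refine le_trans ?_ h2
    have h3 := Finset.single_le_sum (f := fun c => (Real.exp (ξ / 2 * deviation f (A ∩ U) c)
      + Real.exp (-(ξ / 2) * deviation f (A ∩ U) c))) (fun A _ => by positivity) (mem_univ c)
    refine le_trans (le_of_eq ?_) h3
    rw [Finset.inter_eq_left.2 (hF A hA)]
  have h4 := Real.exp_pos (ξ / 2 * deviation f A c)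
  have h5 := Real.exp_pos (-(ξ / 2) * deviation f A c)
  have h6 := Real.exp_le_exp.1 ((by linarith : Real.exp (ξ / 2 * deviation f A c) ≤ _).trans h1)
  have h7 := Real.exp_le_exp.1 ((by linarith : Real.exp (-(ξ / 2) * deviation f A c) ≤ _).trans h1)
  change |deviation f A c| ≤ ξ * n
  rw [abs_le]
  constructor
  · refine le_of_mul_le_mul_left ?_ (half_pos hξ0)
    linarith
  · refine le_of_mul_le_mul_left ?_ (half_pos hξ0)
    linarith

lemma commonOut_subset (l : List V) (R : Finset V) : commonOut G l R ⊆ R := Finset.filter_subset _ _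

lemma commonIn_subset (l : List V) (R : Finset V) : commonIn G l R ⊆ R := Finset.filter_subset _ _

/-- If the unused vertices induce a digraph with large degrees, then the path can be prolonged so
that it covers almost all vertices and its end dominates the prescribed list `B`. -/
lemma IsState.exists_almost_cover [Fintype V] (hG : ∀ u v, G u v → ¬ G v u) {k : ℕ} (hk : 1 ≤ k)
    {l : List (List V)} {E B : List V} {U : Finset V} (h : IsState G k l E U) {n η : ℝ} {M : ℕ}
    (hM : 2 ≤ M) (hn : n = Fintype.card V) (hη0 : 0 < η) (hη1 : η ≤ 1 / 1000)
    (hη2 : η ≤ resTol k / 8) (hη3 : η ≤ linkDensity k / 8)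
    (hU : 999 / 1000 * n ≤ #U) (hout : ∀ v, 497 / 1000 * n ≤ #(outIn G v U))
    (hinn : ∀ v, 497 / 1000 * n ≤ #(innIn G v U)) (hnon : ∀ v, #(nonIn G v U) ≤ resTol k / 8 * n)
    (hE : linkDensity k / 2 * n ≤ #(commonOut G (E.rtake k) U))
    (hB : linkDensity k / 2 * n ≤ #(commonIn G B U))
    (hsize : 2 * resSize k < 998 / 1000 * (n / M))
    (hexp : 2 * (3 * n + 3) * M ≤ Real.exp ((η / M) ^ 2 / 4 * n)) :
    ∃ (N : List (List V)) (E' : List V) (U' : Finset V), IsState G k (l ++ N) E' U' ∧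
      U' ⊆ U ∧ (#U' : ℝ) ≤ 3 * (n / M) ∧ Dominates G (E'.rtake k) B := by
  have hM2 : (2 : ℝ) ≤ M := by exact_mod_cast hM
  have hM0 : (0 : ℝ) < M := by linarith
  have hn0 : 0 ≤ n := by rw [hn]; positivity
  set F : Finset (Finset V) := univ.image (fun v => outIn G v U) ∪ univ.image (fun v => innIn G v U)
    ∪ univ.image (fun v => nonIn G v U) ∪ {U, commonOut G (E.rtake k) U, commonIn G B U} with hF
  have hFcard : (#F : ℝ) ≤ 3 * n + 3 := by
    have h1 : #F ≤ Fintype.card V + Fintype.card V + Fintype.card V + 3 := by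
      refine (Finset.card_union_le _ _).trans (Nat.add_le_add ?_ Finset.card_le_three)
      refine (Finset.card_union_le _ _).trans (Nat.add_le_add ?_ Finset.card_image_le)
      exact (Finset.card_union_le _ _).trans (Nat.add_le_add Finset.card_image_le
        Finset.card_image_le)
    have h2 : (#F : ℝ) ≤ Fintype.card V + Fintype.card V + Fintype.card V + 3 := by
      exact_mod_cast h1
    linarith
  have hFU : ∀ A ∈ F, A ⊆ U := by
    intro A hA
    simp only [hF, mem_union, mem_image, mem_univ, true_and, mem_insert, mem_singleton] at hA
    rcases hA with ((⟨v, rfl⟩ | ⟨v, rfl⟩) | ⟨v, rfl⟩) | rfl | rfl | rfl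
    · exact Finset.filter_subset _ _
    · exact Finset.filter_subset _ _
    · exact Finset.filter_subset _ _
    · exact subset_rfl
    · exact commonOut_subset _ _
    · exact commonIn_subset _ _
  have hUn : (#U : ℝ) ≤ n := by rw [hn]; exact_mod_cast Finset.card_le_univ U
  obtain ⟨f, hf⟩ := exists_even_coloring (M := M) (by omega) F (ξ := η / M) (by positivity)
    ((div_le_one hM0).2 (by linarith)) hUn hFU (le_trans (by gcongr) hexp)
  set D : Fin M → Finset V := fun c => U.filter fun x => f x = c with hD
  have hdev : ∀ A ∈ F, ∀ c, (#A : ℝ) / M - η * (n / M) ≤ #(A.filter fun x => f x = c) ∧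
      (#(A.filter fun x => f x = c) : ℝ) ≤ #A / M + η * (n / M) := by
    intro A hA c
    have h1 := abs_le.1 (hf A hA c)
    have h2 : η / M * n = η * (n / M) := by ring
    rw [h2] at h1
    constructor <;> linarith [h1.1, h1.2]
  have hnM : 0 ≤ n / M := by positivity
  have low : ∀ A ∈ F, ∀ a : ℝ, a * n ≤ #A → ∀ c, (a - η) * (n / M)
      ≤ #(A.filter fun x => f x = c) := by
    intro A hA a ha c
    have h1 := (hdev A hA c).1
    have h2 : a * n / M ≤ #A / M := by gcongr
    have h3 : a * n / M = a * (n / M) := by ring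
    linarith
  have upp : ∀ A ∈ F, ∀ a : ℝ, #A ≤ a * n → ∀ c, (#(A.filter fun x => f x = c) : ℝ)
      ≤ (a + η) * (n / M) := by
    intro A hA a ha c
    have h1 := (hdev A hA c).2
    have h2 : (#A : ℝ) / M ≤ a * n / M := by gcongr
    have h3 : a * n / M = a * (n / M) := by ring
    linarith
  have mout : ∀ v, outIn G v U ∈ F := fun v => by simp [hF]
  have minn : ∀ v, innIn G v U ∈ F := fun v => by simp [hF]
  have mnon : ∀ v, nonIn G v U ∈ F := fun v => by simp [hF]
  have mU : U ∈ F := by simp [hF]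
  have mE : commonOut G (E.rtake k) U ∈ F := by simp [hF]
  have mB : commonIn G B U ∈ F := by simp [hF]
  have hD1 : ∀ c, 998 / 1000 * (n / M) ≤ #(D c) := fun c =>
    le_trans (by gcongr; linarith) (low U mU _ hU c)
  have hD2 : ∀ c, (#(D c) : ℝ) ≤ 1001 / 1000 * (n / M) := fun c =>
    (upp U mU 1 (by linarith) c).trans (by gcongr; linarith)
  have hτ := resTol_pos k
  have hβ := linkDensity_pos k
  have hfresh : ∀ c, IsFresh G k (D c) := by
    intro c
    have a1 := hD1 c
    have a2 := hD2 c
    refine ⟨fun v => ?_, fun v => ?_, fun v => ?_⟩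
    · have e : outIn G v (D c) = (outIn G v U).filter fun x => f x = c := by
        rw [hD, outIn, outIn, Finset.filter_comm]
      rw [e]
      have h1 := low _ (mout v) _ (hout v) c
      have h2 : 496 / 1000 * (n / M) ≤ (497 / 1000 - η) * (n / M) := by gcongr; linarith
      linarith
    · have e : innIn G v (D c) = (innIn G v U).filter fun x => f x = c := by
        rw [hD, innIn, innIn, Finset.filter_comm]
      rw [e]
      have h1 := low _ (minn v) _ (hinn v) c
      have h2 : 496 / 1000 * (n / M) ≤ (497 / 1000 - η) * (n / M) := by gcongr; linarith
      linarith
    · have e : nonIn G v (D c) = (nonIn G v U).filter fun x => f x = c := by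
        rw [hD, nonIn, nonIn, Finset.filter_comm]
      rw [e]
      calc _ ≤ (resTol k / 8 + η) * (n / M) := upp _ (mnon v) _ (hnon v) c
        _ ≤ resTol k / 2 * (998 / 1000) * (n / M) := by gcongr; linarith
        _ = resTol k / 2 * (998 / 1000 * (n / M)) := by ring
        _ ≤ _ := by gcongr
  have hcE : ∀ c, linkDensity k / 4 * #(D c) ≤ #(commonOut G (E.rtake k) (D c)) := by
    intro c
    have e : commonOut G (E.rtake k) (D c) = (commonOut G (E.rtake k) U).filter fun x => f x = c :=
      by rw [hD, commonOut, commonOut, Finset.filter_comm]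
    rw [e]
    calc _ ≤ linkDensity k / 4 * (1001 / 1000 * (n / M)) := by gcongr; exact hD2 c
      _ = linkDensity k / 4 * (1001 / 1000) * (n / M) := by ring
      _ ≤ (linkDensity k / 2 - η) * (n / M) := by gcongr; linarith
      _ ≤ _ := low _ mE _ hE c
  have hcB : ∀ c, linkDensity k / 4 * #(D c) ≤ #(commonIn G B (D c)) := by
    intro c
    have e : commonIn G B (D c) = (commonIn G B U).filter fun x => f x = c := by
      rw [hD, commonIn, commonIn, Finset.filter_comm]
    rw [e]
    calc _ ≤ linkDensity k / 4 * (1001 / 1000 * (n / M)) := by gcongr; exact hD2 c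
      _ = linkDensity k / 4 * (1001 / 1000) * (n / M) := by ring
      _ ≤ (linkDensity k / 2 - η) * (n / M) := by gcongr; linarith
      _ ≤ _ := low _ mB _ hB c
  have hdisj : ∀ c c', c ≠ c' → Disjoint (D c) (D c') := by
    intro c c' hcc
    rw [Finset.disjoint_left]
    intro x hx hx'
    exact hcc ((mem_filter.1 hx).2.symm.trans (mem_filter.1 hx').2)
  obtain ⟨m, rfl⟩ : ∃ m, M = m + 2 := ⟨M - 2, by omega⟩
  obtain ⟨N, E', U', g1, g2, g3, g4⟩ := IsState.exists_cover hG hk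
    (s := 998 / 1000 * (n / (m + 2 : ℕ)))
    hsize (Ds := List.ofFn fun i : Fin (m + 1) => D i.succ) (D := D 0) (R := D 0) (B := B) (by simp)
    h (fun A hA => by
      have : ∃ c, A = D c := by
        simp only [List.mem_cons, List.mem_ofFn] at hA
        rcases hA with rfl | ⟨i, rfl⟩
        · exact ⟨0, rfl⟩
        · exact ⟨_, rfl⟩
      obtain ⟨c, rfl⟩ := this
      exact ⟨hfresh c, hD1 c, (hD2 c).trans (by linarith)⟩)
    (by
      rw [List.pairwise_cons, List.pairwise_ofFn]
      refine ⟨fun A hA => ?_, fun i j hij => hdisj _ _ (by simpa using hij.ne)⟩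
      obtain ⟨i, rfl⟩ := List.mem_ofFn.1 hA
      exact hdisj _ _ (Fin.succ_ne_zero i).symm)
    subset_rfl (by simp) (Finset.filter_subset _ _) (fun A hA => by
      obtain ⟨i, rfl⟩ := List.mem_ofFn.1 hA
      exact Finset.filter_subset _ _) (fun x hx => by
      rcases Fin.eq_zero_or_eq_succ (f x) with hc | ⟨i, hc⟩
      · exact Or.inl (mem_filter.2 ⟨hx, hc⟩)
      · exact Or.inr ⟨_, List.mem_ofFn.2 ⟨i, rfl⟩, mem_filter.2 ⟨hx, hc⟩⟩) (hcE 0)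
    (fun A hA => by
      obtain ⟨i, rfl⟩ := List.mem_ofFn.1 (List.mem_of_getLast? hA)
      exact hcB _)
  exact ⟨N, E', U', g1, g2, g3.trans (by linarith), g4⟩

/-- The proportion of pairs of tuples that absorb a given vertex. -/
noncomputable def absorbRate (k : ℕ) : ℝ :=
  drcGamma (1 / 50) k * (1 / 20) ^ k * (drcGamma (1 / 50) k * drcBeta (1 / 50) k ^ k)

lemma absorbRate_pos (k : ℕ) : 0 < absorbRate k := by
  have hb : 0 < drcBeta (1 / 50) k := drcBeta_pos (by norm_num) k
  have hg : 0 < drcGamma (1 / 50) k := drcGamma_pos (by norm_num) k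
  rw [absorbRate]
  positivity

/-- The total weight of the vertices, which halves for a vertex with each of its absorbers. -/
noncomputable def absorbWeight [Fintype V] (G : V → V → Prop) (k : ℕ) (l : List (List V)) : ℝ :=
  ∑ v, (1 / 2) ^ (l.countP fun E => Absorbs G k v E)

/-- Some pair of tuples absorbs a positive proportion of all vertices, counted with weights. -/
lemma IsReservoir.exists_absorbing_pair [Fintype V] (hG : ∀ u v, G u v → ¬ G v u) {k : ℕ}
    (hk : 1 ≤ k) {R : Finset V} (hR : IsReservoir G (resTol k) R) (hR0 : R.Nonempty) (w : V → ℝ)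
    (hw : ∀ v, 0 ≤ w v) :
    ∃ p : (Fin k → V) × (Fin k → V), (∀ i, p.1 i ∈ R) ∧ (∀ i, p.2 i ∈ R) ∧
      absorbRate k * ∑ v, w v ≤ ∑ v with IsAbsorbingPair G k R v p, w v := by
  set P : Finset ((Fin k → V) × (Fin k → V)) :=
    (Fintype.piFinset fun _ : Fin k => R) ×ˢ (Fintype.piFinset fun _ : Fin k => R) with hP
  have hPcard : (#P : ℝ) = (#R : ℝ) ^ k * (#R : ℝ) ^ k := by
    rw [hP, Finset.card_product, Fintype.card_piFinset_const]
    push_cast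
    rfl
  have hP0 : P.Nonempty := by
    obtain ⟨x, hx⟩ := hR0
    exact ⟨(fun _ => x, fun _ => x), by simp [hP, hx]⟩
  have hpairs : ∀ v, absorbRate k * #P ≤ #(P.filter (IsAbsorbingPair G k R v)) := by
    intro v
    rw [hPcard]
    exact hR.card_absorbingPairs hG hk (resTol_pos k).le (resTol_le hk)
      ((resTol_link hk).trans (by
        have := linkDensity_le_one k
        have := linkDensity_pos k
        have hb : 0 < drcBeta (1 / 50) k := drcBeta_pos (by norm_num) k
        gcongr
        nlinarith)) hR0 v
  have hsum : ∑ p ∈ P, absorbRate k * ∑ v, w v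
      ≤ ∑ p ∈ P, ∑ v with IsAbsorbingPair G k R v p, w v := by
    calc ∑ p ∈ P, absorbRate k * ∑ v, w v = ∑ v, w v * (absorbRate k * #P) := by
          rw [Finset.sum_const, nsmul_eq_mul, ← Finset.sum_mul]
          ring
      _ ≤ ∑ v, w v * #(P.filter (IsAbsorbingPair G k R v)) :=
          Finset.sum_le_sum fun v _ => mul_le_mul_of_nonneg_left (hpairs v) (hw v)
      _ = ∑ v, ∑ p ∈ P, if IsAbsorbingPair G k R v p then w v else 0 := by
          refine Finset.sum_congr rfl fun v _ => ?_
          rw [← Finset.sum_filter, Finset.sum_const, nsmul_eq_mul, mul_comm]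
      _ = _ := by
          rw [Finset.sum_comm]
          exact Finset.sum_congr rfl fun p _ => (Finset.sum_filter _ _).symm
  obtain ⟨p, hp, hle⟩ := Finset.exists_le_of_sum_le hP0 hsum
  rw [hP, mem_product, Fintype.mem_piFinset, Fintype.mem_piFinset] at hp
  exact ⟨p, hp.1, hp.2, hle⟩

lemma absorbWeight_append_le [Fintype V] {k : ℕ} {l M : List (List V)} {E' : List V}
    {A : Finset V} (hA : ∀ v ∈ A, Absorbs G k v E') {c : ℝ}
    (hc : c * absorbWeight G k l ≤ ∑ v ∈ A, (1 / 2) ^ (l.countP fun E => Absorbs G k v E)) :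
    absorbWeight G k (l ++ M ++ [E']) ≤ (1 - c / 2) * absorbWeight G k l := by
  have hle : ∀ v, ((1 : ℝ) / 2) ^ ((l ++ M ++ [E']).countP fun E => Absorbs G k v E)
      ≤ (1 / 2) ^ (l.countP fun E => Absorbs G k v E)
        - if v ∈ A then (1 / 2) * (1 / 2) ^ (l.countP fun E => Absorbs G k v E) else 0 := by
    intro v
    rw [List.countP_append, List.countP_append]
    split_ifs with hv
    · have h1 : [E'].countP (fun E => decide (Absorbs G k v E)) = 1 := by simp [hA v hv]
      have h2 : ((1 : ℝ) / 2) ^ (l.countP (fun E => decide (Absorbs G k v E))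
          + M.countP (fun E => decide (Absorbs G k v E)) + 1)
          ≤ (1 / 2) ^ (l.countP (fun E => decide (Absorbs G k v E)) + 1) :=
        pow_le_pow_of_le_one (by norm_num) (by norm_num) (by omega)
      rw [h1]
      refine h2.trans (le_of_eq ?_)
      rw [pow_succ]
      ring
    · rw [sub_zero]
      exact pow_le_pow_of_le_one (by norm_num) (by norm_num) (by omega)
  calc absorbWeight G k (l ++ M ++ [E']) ≤ _ := Finset.sum_le_sum fun v _ => hle v
    _ = absorbWeight G k l
        - 1 / 2 * ∑ v ∈ A, (1 / 2) ^ (l.countP fun E => Absorbs G k v E) := by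
      rw [Finset.sum_sub_distrib, absorbWeight, Finset.mul_sum]
      congr 1
      rw [← Finset.sum_filter]
      simp
    _ ≤ _ := by linarith

/-- Prolonging a path by an entry that absorbs a positive proportion of all vertices. -/
lemma IsState.exists_absorber [Fintype V] (hG : ∀ u v, G u v → ¬ G v u) {k : ℕ} (hk : 1 ≤ k)
    {l : List (List V)} {E : List V} {U : Finset V} (h : IsState G k l E U)
    (hR : IsReservoir G (resTol k) U) (hsize : resSize k < #U)
    (hS : linkDensity k / 4 * #U ≤ #(commonOut G (E.rtake k) U)) :
    ∃ (M : List (List V)) (E' : List V) (W : Finset V), IsState G k (l ++ M) E' (U \ W) ∧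
      #W ≤ 6 * k ∧ linkDensity k * #U ≤ #(commonOut G (E'.rtake k) U) ∧
      absorbWeight G k (l ++ M) ≤ (1 - absorbRate k / 2) * absorbWeight G k l := by
  have hU : (0 : ℝ) < #U := (resSize_nonneg k).trans_lt hsize
  have hU0 : U.Nonempty := Finset.card_pos.1 (by exact_mod_cast hU)
  obtain ⟨p, hp1, hp2, hp⟩ := hR.exists_absorbing_pair hG hk hU0
    (fun v => (1 / 2) ^ (l.countP fun E => Absorbs G k v E)) (fun v => by positivity)
  set A : Finset V := univ.filter fun v => IsAbsorbingPair G k U v p with hA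
  have hpos : 0 < ∑ v ∈ A, ((1 : ℝ) / 2) ^ (l.countP fun E => Absorbs G k v E) := by
    refine lt_of_lt_of_le (mul_pos (absorbRate_pos k) ?_) hp
    obtain ⟨x, -⟩ := hU0
    exact Finset.sum_pos (fun v _ => by positivity) ⟨x, mem_univ x⟩
  have hA0 : A.Nonempty := by
    by_contra hne
    rw [Finset.not_nonempty_iff_eq_empty] at hne
    rw [hne, Finset.sum_empty] at hpos
    exact lt_irrefl _ hpos
  have hAp : ∀ v ∈ A, IsAbsorbingPair G k U v p := fun v hv => (mem_filter.1 hv).2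
  set X := List.ofFn p.1 with hX
  set Y := List.ofFn p.2 with hY
  have hXl : X.length = k := by simp [hX]
  have hYl : Y.length = k := by simp [hY]
  obtain ⟨t1, t2⟩ := take_rtake_of_append (Z := []) hXl hYl
  rw [List.nil_append] at t1 t2
  obtain ⟨v, hv⟩ := hA0
  obtain ⟨q1, q2, q3⟩ := hAp v hv
  have hpw : (X ++ Y).Pairwise G :=
    q1.sublist (List.Sublist.append_left (List.sublist_cons_self v Y) X)
  have hmem : ∀ x ∈ X ++ Y, x ∈ U := by
    intro x hx
    simp only [hX, hY, List.mem_append, List.mem_ofFn] at hx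
    rcases hx with ⟨i, rfl⟩ | ⟨i, rfl⟩
    · exact hp1 i
    · exact hp2 i
  have hin : linkDensity k * #U ≤ #(commonIn G X U) :=
    le_trans (by gcongr; exact linkDensity_le k) q2
  have hout : linkDensity k * #U ≤ #(commonOut G Y U) :=
    le_trans (by gcongr; exact linkDensity_le k) q3
  obtain ⟨M, W, h1, h2, h3, h4, h5⟩ := h.extend hG hk hR subset_rfl hsize (E' := X ++ Y)
    ⟨by simp; omega, hpw⟩ (by simp; omega) hmem hS (by rwa [t1]) (by rwa [t2])
  refine ⟨M ++ [X ++ Y], X ++ Y, W ∪ (X ++ Y).toFinset, ?_, ?_, by rwa [t2], ?_⟩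
  · convert h1 using 1
    · simp
    · ext x; simp only [mem_sdiff, mem_union]; tauto
  · have := List.toFinset_card_le (X ++ Y)
    rw [List.length_append] at this
    refine (Finset.card_union_le _ _).trans ?_
    omega
  · rw [← List.append_assoc]
    refine absorbWeight_append_le (A := A) (fun u hu => ?_) hp
    exact ⟨X, Y, rfl, hXl, hYl, (hAp u hu).1⟩

lemma absorbWeight_nonneg [Fintype V] (k : ℕ) (l : List (List V)) : 0 ≤ absorbWeight G k l :=
  Finset.sum_nonneg fun v _ => by positivity

/-- Prolonging a path by many absorbers. -/
lemma IsState.exists_absorbers [Fintype V] (hG : ∀ u v, G u v → ¬ G v u) {k : ℕ} (hk : 1 ≤ k)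
    {l : List (List V)} {E : List V} {U : Finset V} {n a : ℝ} {m : ℕ} (h : IsState G k l E U)
    (hn : n = Fintype.card V) (hV : IsFresh G k (univ : Finset V)) (hsize : 2 * resSize k < n)
    (hm : a + 6 * k * m ≤ linkDensity k / 1000 * n) (ha : 0 ≤ a) (hU : n - a ≤ #U)
    (hE : linkDensity k / 2 * n ≤ #(commonOut G (E.rtake k) U)) :
    ∃ (M : List (List V)) (E' : List V) (U' : Finset V), IsState G k (l ++ M) E' U' ∧
      n - linkDensity k / 1000 * n ≤ #U' ∧
      linkDensity k / 2 * n ≤ #(commonOut G (E'.rtake k) U') ∧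
      absorbWeight G k (l ++ M) ≤ Real.exp (-(absorbRate k / 2 * m)) * n := by
  have hβ := linkDensity_pos k
  have hβ1 := linkDensity_le_one k
  have hnn := resSize_nonneg k
  have hn0 : 0 < n := by linarith
  suffices hj : ∀ j : ℕ, j ≤ m → ∃ (M : List (List V)) (E' : List V) (U' : Finset V),
      IsState G k (l ++ M) E' U' ∧ n - (a + 6 * k * j) ≤ #U' ∧
      linkDensity k / 2 * n ≤ #(commonOut G (E'.rtake k) U') ∧
      absorbWeight G k (l ++ M) ≤ Real.exp (-(absorbRate k / 2 * j)) * n by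
    obtain ⟨M, E', U', h1, h2, h3, h4⟩ := hj m le_rfl
    exact ⟨M, E', U', h1, by linarith, h3, h4⟩
  intro j
  induction j with
  | zero =>
    intro _
    refine ⟨[], E, U, by simpa using h, by simpa using hU, hE, ?_⟩
    calc absorbWeight G k (l ++ []) ≤ ∑ v : V, (1 : ℝ) :=
          Finset.sum_le_sum fun v _ => pow_le_one₀ (by norm_num) (by norm_num)
      _ = _ := by simp [hn]
  | succ j ih =>
    intro hjm
    obtain ⟨M, E', U', h1, h2, h3, h4⟩ := ih (by omega)
    have hjm' : (j : ℝ) + 1 ≤ m := by exact_mod_cast hjm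
    have hkj : 6 * (k : ℝ) * (j + 1) ≤ 6 * k * m := by gcongr
    have hkj0 : 0 ≤ 6 * (k : ℝ) * j := by positivity
    have hk0 : 0 ≤ 6 * (k : ℝ) := by positivity
    have hβn : linkDensity k / 1000 * n ≤ 1 / 1000 * n := by gcongr
    have hU1 : n - linkDensity k / 1000 * n ≤ #U' := by linarith
    have hU2 : (#U' : ℝ) ≤ n := by rw [hn]; exact_mod_cast Finset.card_le_univ U'
    have hR : IsReservoir G (resTol k) U' := by
      refine hV.isReservoir (Finset.subset_univ _) ?_
      have : (#(univ \ U') : ℝ) + #U' = n := by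
        rw [hn]
        exact_mod_cast Finset.card_sdiff_add_card_eq_card (Finset.subset_univ U')
      rw [Finset.card_univ, ← hn]
      linarith
    have hlink : linkDensity k / 4 * #U' ≤ #(commonOut G (E'.rtake k) U') := by
      refine le_trans ?_ h3
      gcongr
      norm_num
    obtain ⟨N, F, W, g1, g2, g3, g4⟩ := h1.exists_absorber hG hk hR (by linarith) hlink
    have hW : (#W : ℝ) ≤ 6 * k := by exact_mod_cast g2
    refine ⟨M ++ N, F, U' \ W, by simpa using g1, ?_, ?_, ?_⟩
    · have := card_sdiff_ge U' W
      push_cast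
      linarith
    · have e : commonOut G (F.rtake k) (U' \ W) = commonOut G (F.rtake k) U' \ W := by
        ext x; simp only [commonOut, mem_sdiff, mem_filter]; tauto
      have h5 := card_sdiff_ge (commonOut G (F.rtake k) U') W
      have h6 : linkDensity k * (999 / 1000 * n) ≤ linkDensity k * #U' := by
        gcongr
        linarith
      have h7 : 0 < linkDensity k * n := by positivity
      rw [e]
      linarith
    · rw [← List.append_assoc]
      calc absorbWeight G k (l ++ M ++ N)
          ≤ (1 - absorbRate k / 2) * absorbWeight G k (l ++ M) := g4
        _ ≤ Real.exp (-(absorbRate k / 2)) * absorbWeight G k (l ++ M) := by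
            refine mul_le_mul_of_nonneg_right ?_ (absorbWeight_nonneg _ _)
            linarith [Real.add_one_le_exp (-(absorbRate k / 2))]
        _ ≤ Real.exp (-(absorbRate k / 2)) * (Real.exp (-(absorbRate k / 2 * j)) * n) := by gcongr
        _ = _ := by
            rw [← mul_assoc, ← Real.exp_add]
            congr 2
            push_cast
            ring

/-- A small total weight means that every vertex has many absorbers. -/
lemma lt_countP_of_absorbWeight [Fintype V] {k : ℕ} {l : List (List V)} {t : ℝ}
    (h : absorbWeight G k l < Real.exp (-t)) (v : V) :
    t < (l.countP fun E => Absorbs G k v E) := by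
  by_contra! hle
  have h1 : ((1 : ℝ) / 2) ^ (l.countP fun E => Absorbs G k v E) ≤ absorbWeight G k l :=
    Finset.single_le_sum (f := fun v => ((1 : ℝ) / 2) ^ (l.countP fun E => Absorbs G k v E))
      (fun v _ => by positivity) (mem_univ v)
  have h2 : Real.exp (-1) ≤ 1 / 2 := by
    rw [Real.exp_neg, inv_eq_one_div]
    exact one_div_le_one_div_of_le (by norm_num) (by linarith [Real.add_one_le_exp (1 : ℝ)])
  have h3 : Real.exp (-(l.countP fun E => Absorbs G k v E : ℕ))
      ≤ (1 / 2) ^ (l.countP fun E => Absorbs G k v E) := by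
    calc _ = Real.exp (-1) ^ (l.countP fun E => Absorbs G k v E) := by
          rw [← Real.exp_nat_mul]; congr 1; ring
      _ ≤ _ := by gcongr
  have h4 : Real.exp (-t) ≤ Real.exp (-(l.countP fun E => Absorbs G k v E : ℕ)) :=
    Real.exp_le_exp.2 (by linarith)
  linarith

/-- If every unused vertex has enough absorbers, then a closed path can be completed to a Hamilton
cycle power. -/
lemma IsState.hasPowHamCycle {n k : ℕ} {G : Fin n → Fin n → Prop} (hkn : k ≤ n)
    {E₀ E : List (Fin n)} {l : List (List (Fin n))} {U : Finset (Fin n)}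
    (h : IsState G k (E₀ :: l) E U) (hcl : Dominates G (E.rtake k) (E₀.take k))
    (habs : ∀ v, #U ≤ (E₀ :: l).countP fun E => Absorbs G k v E) : HasPowHamCycle k G := by
  obtain ⟨l', h1, h2, h3⟩ := exists_absorb_list U.toList (E₀ :: l) h.path.entry
    (fun v _ => by rw [Finset.length_toList]; exact habs v)
  cases l' with
  | nil => simp at h1
  | cons F₀ l' =>
    have hF : ends k F₀ = ends k E₀ := by
      rw [List.map_cons, List.map_cons, List.cons.injEq] at h1
      exact h1.1
    refine hasPowHamCycle_of_isPath (E₁ := E) hkn ⟨h2, ?_, ?_⟩ ?_ (fun v => ?_) ?_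
    · rw [h1]
      exact h.path.chain
    · rw [h3.nodup_iff, List.nodup_append']
      refine ⟨U.nodup_toList, h.path.nodup, fun x hx hx' => ?_⟩
      exact (h.mem_iff x).1 (Finset.mem_toList.1 hx) hx'
    · rw [h1, List.getLast?_map, h.last]
      rfl
    · rw [h3.mem_iff, List.mem_append, Finset.mem_toList, h.mem_iff]
      exact (em _).symm
    · have : F₀.take k = E₀.take k := congrArg Prod.fst hF
      rwa [this]

lemma isState_singleton [Fintype V] (hG : ∀ u v, G u v → ¬ G v u) {k : ℕ} {E : List V}
    (hE : IsEntry G k E) : IsState G k [E] E (univ \ E.toFinset) := by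
  refine ⟨⟨by simpa using hE, by simp, by simpa using nodup_of_pairwise hG hE.2⟩, by simp, ?_⟩
  intro v
  simp

/-- A closed path missing so few vertices that they can all be absorbed, under explicit numerical
conditions. -/
lemma exists_closed_state [Fintype V] (hG : ∀ u v, G u v → ¬ G v u) {k : ℕ} (hk : 1 ≤ k) {n : ℝ}
    (hcard : n = Fintype.card V) (hout : ∀ v, 499 / 1000 * n ≤ #(outIn G v univ))
    (hinn : ∀ v, 499 / 1000 * n ≤ #(innIn G v univ))
    (hnon : ∀ v, (#(nonIn G v univ) : ℝ) ≤ resTol k / 8 * n) {η : ℝ} {m M : ℕ} (hM : 2 ≤ M)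
    (hη0 : 0 < η) (hη1 : η ≤ 1 / 1000) (hη2 : η ≤ resTol k / 8) (hη3 : η ≤ linkDensity k / 8)
    (hm : 200 * (k : ℝ) + 6 * k * m ≤ linkDensity k / 1000 * n)
    (hsize : 2 * resSize k < 998 / 1000 * (n / M))
    (hexp : 2 * (3 * n + 3) * M ≤ Real.exp ((η / M) ^ 2 / 4 * n))
    (habs : n < Real.exp (absorbRate k / 2 * m - 3 * (n / M))) :
    ∃ (E₀ E : List V) (l : List (List V)) (U : Finset V), IsState G k (E₀ :: l) E U ∧
      Dominates G (E.rtake k) (E₀.take k) ∧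
      ∀ v, #U ≤ (E₀ :: l).countP fun E => Absorbs G k v E := by
  have hβ := linkDensity_pos k
  have hβ1 := linkDensity_le_one k
  have hτ := resTol_pos k
  have hnn := resSize_nonneg k
  have hk1 : (1 : ℝ) ≤ k := by exact_mod_cast hk
  have hM2 : (2 : ℝ) ≤ M := by exact_mod_cast hM
  have hn0 : 0 ≤ n := by rw [hcard]; positivity
  have hnM : n / M ≤ n := div_le_self hn0 (by linarith)
  have hn1 : 2 * resSize k < n := by linarith
  have hnpos : (0 : ℝ) < n := by linarith
  have hcard' : (#(univ : Finset V) : ℝ) = n := by rw [Finset.card_univ, hcard]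
  have hV : IsFresh G k (univ : Finset V) := by
    refine ⟨fun v => ?_, fun v => ?_, fun v => ?_⟩
    · rw [hcard']; linarith [hout v]
    · rw [hcard']; linarith [hinn v]
    · rw [hcard']
      refine (hnon v).trans ?_
      gcongr
      norm_num
  have hVr := hV.isReservoir subset_rfl (by
    rw [Finset.sdiff_self, Finset.card_empty, Nat.cast_zero]
    positivity)
  have hV0 : (univ : Finset V).Nonempty :=
    Finset.card_pos.1 (by exact_mod_cast hcard'.symm ▸ hnpos)
  obtain ⟨E₀, e1, e2, -, e4, e5⟩ := exists_long_piece hG hk hVr hVr hV0 hV0 hnpos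
    (Q := univ) (fun v => by rw [← hcard']; exact hVr.non_le v)
    (by rw [hcard']; exact div_le_self hn0 (by linarith))
  rw [hcard'] at e4 e5
  have hs := isState_singleton hG e1
  have hE₀ := card_toFinset_le E₀
  have hE₀' : (E₀.length : ℝ) = 200 * k := by exact_mod_cast e2
  have hkm : 0 ≤ 6 * (k : ℝ) * m := by positivity
  have hβn : 0 < linkDensity k * n := by positivity
  have hβn1 : linkDensity k * n ≤ 1 * n := by gcongr
  obtain ⟨N, E₁, U₁, h1, h2, h3, h4⟩ := hs.exists_absorbers hG hk hcard hV hn1 hm (by positivity)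
    (by
      have := card_sdiff_ge (univ : Finset V) E₀.toFinset
      rw [hcard'] at this
      linarith)
    (by
      have e : commonOut G (E₀.rtake k) (univ \ E₀.toFinset)
          = commonOut G (E₀.rtake k) univ \ E₀.toFinset := by
        ext x; simp only [commonOut, mem_sdiff, mem_filter]; tauto
      rw [e]
      have := card_sdiff_ge (commonOut G (E₀.rtake k) univ) E₀.toFinset
      linarith)
  have hloss : (#(univ \ U₁) : ℝ) ≤ linkDensity k / 1000 * n := by
    have : (#(univ \ U₁) : ℝ) + #U₁ = n := by
      rw [← hcard']
      exact_mod_cast Finset.card_sdiff_add_card_eq_card (Finset.subset_univ U₁)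
    linarith
  have hfilter : ∀ p : V → Prop, (#(univ.filter p) : ℝ) - linkDensity k / 1000 * n
      ≤ #(U₁.filter p) := by
    intro p
    have hsub : univ.filter p ⊆ U₁.filter p ∪ (univ \ U₁) := by
      intro x; simp only [mem_union, mem_filter, mem_sdiff, mem_univ, true_and]; tauto
    have : (#(univ.filter p) : ℝ) ≤ #(U₁.filter p) + #(univ \ U₁) := by
      exact_mod_cast (Finset.card_le_card hsub).trans (Finset.card_union_le _ _)
    linarith
  have hB : linkDensity k / 2 * n ≤ #(commonIn G (E₀.take k) U₁) := by
    have : (#(commonIn G (E₀.take k) univ) : ℝ) - linkDensity k / 1000 * n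
      ≤ #(commonIn G (E₀.take k) U₁) := by
      simp only [commonIn]
      convert hfilter _
    linarith
  obtain ⟨N', E₂, U₂, g1, -, g3, g4⟩ := h1.exists_almost_cover hG hk hM hcard hη0 hη1 hη2 hη3
    (by linarith)
    (fun v => by
      have : (#(outIn G v univ) : ℝ) - linkDensity k / 1000 * n ≤ #(outIn G v U₁) := hfilter _
      linarith [hout v])
    (fun v => by
      have : (#(innIn G v univ) : ℝ) - linkDensity k / 1000 * n ≤ #(innIn G v U₁) := hfilter _
      linarith [hinn v])
    (fun v => le_trans
      (by exact_mod_cast Finset.card_le_card (nonIn_mono (Finset.subset_univ U₁) v)) (hnon v))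
    h3 hB hsize hexp
  have hw : absorbWeight G k ([E₀] ++ N) < Real.exp (-(3 * (n / M))) := by
    refine h4.trans_lt ?_
    calc _ < Real.exp (-(absorbRate k / 2 * m))
          * Real.exp (absorbRate k / 2 * m - 3 * (n / M)) := by gcongr
      _ = _ := by rw [← Real.exp_add]; congr 1; ring
  have hfin : IsState G k (E₀ :: (N ++ N')) E₂ U₂ := by simpa using g1
  refine ⟨E₀, E₂, N ++ N', U₂, hfin, g4, fun v => ?_⟩
  have h5 := lt_countP_of_absorbWeight hw v
  have h6 : #U₂ ≤ ([E₀] ++ N).countP fun E => Absorbs G k v E := by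
    have : (#U₂ : ℝ) ≤ (([E₀] ++ N).countP fun E => Absorbs G k v E : ℕ) := g3.trans h5.le
    exact_mod_cast this
  refine h6.trans ?_
  have : E₀ :: (N ++ N') = ([E₀] ++ N) ++ N' := by simp
  rw [this, List.countP_append (l₁ := [E₀] ++ N)]
  exact Nat.le_add_right _ _

lemma linear_le_exp {a : ℝ} (ha : 0 < a) (A B : ℝ) :
    ∀ᶠ n : ℕ in Filter.atTop, A * n + B < Real.exp (a * n) := by
  filter_upwards [Filter.eventually_ge_atTop 1,
    Filter.eventually_ge_atTop ⌈2 * (|A| + |B|) / a ^ 2⌉₊] with n h1 h2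
  have h1' : (1 : ℝ) ≤ n := by exact_mod_cast h1
  have h2' := Nat.ceil_le.1 h2
  rw [div_le_iff₀ (by positivity)] at h2'
  have h3 := Real.quadratic_le_exp_of_nonneg (x := a * n) (by positivity)
  have h4 : A * n ≤ |A| * n := by gcongr; exact le_abs_self A
  have h5 : B ≤ |B| * n := (le_abs_self B).trans (le_mul_of_one_le_right (abs_nonneg B) h1')
  have h6 : 2 * (|A| + |B|) * n ≤ n * a ^ 2 * n := by gcongr
  have h7 : 0 < a * n := by positivity
  nlinarith

end Digraph

lemma outDeg_eq {n : ℕ} (G : Fin n → Fin n → Prop) (v : Fin n) :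
    outDeg G v = #(outIn G v univ) := by
  rw [outDeg, ← Set.ncard_coe_finset]
  congr 1
  ext w
  simp [outIn]

lemma inDeg_eq {n : ℕ} (G : Fin n → Fin n → Prop) (v : Fin n) :
    inDeg G v = #(innIn G v univ) := by
  rw [inDeg, ← Set.ncard_coe_finset]
  congr 1
  ext w
  simp [innIn]

lemma degree_slack_le {k : ℕ} (hk : 1 ≤ k) : 1 / (10 : ℝ) ^ (6000 * k) ≤ resTol k / 16 := by
  rw [resTol, div_div]
  refine one_div_le_one_div_of_le (by positivity) ?_
  calc (10 : ℝ) ^ (5000 * k) * 16 ≤ 10 ^ (5000 * k) * 10 ^ (1000 * k) := by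
        gcongr
        calc (16 : ℝ) ≤ 10 ^ 2 := by norm_num
          _ ≤ _ := pow_le_pow_right₀ (by norm_num) (by omega)
    _ = 10 ^ (6000 * k) := by rw [← pow_add]; congr 1; ring

/-- For every `k ≥ 2` there is `n₀` such that every oriented graph on `n ≥ n₀` vertices
with minimum semi-degree at least `(1/2 - 1/10^(6000k))n` contains the `k`-th power of a
Hamilton cycle. -/
theorem statement_1 (k : ℕ) (hk : 2 ≤ k) :
    ∃ n₀ : ℕ, ∀ n : ℕ, n₀ ≤ n → ∀ G : Fin n → Fin n → Prop, IsOriented G →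
      (∀ v, (1/2 - 1/(10:ℝ)^(6000*k)) * n ≤ ((min (outDeg G v) (inDeg G v) : ℕ) : ℝ)) →
      HasPowHamCycle k G := by
  have hk1 : 1 ≤ k := by omega
  have hk0 : (0 : ℝ) < k := by exact_mod_cast hk1
  have hβ := linkDensity_pos k
  have hτ := resTol_pos k
  have hc := absorbRate_pos k
  set β := linkDensity k with hβ'
  set c := absorbRate k with hc'
  obtain ⟨θ, hθ⟩ : ∃ θ, θ = β / (10000 * k) := ⟨_, rfl⟩
  have hθ0 : 0 < θ := by rw [hθ]; positivity
  have hθk : k * θ = β / 10000 := by rw [hθ]; field_simp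
  obtain ⟨M, hM⟩ : ∃ M : ℕ, M = ⌈12 / (c * θ)⌉₊ + 2 := ⟨_, rfl⟩
  have hM2 : 2 ≤ M := by omega
  have hM0 : (0 : ℝ) < M := by exact_mod_cast (by omega : 0 < M)
  have hMc : 12 ≤ M * (c * θ) := by
    rw [← div_le_iff₀ (by positivity)]
    refine (Nat.le_ceil _).trans ?_
    exact_mod_cast (by omega)
  obtain ⟨η, hη⟩ : ∃ η, η = min (1 / 1000) (min (resTol k / 8) (β / 8)) := ⟨_, rfl⟩
  have hη0 : 0 < η := by rw [hη]; positivity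
  have hη1 : η ≤ 1 / 1000 := by rw [hη]; exact min_le_left _ _
  have hη2 : η ≤ resTol k / 8 := by
    rw [hη]; exact (min_le_right _ _).trans (min_le_left _ _)
  have hη3 : η ≤ β / 8 := by rw [hη]; exact (min_le_right _ _).trans (min_le_right _ _)
  have hev : ∀ᶠ n : ℕ in Filter.atTop, k ≤ n ∧ 200 * (k : ℝ) ≤ β / 10000 * n ∧
      2 * resSize k < 998 / 1000 * ((n : ℝ) / M) ∧
      6 * M * (n : ℝ) + 6 * M < Real.exp ((η / M) ^ 2 / 4 * n) ∧
      Real.exp (c / 2) * n + 0 < Real.exp (c * θ / 4 * n) := by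
    refine (Filter.eventually_ge_atTop k).and (Filter.Eventually.and ?_ (Filter.Eventually.and ?_
      ((linear_le_exp (by positivity) _ _).and (linear_le_exp (by positivity) _ _))))
    · filter_upwards [Filter.eventually_ge_atTop ⌈200 * (k : ℝ) / (β / 10000)⌉₊] with n hn
      have := Nat.ceil_le.1 hn
      rw [div_le_iff₀ (by positivity)] at this
      linarith
    · filter_upwards [Filter.eventually_gt_atTop ⌈2 * resSize k / (998 / 1000 / M)⌉₊] with n hn
      have := (Nat.le_ceil _).trans_lt (Nat.cast_lt (α := ℝ).2 hn)
      rw [div_lt_iff₀ (by positivity)] at this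
      refine this.trans_eq ?_
      ring
  obtain ⟨n₀, hn₀⟩ := Filter.eventually_atTop.1 hev
  refine ⟨n₀, fun n hn G hG hdeg => ?_⟩
  obtain ⟨h1, h2, h3, h4, h5⟩ := hn₀ n hn
  have hε := degree_slack_le hk1
  have hτ1 := resTol_le hk1
  have hn0 : (0 : ℝ) ≤ n := by positivity
  have hεn : 1 / (10 : ℝ) ^ (6000 * k) * n ≤ resTol k / 16 * n := by gcongr
  have hτn : resTol k * n ≤ 1 / 100 * n := by gcongr
  have hmin : ∀ v, (1 / 2 - 1 / (10 : ℝ) ^ (6000 * k)) * n ≤ #(outIn G v univ) ∧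
      (1 / 2 - 1 / (10 : ℝ) ^ (6000 * k)) * n ≤ #(innIn G v univ) := by
    intro v
    rw [← outDeg_eq, ← inDeg_eq]
    exact ⟨(hdeg v).trans (by exact_mod_cast min_le_left _ _),
      (hdeg v).trans (by exact_mod_cast min_le_right _ _)⟩
  have hm1 : ((⌊θ * n⌋₊ : ℕ) : ℝ) ≤ θ * n := Nat.floor_le (by positivity)
  have hm2 : θ * n < (⌊θ * n⌋₊ : ℕ) + 1 := Nat.lt_floor_add_one _
  obtain ⟨E₀, E, l, U, s1, s2, s3⟩ := exists_closed_state (n := n) (m := ⌊θ * n⌋₊) hG hk1 (by simp)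
    (fun v => by linarith [(hmin v).1]) (fun v => by linarith [(hmin v).2])
    (fun v => by
      have := card_out_add_inn_add_non hG v univ
      rw [Finset.card_univ, Fintype.card_fin] at this
      linarith [(hmin v).1, (hmin v).2]) hM2 hη0 hη1 hη2 hη3
    (by
      have : 6 * (k : ℝ) * (⌊θ * n⌋₊ : ℕ) ≤ 6 * k * (θ * n) := by gcongr
      have e : 6 * (k : ℝ) * (θ * n) = 6 * (k * θ) * n := by ring
      rw [e, hθk] at this
      linarith) h3 (by linarith)
    (by
      have e1 : c / 2 * (θ * n) ≤ c / 2 * ((⌊θ * n⌋₊ : ℕ) + 1) := by gcongr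
      have e2 : 3 * ((n : ℝ) / M) ≤ c * θ / 4 * n := by
        rw [mul_div_assoc', div_le_iff₀ hM0]
        have := mul_le_mul_of_nonneg_right hMc hn0
        linarith
      have e3 : Real.exp (c * θ / 4 * n) ≤ Real.exp (c / 2)
          * Real.exp (c / 2 * (⌊θ * n⌋₊ : ℕ) - 3 * (n / M)) := by
        rw [← Real.exp_add, Real.exp_le_exp]
        linarith
      have e4 := h5.trans_le e3
      rw [add_zero] at e4
      exact lt_of_mul_lt_mul_left e4 (Real.exp_pos _).le)
  exact s1.hasPowHamCycle h1 s2 s3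

end Paper
end

section
/- For every integer k ≥ 15 and every sufficiently large n ∈ ℕ, there exists an n-vertex oriented graph R_k with minimum semi-degree δ⁰(R_k) > (1/2 − 4/2^{k/5})n that contains no copy of the transitive tournament on k+1 vertices, and hence contains no kth power of a Hamilton cycle. -/
namespace Paper

/-- `G` contains a copy of the transitive tournament on `m` vertices. -/
def ContainsTransTournament {n : ℕ} (G : Fin n → Fin n → Prop) (m : ℕ) : Prop :=
  ∃ f : Fin m → Fin n, Function.Injective f ∧ ∀ i j : Fin m, i < j → G (f i) (f j)

/-- The tournament on a linear order in which the pair `u < v` is oriented from `u` to `v`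
exactly when `c (u, v)` is true. -/
def tournamentOf {V : Type*} [LinearOrder V] (c : V × V → Bool) (u v : V) : Prop :=
  (u < v ∧ c (u, v) = true) ∨ (v < u ∧ c (v, u) = false)

instance {V : Type*} [LinearOrder V] (c : V × V → Bool) (u v : V) :
    Decidable (tournamentOf c u v) := by
  unfold tournamentOf
  infer_instance

theorem tournamentOf_irrefl {V : Type*} [LinearOrder V] (c : V × V → Bool) (u : V) :
    ¬ tournamentOf c u u := by
  simp [tournamentOf]

theorem tournamentOf_asymm {V : Type*} [LinearOrder V] {c : V × V → Bool} {u v : V}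
    (h : tournamentOf c u v) : ¬ tournamentOf c v u := by
  rcases h with ⟨h₁, h₂⟩ | ⟨h₁, h₂⟩ <;> simp [tournamentOf, h₁.not_gt, h₂]

theorem tournamentOf_total {V : Type*} [LinearOrder V] (c : V × V → Bool) {u v : V}
    (h : u ≠ v) : tournamentOf c u v ∨ tournamentOf c v u := by
  rcases lt_or_gt_of_ne h with h | h
  · cases hc : c (u, v) <;> simp [tournamentOf, h, hc]
  · cases hc : c (v, u) <;> simp [tournamentOf, h, hc]

/-- The number of Boolean functions with values prescribed on a subset. -/
theorem card_filter_agree_on {E : Type*} [Fintype E] [DecidableEq E] (S : Finset E)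
    (b : E → Bool) :
    (Finset.univ.filter fun c : E → Bool => ∀ e ∈ S, c e = b e).card * 2 ^ S.card
      = 2 ^ Fintype.card E := by
  have h : (Finset.univ.filter fun c : E → Bool => ∀ e ∈ S, c e = b e)
      = Fintype.piFinset fun e => if e ∈ S then {b e} else Finset.univ := by
    ext c
    simp only [Finset.mem_filter, Finset.mem_univ, true_and, Fintype.mem_piFinset]
    refine forall_congr' fun e => ?_
    by_cases he : e ∈ S <;> simp [he]
  have h₂ : 2 ^ S.card = ∏ e : E, if e ∈ S then 2 else 1 := by
    simp
  rw [h, Fintype.card_piFinset, h₂, ← Finset.prod_mul_distrib]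
  have h₃ : ∀ e : E, (if e ∈ S then {b e} else Finset.univ : Finset Bool).card
      * (if e ∈ S then 2 else 1) = 2 := by
    intro e
    by_cases he : e ∈ S <;> simp [he]
  simp only [h₃, Finset.prod_const, Finset.card_univ]

theorem card_pairs_lt (t : ℕ) :
    (Finset.univ.filter fun p : Fin t × Fin t => p.1 < p.2).card = t.choose 2 := by
  have h : (Finset.univ.filter fun p : Fin t × Fin t => p.1 < p.2).card
      = ∑ j : Fin t, (j : ℕ) := by
    rw [Finset.card_filter, Fintype.sum_prod_type_right]
    refine Finset.sum_congr rfl fun j _ => ?_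
    simp only [← Finset.card_filter]
    rw [show (Finset.univ.filter fun i : Fin t => i < j) = Finset.Iio j by ext; simp]
    simp
  rw [h, Fin.sum_univ_eq_sum_range (fun i => i), Finset.sum_range_id, Nat.choose_two_right]

/-- The orientations in which a given sequence spans a transitive tournament are few. -/
theorem card_transitive_le {m t : ℕ} (h : Fin t → Fin m) :
    (Finset.univ.filter fun c : Fin m × Fin m → Bool =>
      ∀ i j, i < j → tournamentOf c (h i) (h j)).card * 2 ^ t.choose 2 ≤ 2 ^ (m * m) := by
  by_cases hinj : Function.Injective h
  swap
  · have : (Finset.univ.filter fun c : Fin m × Fin m → Bool =>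
        ∀ i j, i < j → tournamentOf c (h i) (h j)) = ∅ := by
      refine Finset.filter_eq_empty_iff.mpr fun c _ hc => hinj fun i j hij => ?_
      by_contra hne
      rcases lt_or_gt_of_ne hne with hlt | hlt
      · have := hc i j hlt
        rw [hij] at this
        exact tournamentOf_irrefl c _ this
      · have := hc j i hlt
        rw [hij] at this
        exact tournamentOf_irrefl c _ this
    simp [this]
  set g : Fin t × Fin t → Fin m × Fin m := fun p => (min (h p.1) (h p.2), max (h p.1) (h p.2))
  set P := Finset.univ.filter fun p : Fin t × Fin t => p.1 < p.2
  have hg : Set.InjOn g P := by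
    rintro ⟨i, j⟩ hp ⟨i', j'⟩ hp' heq
    have hij : i < j := by simpa [P] using hp
    have hij' : i' < j' := by simpa [P] using hp'
    simp only [g, Prod.mk.injEq] at heq
    have key : (h i = h i' ∧ h j = h j') ∨ (h i = h j' ∧ h j = h i') := by
      rcases le_total (h i) (h j) with h₁ | h₁ <;> rcases le_total (h i') (h j') with h₂ | h₂ <;>
        simp only [h₁, h₂, min_eq_left, min_eq_right, max_eq_left, max_eq_right] at heq <;> tauto
    rcases key with ⟨h₁, h₂⟩ | ⟨h₁, h₂⟩
    · rw [hinj h₁, hinj h₂]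
    · rw [hinj h₁, hinj h₂] at hij
      exact absurd hij hij'.not_gt
  have hcard : (P.image g).card = t.choose 2 := by
    rw [Finset.card_image_of_injOn hg, card_pairs_lt]
  set b : Fin m × Fin m → Bool := fun e => decide (∃ i j, i < j ∧ e = (h i, h j))
  have hsub : (Finset.univ.filter fun c : Fin m × Fin m → Bool =>
      ∀ i j, i < j → tournamentOf c (h i) (h j)) ⊆
      Finset.univ.filter fun c : Fin m × Fin m → Bool => ∀ e ∈ P.image g, c e = b e := by
    intro c hc
    simp only [Finset.mem_filter, Finset.mem_univ, true_and] at hc ⊢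
    intro e he
    obtain ⟨⟨i, j⟩, hp, rfl⟩ := Finset.mem_image.mp he
    have hij : i < j := by simpa [P] using hp
    rcases hc i j hij with ⟨h₁, h₂⟩ | ⟨h₁, h₂⟩
    · have hb : b (h i, h j) = true := by
        simp only [b, decide_eq_true_eq]
        exact ⟨i, j, hij, rfl⟩
      simp only [g, min_eq_left h₁.le, max_eq_right h₁.le, h₂, hb]
    · have hb : b (h j, h i) = false := by
        simp only [b, decide_eq_false_iff_not]
        rintro ⟨i', j', hij', heq⟩
        simp only [Prod.mk.injEq] at heq
        rw [← hinj heq.1, ← hinj heq.2] at hij'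
        exact hij'.not_gt hij
      simp only [g, min_eq_right h₁.le, max_eq_left h₁.le, h₂, hb]
  have := card_filter_agree_on (P.image g) b
  rw [hcard, Fintype.card_prod, Fintype.card_fin] at this
  calc _ ≤ _ := Nat.mul_le_mul_right _ (Finset.card_le_card hsub)
    _ = _ := this

/-- If `m ^ t < 2 ^ (t choose 2)`, some tournament on `m` vertices has no transitive
subtournament on `t` vertices. -/
theorem exists_tournament_no_transitive {m t : ℕ} (hmt : m ^ t < 2 ^ t.choose 2) :
    ∃ c : Fin m × Fin m → Bool,
      ∀ h : Fin t → Fin m, ¬ ∀ i j, i < j → tournamentOf c (h i) (h j) := by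
  by_contra! hcon
  have hcover : (Finset.univ : Finset (Fin m × Fin m → Bool)) ⊆
      (Finset.univ : Finset (Fin t → Fin m)).biUnion fun h =>
        Finset.univ.filter fun c => ∀ i j, i < j → tournamentOf c (h i) (h j) := by
    intro c _
    obtain ⟨h, hh⟩ := hcon c
    simp only [Finset.mem_biUnion, Finset.mem_univ, Finset.mem_filter, true_and]
    exact ⟨h, hh⟩
  have h₁ := (Finset.card_le_card hcover).trans Finset.card_biUnion_le
  have h₂ : (∑ h : Fin t → Fin m, (Finset.univ.filter fun c : Fin m × Fin m → Bool =>
      ∀ i j, i < j → tournamentOf c (h i) (h j)).card) * 2 ^ t.choose 2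
      ≤ m ^ t * 2 ^ (m * m) := by
    rw [Finset.sum_mul]
    refine (Finset.sum_le_card_nsmul _ _ (2 ^ (m * m)) fun h _ => ?_).trans ?_
    · exact card_transitive_le h
    · simp
  have h₃ : (Finset.univ : Finset (Fin m × Fin m → Bool)).card = 2 ^ (m * m) := by simp
  rw [h₃] at h₁
  have h₄ := (Nat.mul_le_mul_right (2 ^ t.choose 2) h₁).trans h₂
  rw [mul_comm] at h₄
  exact hmt.not_ge (Nat.le_of_mul_le_mul_right h₄ (by positivity))

/-- Two copies of a relation, with the relation reversed between the copies. -/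
def doubled {V : Type*} (T : V → V → Prop) (x y : V × Bool) : Prop :=
  if x.2 = y.2 then T x.1 y.1 else T y.1 x.1

theorem doubled_asymm {V : Type*} {T : V → V → Prop} (hT : ∀ u v, T u v → ¬ T v u)
    {x y : V × Bool} (h : doubled T x y) : ¬ doubled T y x := by
  unfold doubled at *
  by_cases hxy : x.2 = y.2
  · simp only [hxy, if_true] at *
    exact hT _ _ h
  · simp only [hxy, Ne.symm hxy, if_false] at *
    exact hT _ _ h

/-- Every vertex of the double of a tournament has an out-neighbour over each other base vertex. -/
theorem exists_doubled_out {V : Type*} {T : V → V → Prop} (hT : ∀ u v, u ≠ v → T u v ∨ T v u)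
    (x : V × Bool) {v : V} (hv : v ≠ x.1) : ∃ b, doubled T x (v, b) := by
  rcases hT _ _ hv with h | h
  · exact ⟨!x.2, by simpa [doubled] using h⟩
  · exact ⟨x.2, by simpa [doubled] using h⟩

/-- Every vertex of the double of a tournament has an in-neighbour over each other base vertex. -/
theorem exists_doubled_in {V : Type*} {T : V → V → Prop} (hT : ∀ u v, u ≠ v → T u v ∨ T v u)
    (x : V × Bool) {v : V} (hv : v ≠ x.1) : ∃ b, doubled T (v, b) x := by
  rcases hT _ _ hv with h | h
  · exact ⟨x.2, by simpa [doubled] using h⟩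
  · exact ⟨!x.2, by simpa [doubled] using h⟩

/-- A transitive sequence in the double of `T` of length over `2 * s` contains a transitive
sequence of length `s + 1` in `T`. -/
theorem exists_transitive_of_doubled {V : Type*} {T : V → V → Prop} {s l : ℕ} (hsl : 2 * s < l)
    (g : Fin l → V × Bool) (hg : ∀ i j, i < j → doubled T (g i) (g j)) :
    ∃ h : Fin (s + 1) → V, ∀ i j, i < j → T (h i) (h j) := by
  obtain ⟨b, -, hb⟩ := Finset.exists_lt_card_fiber_of_mul_lt_card_of_maps_to
    (s := (Finset.univ : Finset (Fin l))) (t := (Finset.univ : Finset Bool))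
    (f := fun i => (g i).2) (n := s) (fun _ _ => Finset.mem_univ _) (by simpa using hsl)
  set S := Finset.univ.filter fun i => (g i).2 = b
  let e := S.orderEmbOfCardLe (Nat.succ_le_of_lt hb)
  have he : ∀ i, (g (e i)).2 = b := fun i => by
    have := S.orderEmbOfCardLe_mem (Nat.succ_le_of_lt hb) i
    simpa [S] using this
  refine ⟨fun i => (g (e i)).1, fun i j hij => ?_⟩
  have := hg _ _ (e.strictMono hij)
  simpa [doubled, he] using this

/-- A set containing all `q` points `φ (w, i)` of a blow-up, for each `w` in the range of an
injection `a` from `ι`, has at least `card ι * q` elements. -/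
theorem mul_le_ncard_of_fibers {W ι : Type*} [Fintype ι] {n q : ℕ} (φ : W × Fin q → Fin n)
    (hφ : Function.Injective φ) (D : Set (Fin n)) (a : ι → W) (ha : Function.Injective a)
    (hD : ∀ x i, φ (a x, i) ∈ D) : Fintype.card ι * q ≤ D.ncard := by
  have hinj : Function.Injective fun y : ι × Fin q => φ (a y.1, y.2) := by
    intro y z hyz
    have := hφ hyz
    simp only [Prod.mk.injEq] at this
    exact Prod.ext (ha this.1) this.2
  calc Fintype.card ι * q = (Set.range fun y : ι × Fin q => φ (a y.1, y.2)).ncard := by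
        rw [← Set.image_univ, Set.ncard_image_of_injective _ hinj, Set.ncard_univ]
        simp
    _ ≤ D.ncard := by
        refine Set.ncard_le_ncard ?_ (Set.toFinite D)
        rintro _ ⟨y, rfl⟩
        exact hD _ _

/-- `Fin n` maps to a set of size `M` with a family of `n / M` disjoint sections. -/
theorem exists_equitable_map {W : Type*} [Fintype W] [Nonempty W] (n : ℕ) :
    ∃ (p : Fin n → W) (φ : W × Fin (n / Fintype.card W) → Fin n),
      Function.Injective φ ∧ ∀ y, p (φ y) = y.1 := by
  let e := Fintype.equivFin W
  have hM : 0 < Fintype.card W := Fintype.card_pos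
  set M := Fintype.card W
  have hlt : ∀ y : W × Fin (n / M), (e y.1 : ℕ) + M * y.2 < n := fun y => by
    have h₁ : (e y.1 : ℕ) < M := (e y.1).isLt
    have h₂ : M * (y.2 + 1) ≤ M * (n / M) := Nat.mul_le_mul_left _ y.2.isLt
    have h₃ := Nat.mul_div_le n M
    rw [mul_add] at h₂
    omega
  have hmod : ∀ y : W × Fin (n / M), ((e y.1 : ℕ) + M * y.2) % M = e y.1 := fun y => by
    rw [Nat.add_mul_mod_self_left, Nat.mod_eq_of_lt (e y.1).isLt]
  refine ⟨fun v => e.symm ⟨v % M, Nat.mod_lt _ hM⟩, fun y => ⟨e y.1 + M * y.2, hlt y⟩, ?_, ?_⟩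
  · intro y z hyz
    simp only [Fin.mk.injEq] at hyz
    have h₁ : (e y.1 : ℕ) = e z.1 := by rw [← hmod y, hyz, hmod z]
    have h₂ : M * (y.2 : ℕ) = M * z.2 := by omega
    exact Prod.ext (e.injective (Fin.ext h₁)) (Fin.ext (Nat.eq_of_mul_eq_mul_left hM h₂))
  · intro y
    simp only [hmod]
    simp

theorem containsTransTournament_of_hasPowHamCycle {n k : ℕ} (hkn : k < n)
    {G : Fin n → Fin n → Prop} (h : HasPowHamCycle k G) : ContainsTransTournament G (k + 1) := by
  obtain ⟨f, hf⟩ := h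
  refine ⟨fun i => f ⟨i, by omega⟩, fun i j hij => ?_, fun i j hij => ?_⟩
  · have := f.injective hij
    simp only [Fin.mk.injEq] at this
    exact Fin.ext this
  · have hij' : (i : ℕ) < j := hij
    have := hf ⟨i, by omega⟩ (j - i) (by omega) (by omega)
    have hj : ((i : ℕ) + (j - i)) % n = j := by
      rw [Nat.add_sub_cancel' hij'.le, Nat.mod_eq_of_lt (by omega)]
    simpa only [hj] using this

/-- Blowing up the double of a tournament on `m` vertices without transitive subtournaments on
`s + 1` vertices. -/
theorem exists_oriented_of_pow_lt {m s k : ℕ} (hm : 0 < m)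
    (hms : m ^ (s + 1) < 2 ^ (s + 1).choose 2) (hsk : 2 * s ≤ k) (n : ℕ) :
    ∃ G : Fin n → Fin n → Prop, IsOriented G ∧
      (∀ v, (m - 1) * (n / (2 * m)) ≤ min (outDeg G v) (inDeg G v)) ∧
      ¬ ContainsTransTournament G (k + 1) := by
  obtain ⟨c, hc⟩ := exists_tournament_no_transitive hms
  have : NeZero m := ⟨hm.ne'⟩
  obtain ⟨p, φ, hφ, hpφ⟩ := exists_equitable_map (W := Fin m × Bool) n
  have hW : Fintype.card (Fin m × Bool) = 2 * m := by simp [mul_comm]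
  have hcard : ∀ u : Fin m, Fintype.card {v : Fin m // v ≠ u} = m - 1 := by simp
  refine ⟨fun u v => doubled (tournamentOf c) (p u) (p v), ?_, fun v => le_min ?_ ?_, ?_⟩
  · exact fun u v h => doubled_asymm (fun _ _ => tournamentOf_asymm) h
  · choose b hb using fun w : {w : Fin m // w ≠ (p v).1} =>
      exists_doubled_out (T := tournamentOf c) (fun _ _ => tournamentOf_total c) (p v) w.2
    rw [← hcard (p v).1, ← hW]
    refine mul_le_ncard_of_fibers φ hφ _ (fun w => (w.1, b w)) ?_ fun x i => ?_
    · exact fun x y hxy => Subtype.ext (congrArg Prod.fst hxy)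
    · simpa [hpφ] using hb x
  · choose b hb using fun w : {w : Fin m // w ≠ (p v).1} =>
      exists_doubled_in (T := tournamentOf c) (fun _ _ => tournamentOf_total c) (p v) w.2
    rw [← hcard (p v).1, ← hW]
    refine mul_le_ncard_of_fibers φ hφ _ (fun w => (w.1, b w)) ?_ fun x i => ?_
    · exact fun x y hxy => Subtype.ext (congrArg Prod.fst hxy)
    · simpa [hpφ] using hb x
  · rintro ⟨f, -, hf⟩
    obtain ⟨h, hh⟩ := exists_transitive_of_doubled (s := s) (by omega) (fun i => p (f i)) hf
    exact hc h hh

/-- For every `k ≥ 15` and all sufficiently large `n` there is an `n`-vertex oriented graph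
with minimum semi-degree greater than `(1/2 - 4/2^(k/5))n` containing no copy of the
transitive tournament on `k+1` vertices, hence no `k`-th power of a Hamilton cycle. -/
theorem statement_2 (k : ℕ) (hk : 15 ≤ k) :
    ∃ N : ℕ, ∀ n : ℕ, N ≤ n →
      ∃ G : Fin n → Fin n → Prop, IsOriented G ∧
        (∀ v, (1/2 - 4/(2:ℝ)^((k:ℝ)/5)) * n < ((min (outDeg G v) (inDeg G v) : ℕ) : ℝ)) ∧
        ¬ ContainsTransTournament G (k+1) ∧
        ¬ HasPowHamCycle k G := by
  set s := k / 2 with hs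
  set a := (s - 1) / 2 with ha
  set m := 2 ^ a with hm
  have hm0 : 0 < m := by positivity
  have hpow : m ^ (s + 1) < 2 ^ (s + 1).choose 2 := by
    rw [hm, ← pow_mul, Nat.choose_two_right, Nat.add_sub_cancel]
    refine Nat.pow_lt_pow_right (by norm_num) ?_
    have h₁ : (s + 1) * (2 * a + 1) ≤ (s + 1) * s := Nat.mul_le_mul_left _ (by omega)
    have h₂ : (s + 1) * (2 * a + 1) = 2 * (a * (s + 1)) + (s + 1) := by ring
    omega
  have hmR : (0 : ℝ) < m := by exact_mod_cast hm0
  set ε : ℝ := 4 / (2 : ℝ) ^ ((k : ℝ) / 5) - 1 / (2 * m) with hε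
  have hεpos : 0 < ε := by
    have h₁ : (2 : ℝ) ^ ((k : ℝ) / 5) < 8 * m := by
      have h₂ : (8 * m : ℝ) = (2 : ℝ) ^ ((a + 3 : ℕ) : ℝ) := by
        rw [Real.rpow_natCast, hm]
        push_cast
        ring
      rw [h₂]
      refine Real.rpow_lt_rpow_of_exponent_lt (by norm_num) ?_
      have h₃ : k < 5 * (a + 3) := by omega
      have h₄ : (k : ℝ) < 5 * ((a + 3 : ℕ) : ℝ) := by exact_mod_cast h₃
      linarith
    rw [hε, sub_pos, div_lt_div_iff₀ (by positivity) (by positivity)]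
    linarith
  obtain ⟨N, hN⟩ := exists_nat_gt (m / ε)
  refine ⟨N + k + 1, fun n hn => ?_⟩
  obtain ⟨G, hG, hdeg, hT⟩ := exists_oriented_of_pow_lt (k := k) hm0 hpow (by omega) n
  refine ⟨G, hG, fun v => ?_, hT,
    fun h => hT (containsTransTournament_of_hasPowHamCycle (by omega) h)⟩
  have hnN : (N : ℝ) ≤ n := by exact_mod_cast (by omega : N ≤ n)
  have hεn : (m : ℝ) < n * ε := (div_lt_iff₀ hεpos).mp (hN.trans_le hnN)
  have hq : (n : ℝ) / (2 * m) - 1 ≤ ((n / (2 * m) : ℕ) : ℝ) := by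
    have := Nat.lt_floor_add_one ((n : ℝ) / ((2 * m : ℕ) : ℝ))
    rw [Nat.floor_div_natCast, Nat.floor_natCast] at this
    push_cast at this
    linarith
  have hm1 : (0 : ℝ) ≤ m - 1 := by
    have : (1 : ℝ) ≤ m := by exact_mod_cast hm0
    linarith
  have hdegR : ((m : ℝ) - 1) * ((n / (2 * m) : ℕ) : ℝ)
      ≤ ((min (outDeg G v) (inDeg G v) : ℕ) : ℝ) := by
    have := hdeg v
    rw [← Nat.cast_pred hm0]
    exact_mod_cast this
  refine lt_of_lt_of_le ?_ ((mul_le_mul_of_nonneg_left hq hm1).trans hdegR)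
  have h₅ : ((m : ℝ) - 1) * (n / (2 * m) - 1) = (1 / 2 - 1 / (2 * m)) * n - (m - 1) := by
    field_simp
  rw [h₅]
  have h₆ : (1 / 2 - 4 / (2 : ℝ) ^ ((k : ℝ) / 5)) * n = (1 / 2 - 1 / (2 * m)) * n - n * ε := by
    rw [hε]
    ring
  rw [h₆]
  linarith

end Paper
end

section
/- For every n ∈ ℕ divisible by 11, there exists an n-vertex oriented graph G₂ with minimum semi-degree δ⁰(G₂) ≥ 5n/11 − 2 that does not contain the square of a Hamilton cycle. -/
namespace Paper

/-- The blow-up of a directed triangle with the relations `R`, `S`, `T` placed inside its three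
parts: all edges go from the first part to the second, from the second to the third and from the
third to the first. -/
def triangleJoin {A B C : Type*} (R : A → A → Prop) (S : B → B → Prop) (T : C → C → Prop) :
    A ⊕ (B ⊕ C) → A ⊕ (B ⊕ C) → Prop
  | .inl a, .inl a' => R a a'
  | .inl _, .inr (.inl _) => True
  | .inl _, .inr (.inr _) => False
  | .inr (.inl _), .inl _ => False
  | .inr (.inl b), .inr (.inl b') => S b b'
  | .inr (.inl _), .inr (.inr _) => True
  | .inr (.inr _), .inl _ => True
  | .inr (.inr _), .inr (.inl _) => False
  | .inr (.inr c), .inr (.inr c') => T c c'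

/-- The circulant oriented graph on `ZMod k` in which `u` dominates the next `⌊(k - 1) / 2⌋`
elements. -/
def circulant (k : ℕ) (u v : ZMod k) : Prop :=
  ∃ j ∈ Finset.Icc 1 ((k - 1) / 2), v = u + (j : ZMod k)

/-- The blow-up of a directed triangle with independent parts of sizes `p`, `q`, `r`. -/
abbrev triangleBlowup (p q r : ℕ) : Fin p ⊕ (Fin q ⊕ Fin r) → Fin p ⊕ (Fin q ⊕ Fin r) → Prop :=
  triangleJoin (fun _ _ => False) (fun _ _ => False) (fun _ _ => False)

section Degrees

variable {A B C : Type*} [Finite A] [Finite B] [Finite C]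

lemma ncard_sum (t : Set (A ⊕ B)) :
    t.ncard = (Sum.inl ⁻¹' t).ncard + (Sum.inr ⁻¹' t).ncard := by
  conv_lhs => rw [← Set.image_preimage_inl_union_image_preimage_inr t]
  rw [Set.ncard_union_eq, Set.ncard_image_of_injective _ Sum.inl_injective,
    Set.ncard_image_of_injective _ Sum.inr_injective]
  rw [Set.disjoint_left]
  rintro _ ⟨x, -, rfl⟩ ⟨y, -, h⟩
  cases h

lemma ncard_sum_sum (s : Set (A ⊕ (B ⊕ C))) :
    s.ncard = {a | Sum.inl a ∈ s}.ncard + {b | Sum.inr (Sum.inl b) ∈ s}.ncard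
      + {c | Sum.inr (Sum.inr c) ∈ s}.ncard := by
  rw [ncard_sum s, ncard_sum (Sum.inr ⁻¹' s), add_assoc]
  rfl

variable (R : A → A → Prop) (S : B → B → Prop) (T : C → C → Prop)

lemma triangleJoin_out_fst (a : A) :
    {w | triangleJoin R S T (.inl a) w}.ncard = {w | R a w}.ncard + Nat.card B := by
  simp [ncard_sum_sum, triangleJoin, Set.ncard_univ]

lemma triangleJoin_out_snd (b : B) :
    {w | triangleJoin R S T (.inr (.inl b)) w}.ncard = {w | S b w}.ncard + Nat.card C := by
  simp [ncard_sum_sum, triangleJoin, Set.ncard_univ]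

lemma triangleJoin_out_trd (c : C) :
    {w | triangleJoin R S T (.inr (.inr c)) w}.ncard = {w | T c w}.ncard + Nat.card A := by
  simp [ncard_sum_sum, triangleJoin, Set.ncard_univ, add_comm]

lemma triangleJoin_in_fst (a : A) :
    {w | triangleJoin R S T w (.inl a)}.ncard = {w | R w a}.ncard + Nat.card C := by
  simp [ncard_sum_sum, triangleJoin, Set.ncard_univ]

lemma triangleJoin_in_snd (b : B) :
    {w | triangleJoin R S T w (.inr (.inl b))}.ncard = {w | S w b}.ncard + Nat.card A := by
  simp [ncard_sum_sum, triangleJoin, Set.ncard_univ, add_comm]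

lemma triangleJoin_in_trd (c : C) :
    {w | triangleJoin R S T w (.inr (.inr c))}.ncard = {w | T w c}.ncard + Nat.card B := by
  simp [ncard_sum_sum, triangleJoin, Set.ncard_univ, add_comm]

end Degrees

lemma triangleJoin_asymm {A B C : Type*} {R : A → A → Prop} {S : B → B → Prop} {T : C → C → Prop}
    (hR : ∀ u v, R u v → ¬ R v u) (hS : ∀ u v, S u v → ¬ S v u) (hT : ∀ u v, T u v → ¬ T v u) :
    ∀ u v, triangleJoin R S T u v → ¬ triangleJoin R S T v u := by
  rintro (a | b | c) (a' | b' | c') <;> simp [triangleJoin] <;> solve_by_elim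

lemma circulant_asymm (k : ℕ) (u v : ZMod k) (h : circulant k u v) : ¬ circulant k v u := by
  rintro ⟨j, hj, rfl⟩
  obtain ⟨i, hi, hv⟩ := h
  rw [Finset.mem_Icc] at hi hj
  have h0 : ((j + i : ℕ) : ZMod k) = 0 := by
    push_cast
    linear_combination -hv
  have := Nat.le_of_dvd (by omega) ((ZMod.natCast_eq_zero_iff _ _).1 h0)
  omega

lemma natCast_injOn_Icc (k : ℕ) :
    Set.InjOn (fun j : ℕ => (j : ZMod k)) (Finset.Icc 1 ((k - 1) / 2) : Set ℕ) := by
  intro i hi j hj h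
  simp only [Finset.coe_Icc, Set.mem_Icc] at hi hj
  have h' := (ZMod.natCast_eq_natCast_iff' _ _ _).1 h
  rwa [Nat.mod_eq_of_lt (by omega), Nat.mod_eq_of_lt (by omega)] at h'

lemma circulant_out (k : ℕ) (u : ZMod k) : {w | circulant k u w}.ncard = (k - 1) / 2 := by
  have : {w | circulant k u w} =
      (fun j : ℕ => u + (j : ZMod k)) '' (Finset.Icc 1 ((k - 1) / 2) : Set ℕ) := by
    ext w
    simp [circulant, eq_comm]
  rw [this, Set.InjOn.ncard_image, Set.ncard_coe_finset, Nat.card_Icc, Nat.add_sub_cancel]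
  intro i hi j hj h
  exact natCast_injOn_Icc k hi hj (add_left_cancel h)

lemma circulant_in (k : ℕ) (u : ZMod k) : {w | circulant k w u}.ncard = (k - 1) / 2 := by
  have : {w | circulant k w u} =
      (fun j : ℕ => u - (j : ZMod k)) '' (Finset.Icc 1 ((k - 1) / 2) : Set ℕ) := by
    ext w
    simp [circulant, sub_eq_iff_eq_add]
  rw [this, Set.InjOn.ncard_image, Set.ncard_coe_finset, Nat.card_Icc, Nat.add_sub_cancel]
  intro i hi j hj h
  exact natCast_injOn_Icc k hi hj (sub_right_injective h)

lemma triangleBlowup_not_transitive {p q r : ℕ} (u v w : Fin p ⊕ (Fin q ⊕ Fin r)) :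
    triangleBlowup p q r u v → triangleBlowup p q r v w → ¬ triangleBlowup p q r u w := by
  rcases u with u | u | u <;> rcases v with v | v | v <;> rcases w with w | w | w <;>
    simp [triangleBlowup, triangleJoin]

lemma le_triangleBlowup_out {p q r d : ℕ} (hp : d ≤ p) (hq : d ≤ q) (hr : d ≤ r) (u) :
    d ≤ {w | triangleBlowup p q r u w}.ncard := by
  rcases u with u | u | u
  · simpa [triangleJoin_out_fst] using hq
  · simpa [triangleJoin_out_snd] using hr
  · simpa [triangleJoin_out_trd] using hp

lemma le_triangleBlowup_in {p q r d : ℕ} (hp : d ≤ p) (hq : d ≤ q) (hr : d ≤ r) (u) :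
    d ≤ {w | triangleBlowup p q r w u}.ncard := by
  rcases u with u | u | u
  · simpa [triangleJoin_in_fst] using hr
  · simpa [triangleJoin_in_snd] using hp
  · simpa [triangleJoin_in_trd] using hq

/-- If `X` spans no transitive triangle, and the square of a cycle cannot leave `X` immediately
after entering it, then the square of a Hamilton cycle meets `X` in runs of length exactly two. -/
lemma HasPowHamCycle.even_ncard {n : ℕ} [NeZero n] {G : Fin n → Fin n → Prop}
    (h : HasPowHamCycle 2 G) (X : Set (Fin n))
    (henter : ∀ u v w, u ∉ X → v ∈ X → G u v → G v w → G u w → w ∈ X)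
    (htrans : ∀ u v w, u ∈ X → v ∈ X → w ∈ X → G u v → G v w → ¬ G u w) :
    Even X.ncard := by
  obtain ⟨f, hf⟩ := h
  have h1 (i : Fin n) : G (f i) (f (i + 1)) := by
    convert hf i 1 le_rfl one_le_two using 2
    simp [Fin.ext_iff, Fin.val_add]
  have h2 (i : Fin n) : G (f i) (f (i + 1 + 1)) := by
    convert hf i 2 one_le_two le_rfl using 2
    simp [Fin.ext_iff, Fin.val_add, add_assoc]
  set S : Set (Fin n) := f ⁻¹' X with hS
  set E : Set (Fin n) := {i | i ∉ S ∧ i + 1 ∈ S}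
  have hunion : S = (· + 1) '' E ∪ (· + 1 + 1) '' E := by
    ext j
    constructor
    · intro hj
      by_cases hj1 : j - 1 ∈ S
      · refine Or.inr ⟨j - 1 - 1, ⟨fun hj2 => ?_, by simpa using hj1⟩, by simp⟩
        refine htrans (f (j - 1 - 1)) (f (j - 1)) (f j) hj2 hj1 hj ?_ ?_ ?_
        · simpa using h1 (j - 1 - 1)
        · simpa using h1 (j - 1)
        · simpa using h2 (j - 1 - 1)
      · exact Or.inl ⟨j - 1, ⟨hj1, by simpa using hj⟩, by simp⟩
    · rintro (⟨i, hi, rfl⟩ | ⟨i, hi, rfl⟩)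
      · exact hi.2
      · exact henter _ _ _ hi.1 hi.2 (h1 i) (h1 (i + 1)) (h2 i)
  have hdisj : Disjoint ((· + 1) '' E) ((· + 1 + 1) '' E) := by
    rw [Set.disjoint_left]
    rintro _ ⟨i, hi, rfl⟩ ⟨j, hj, hij⟩
    exact hi.1 (add_right_cancel hij ▸ hj.2)
  have hcard : X.ncard = S.ncard := by
    rw [hS, Set.ncard_preimage_of_injective_subset_range f.injective (by simp)]
  rw [hcard, hunion, Set.ncard_union_eq hdisj,
    Set.ncard_image_of_injective _ (add_left_injective 1),
    Set.ncard_image_of_injective (f := (· + 1 + 1)) _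
      ((add_left_injective 1).comp (add_left_injective 1))]
  exact ⟨_, rfl⟩

lemma ncard_setOf_equiv {α β : Type*} (e : α ≃ β) (P : β → Prop) :
    {x | P (e x)}.ncard = {y | P y}.ncard :=
  Set.ncard_preimage_of_injective_subset_range e.injective
    (by rw [e.range_eq_univ]; exact Set.subset_univ _)

/-- For every positive `n` divisible by `11`, there is an `n`-vertex oriented graph with
minimum semi-degree at least `5n/11 - 2` not containing the square of a Hamilton cycle. -/
theorem statement_3 (n : ℕ) (hn : 0 < n) (h11 : 11 ∣ n) :
    ∃ G : Fin n → Fin n → Prop, IsOriented G ∧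
      (∀ v, 5 * (n:ℝ) / 11 - 2 ≤ ((min (outDeg G v) (inDeg G v) : ℕ) : ℝ)) ∧
      ¬ HasPowHamCycle 2 G := by
  obtain ⟨m, rfl⟩ := h11
  obtain ⟨t, ht, hodd⟩ : ∃ t ≤ 1, Odd (m + t) := by
    rcases m.even_or_odd with h | h
    · exact ⟨1, le_rfl, h.add_one⟩
    · exact ⟨0, zero_le_one, h⟩
  have : NeZero (11 * m) := ⟨hn.ne'⟩
  have : NeZero (4 * m) := ⟨by omega⟩
  have : NeZero (4 * m - t) := ⟨by omega⟩
  let J := triangleJoin (circulant (4 * m)) (circulant (4 * m - t)) (triangleBlowup m m (m + t))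
  have hout (v) : 5 * m ≤ {w | J v w}.ncard + 2 := by
    rcases v with a | b | c
    · simp only [J, triangleJoin_out_fst, circulant_out, Nat.card_zmod]
      omega
    · simp only [J, triangleJoin_out_snd, circulant_out, Nat.card_sum, Nat.card_fin]
      omega
    · have := le_triangleBlowup_out (d := m) le_rfl le_rfl (Nat.le_add_right m t) c
      simp only [J, triangleJoin_out_trd, Nat.card_zmod]
      omega
  have hin (v) : 5 * m ≤ {w | J w v}.ncard + 2 := by
    rcases v with a | b | c
    · simp only [J, triangleJoin_in_fst, circulant_in, Nat.card_sum, Nat.card_fin]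
      omega
    · simp only [J, triangleJoin_in_snd, circulant_in, Nat.card_zmod]
      omega
    · have := le_triangleBlowup_in (d := m) le_rfl le_rfl (Nat.le_add_right m t) c
      simp only [J, triangleJoin_in_trd, Nat.card_zmod]
      omega
  have hJ : ∀ u v, J u v → ¬ J v u :=
    triangleJoin_asymm (circulant_asymm _) (circulant_asymm _)
      (triangleJoin_asymm (by simp) (by simp) (by simp))
  let e : Fin (11 * m) ≃ ZMod (4 * m) ⊕ (ZMod (4 * m - t) ⊕ (Fin m ⊕ (Fin m ⊕ Fin (m + t)))) :=
    (Fintype.equivFinOfCardEq (by simp [ZMod.card]; omega)).symm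
  refine ⟨fun u v => J (e u) (e v), fun u v => hJ _ _, fun v => ?_, fun hham => ?_⟩
  · have h : 5 * m ≤ min (outDeg (fun u v => J (e u) (e v)) v)
        (inDeg (fun u v => J (e u) (e v)) v) + 2 := by
      have h1 := hout (e v)
      have h2 := hin (e v)
      rw [← ncard_setOf_equiv e] at h1 h2
      rw [outDeg, inDeg]
      omega
    have h' : (5 * m : ℝ) ≤ (min (outDeg (fun u v => J (e u) (e v)) v)
        (inDeg (fun u v => J (e u) (e v)) v) : ℕ) + 2 := by exact_mod_cast h
    push_cast at h' ⊢
    linarith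
  · have heven := hham.even_ncard {i | ∃ c, e i = .inr (.inr c)} ?_ ?_
    · rw [ncard_setOf_equiv e (fun y => ∃ c, y = .inr (.inr c)), ncard_sum_sum] at heven
      simp [-Sum.exists, Set.ncard_univ] at heven
      rw [Nat.even_iff] at heven
      rw [Nat.odd_iff] at hodd
      omega
    · intro u v w
      simp only [Set.mem_ofPred_eq]
      generalize e u = x
      generalize e v = y
      generalize e w = z
      rcases x with x | x | x <;> rcases y with y | y | y <;> rcases z with z | z | z <;>
        simp [J, triangleJoin]
    · rintro u v w ⟨x, hx⟩ ⟨y, hy⟩ ⟨z, hz⟩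
      simp only [hx, hy, hz]
      exact triangleBlowup_not_transitive x y z

end Paper
end
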